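/- arXiv:math/0301343 — 2 statements merged into one kernel-verified Lean document; each statement's English description precedes it below -/
import Mathlib

section
/- For every α with 0 < α < 2 there exist ε = ε(α) > 0 and C = C(α) > 0 such that: for every prime q, with F = ℤ/qℤ, every set P of projective points (one-dimensional linear subspaces of F³) and every set L of projective lines (two-dimensional linear subspaces of F³) with |P| ≤ |F|^α and |L| ≤ |F|^α, the number of incidences satisfies |{(p, l) ∈ P × L : p ⊆ l}| ≤ C·(|F|^α)^{3/2 − ε}. -/
section

open Finset
open scoped Pointwise

theorem card_filter_product_eq_sum {V W : Type*} (X : Finset V) (Y : Finset W)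
    (r : V → W → Prop) [∀ x, DecidablePred (r x)]
    [DecidablePred fun p : V × W => r p.1 p.2] :
    ((#{p ∈ X ×ˢ Y | r p.1 p.2} : ℕ) : ℝ) = ∑ x ∈ X, ((#{y ∈ Y | r x y} : ℕ) : ℝ) := by
  simp only [card_filter, sum_product, Nat.cast_sum]
  congr! 6

theorem sum_card_filter_comm {V W : Type*} (X : Finset V) (Y : Finset W)
    (r : V → W → Prop) [∀ x, DecidablePred (r x)] [∀ y, DecidablePred fun x => r x y] :
    ∑ x ∈ X, ((#{y ∈ Y | r x y} : ℕ) : ℝ) = ∑ y ∈ Y, ((#{x ∈ X | r x y} : ℕ) : ℝ) := by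
  simp only [card_filter, Nat.cast_sum]
  exact sum_comm

/-- Discarding the terms below a threshold `θ` costs at most `#s * θ`. -/
theorem sum_le_sum_filter_add {ι : Type*} (s : Finset ι) (f : ι → ℝ) {θ : ℝ} (hθ : 0 ≤ θ) :
    ∑ i ∈ s, f i ≤ ∑ i ∈ s with θ ≤ f i, f i + #s * θ := by
  rw [← sum_filter_add_sum_filter_not s (fun i => θ ≤ f i)]
  gcongr
  calc ∑ i ∈ s with ¬ θ ≤ f i, f i ≤ ∑ i ∈ s with ¬ θ ≤ f i, θ := by
        apply sum_le_sum
        intro i hi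
        exact (not_le.1 (mem_filter.1 hi).2).le
    _ ≤ #s * θ := by
        rw [sum_const, nsmul_eq_mul]
        gcongr
        exact filter_subset _ _

theorem sum_le_card_filter_mul_add {ι : Type*} (s : Finset ι) (f : ι → ℝ) {θ M : ℝ}
    (hθ : 0 ≤ θ) (hM : ∀ i ∈ s, f i ≤ M) :
    ∑ i ∈ s, f i ≤ #{i ∈ s | θ ≤ f i} * M + #s * θ := by
  refine (sum_le_sum_filter_add s f hθ).trans ?_
  gcongr
  rw [← nsmul_eq_mul, ← sum_const]
  exact sum_le_sum fun i hi => hM i (mem_filter.1 hi).1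

set_option maxHeartbeats 1000000 in
open scoped Classical in
/-- Dependent random choice: a dense bipartite graph contains a large set of vertices of large
degree, most pairs of which have many common neighbours. -/
theorem exists_large_subset_few_bad_pairs {V W : Type*} (X : Finset V) (Y : Finset W)
    (r : V → W → Prop) {n K : ℝ} (hn : 0 < n) (hK : 0 < K) (hX : #X ≤ n) (hY : #Y ≤ n)
    (hE : n ^ 2 ≤ K * #{p ∈ X ×ˢ Y | r p.1 p.2}) :
    ∃ A ⊆ X, (∀ x ∈ A, n / (2 * K) ≤ (#{y ∈ Y | r x y} : ℝ)) ∧ n ≤ 3 * K * #A ∧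
      16 * K * (∑ x ∈ A,
        (#{x' ∈ A | (#{y ∈ Y | r x y ∧ r x' y} : ℝ) < n / (128 * K ^ 3)} : ℝ)) ≤
        (#A : ℝ) ^ 2 := by
  have e₁ : n ^ 2 / K = n ^ 2 / (2 * K) + n * (n / (2 * K)) := by field_simp; ring
  have e₂ : (n ^ 2 / (2 * K)) ^ 2 = n * (n ^ 3 / (4 * K ^ 2)) := by field_simp; ring
  have e₃ : n ^ 3 / (4 * K ^ 2) =
      n * (n ^ 2 / (8 * K ^ 2)) + 16 * K * (n ^ 3 / (128 * K ^ 3)) := by field_simp; norm_num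
  set X₁ : Finset V := {x ∈ X | n / (2 * K) ≤ (#{y ∈ Y | r x y} : ℝ)} with hX₁
  have hX₁X : X₁ ⊆ X := filter_subset _ _
  have hX₁n : (#X₁ : ℝ) ≤ n := le_trans (by exact_mod_cast card_le_card hX₁X) hX
  set U : W → Finset V := fun y => {x ∈ X₁ | r x y} with hU
  have hU1 : n ^ 2 / (2 * K) ≤ ∑ y ∈ Y, (#(U y) : ℝ) := by
    rw [hU, ← sum_card_filter_comm]
    have h := sum_le_sum_filter_add X (fun x => (#{y ∈ Y | r x y} : ℝ))
      (θ := n / (2 * K)) (by positivity)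
    rw [← card_filter_product_eq_sum] at h
    have h2 : (#X : ℝ) * (n / (2 * K)) ≤ n * (n / (2 * K)) := by gcongr
    have h3 : n ^ 2 / K ≤ (#{p ∈ X ×ˢ Y | r p.1 p.2} : ℝ) := by
      rw [div_le_iff₀ hK]; linarith
    linarith
  have hU2 : n ^ 3 / (4 * K ^ 2) ≤ ∑ y ∈ Y, (#(U y) : ℝ) ^ 2 := by
    have h := sq_sum_le_card_mul_sum_sq (s := Y) (f := fun y => (#(U y) : ℝ))
    have h2 : (n ^ 2 / (2 * K)) ^ 2 ≤ (∑ y ∈ Y, (#(U y) : ℝ)) ^ 2 := by gcongr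
    have h3 : (#Y : ℝ) * ∑ y ∈ Y, (#(U y) : ℝ) ^ 2 ≤ n * ∑ y ∈ Y, (#(U y) : ℝ) ^ 2 :=
      mul_le_mul_of_nonneg_right hY (sum_nonneg fun _ _ => sq_nonneg _)
    exact le_of_mul_le_mul_left (by linarith) hn
  set bad : V → V → Prop := fun x x' => (#{y ∈ Y | r x y ∧ r x' y} : ℝ) < n / (128 * K ^ 3)
    with hbad
  have hB : ∑ y ∈ Y, (#{p ∈ U y ×ˢ U y | bad p.1 p.2} : ℝ) ≤ n ^ 3 / (128 * K ^ 3) := by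
    have h : ∀ y ∈ Y, (#{p ∈ U y ×ˢ U y | bad p.1 p.2} : ℝ) =
        #{p ∈ {p ∈ X₁ ×ˢ X₁ | bad p.1 p.2} | r p.1 y ∧ r p.2 y} := by
      intro y _
      congr 2
      ext p
      simp only [hU, mem_filter, mem_product]
      tauto
    rw [sum_congr rfl h, ← sum_card_filter_comm _ _ (fun (p : V × V) y => r p.1 y ∧ r p.2 y)]
    calc _ ≤ ∑ p ∈ X₁ ×ˢ X₁ with bad p.1 p.2, n / (128 * K ^ 3) :=
          sum_le_sum fun p hp => (mem_filter.1 hp).2.le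
      _ ≤ (n * n) * (n / (128 * K ^ 3)) := by
          rw [sum_const, nsmul_eq_mul]
          gcongr
          calc (#{p ∈ X₁ ×ˢ X₁ | bad p.1 p.2} : ℝ) ≤ #(X₁ ×ˢ X₁) := by
                exact_mod_cast card_le_card (filter_subset _ _)
            _ ≤ n * n := by
                rw [card_product]; push_cast; gcongr
      _ = _ := by ring
  obtain ⟨y₀, hy₀, hUy⟩ : ∃ y ∈ Y, n ^ 2 / (8 * K ^ 2) ≤
      (#(U y) : ℝ) ^ 2 - 16 * K * #{p ∈ U y ×ˢ U y | bad p.1 p.2} := by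
    apply exists_le_of_sum_le
    · by_contra hne
      rw [not_nonempty_iff_eq_empty] at hne
      rw [hne, sum_empty] at hU1
      have : 0 < n ^ 2 / (2 * K) := by positivity
      linarith
    · rw [sum_sub_distrib, ← mul_sum, sum_const, nsmul_eq_mul]
      have h1 : (#Y : ℝ) * (n ^ 2 / (8 * K ^ 2)) ≤ n * (n ^ 2 / (8 * K ^ 2)) := by gcongr
      have h2 : 16 * K * ∑ y ∈ Y, (#{p ∈ U y ×ˢ U y | bad p.1 p.2} : ℝ) ≤
          16 * K * (n ^ 3 / (128 * K ^ 3)) := by gcongr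
      linarith
  set A := U y₀ with hA
  have hAX₁ : A ⊆ X₁ := filter_subset _ _
  have hA0 : 0 ≤ n ^ 2 / (8 * K ^ 2) := by positivity
  have hA1 : n ≤ 3 * K * #A := by
    have h : n ^ 2 / (8 * K ^ 2) ≤ (#A : ℝ) ^ 2 := by
      have : 0 ≤ 16 * K * (#{p ∈ A ×ˢ A | bad p.1 p.2} : ℝ) := by positivity
      linarith
    rw [div_le_iff₀ (by positivity)] at h
    refine le_of_abs_le (abs_le_of_sq_le_sq ?_ (by positivity))
    nlinarith [mul_nonneg (sq_nonneg (#A : ℝ)) (sq_nonneg K)]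
  refine ⟨A, hAX₁.trans hX₁X, fun x hx => (mem_filter.1 (hAX₁ hx)).2, hA1, ?_⟩
  rw [← card_filter_product_eq_sum]
  linarith

set_option maxHeartbeats 1000000 in
open scoped Classical in
/-- The combinatorial core of the Balog–Szemerédi–Gowers theorem: a dense bipartite graph contains
large vertex sets any two points of which are joined by many paths of length three. -/
theorem exists_large_subsets_many_paths {V W : Type*} (X : Finset V) (Y : Finset W)
    (r : V → W → Prop) {n K : ℝ} (hn : 0 < n) (hK : 0 < K) (hX : #X ≤ n) (hY : #Y ≤ n)
    (hE : n ^ 2 ≤ K * #{p ∈ X ×ˢ Y | r p.1 p.2}) :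
    ∃ X' ⊆ X, ∃ Y' ⊆ Y, n ≤ 6 * K * #X' ∧ n ≤ 4 * K * #Y' ∧ ∀ x ∈ X', ∀ y ∈ Y',
      n ^ 2 ≤ 3072 * K ^ 5 * #{p ∈ X ×ˢ Y | r x p.2 ∧ r p.1 p.2 ∧ r p.1 y} := by
  obtain ⟨A, hAX, hdeg, hA1, hAbad⟩ := exists_large_subset_few_bad_pairs X Y r hn hK hX hY hE
  set bad : V → V → Prop := fun x x' => (#{y ∈ Y | r x y ∧ r x' y} : ℝ) < n / (128 * K ^ 3)
    with hbad
  have hApos : (0 : ℝ) < #A := by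
    by_contra h
    have : (#A : ℝ) = 0 := le_antisymm (not_lt.1 h) (by positivity)
    rw [this] at hA1
    linarith
  have hAdeg : #A * (n / (2 * K)) ≤ ∑ y ∈ Y, (#{x ∈ A | r x y} : ℝ) := by
    rw [← sum_card_filter_comm, ← nsmul_eq_mul, ← sum_const]
    exact sum_le_sum hdeg
  refine ⟨{x ∈ A | ¬ (#A : ℝ) / (8 * K) ≤ #{x' ∈ A | bad x x'}},
    (filter_subset _ _).trans hAX,
    {y ∈ Y | (#A : ℝ) / (4 * K) ≤ #{x ∈ A | r x y}}, filter_subset _ _, ?_, ?_, ?_⟩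
  · have h : #{x ∈ A | (#A : ℝ) / (8 * K) ≤ #{x' ∈ A | bad x x'}} * ((#A : ℝ) / (8 * K)) ≤
        ∑ x ∈ A, (#{x' ∈ A | bad x x'} : ℝ) := by
      rw [← nsmul_eq_mul, ← sum_const]
      refine (sum_le_sum fun x hx => (mem_filter.1 hx).2).trans ?_
      exact sum_le_sum_of_subset_of_nonneg (filter_subset _ _) fun _ _ _ => by positivity
    have h2 := card_filter_add_card_filter_not (s := A)
      (fun x => (#A : ℝ) / (8 * K) ≤ #{x' ∈ A | bad x x'})
    have h2' : (#{x ∈ A | (#A : ℝ) / (8 * K) ≤ #{x' ∈ A | bad x x'}} : ℝ) +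
      #{x ∈ A | ¬ (#A : ℝ) / (8 * K) ≤ #{x' ∈ A | bad x x'}} = #A := by exact_mod_cast h2
    have h3 : (#{x ∈ A | (#A : ℝ) / (8 * K) ≤ #{x' ∈ A | bad x x'}} : ℝ) * 2 * #A ≤ #A * #A := by
      have := mul_le_mul_of_nonneg_left h (by positivity : 0 ≤ 16 * K)
      have h4 : 16 * K * (#{x ∈ A | (#A : ℝ) / (8 * K) ≤ #{x' ∈ A | bad x x'}} *
          ((#A : ℝ) / (8 * K))) =
          #{x ∈ A | (#A : ℝ) / (8 * K) ≤ #{x' ∈ A | bad x x'}} * 2 * #A := by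
        field_simp; ring
      nlinarith
    have h5 := le_of_mul_le_mul_right h3 hApos
    have h6 : (#A : ℝ) ≤ 2 * #{x ∈ A | ¬ (#A : ℝ) / (8 * K) ≤ #{x' ∈ A | bad x x'}} := by linarith
    calc n ≤ 3 * K * #A := hA1
      _ ≤ 3 * K * (2 * #{x ∈ A | ¬ (#A : ℝ) / (8 * K) ≤ #{x' ∈ A | bad x x'}}) := by gcongr
      _ = _ := by ring
  · have h := sum_le_card_filter_mul_add Y (fun y => (#{x ∈ A | r x y} : ℝ))
      (θ := (#A : ℝ) / (4 * K)) (M := #A) (by positivity)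
      (fun y _ => by exact_mod_cast card_le_card (filter_subset _ _))
    have h2 : (#Y : ℝ) * ((#A : ℝ) / (4 * K)) ≤ n * ((#A : ℝ) / (4 * K)) := by gcongr
    have h3 : #A * (n / (2 * K)) = n * ((#A : ℝ) / (4 * K)) + (n / (4 * K)) * #A := by
      field_simp; norm_num
    have h4 := le_of_mul_le_mul_right (by linarith :
      (n / (4 * K)) * #A ≤ #{y ∈ Y | (#A : ℝ) / (4 * K) ≤ #{x ∈ A | r x y}} * (#A : ℝ)) hApos
    rw [div_le_iff₀ (by positivity)] at h4
    linarith
  · intro x hx y hy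
    have hx := (mem_filter.1 hx).2
    have hy := (mem_filter.1 hy).2
    rw [not_le] at hx
    set Z := {x' ∈ A | r x' y ∧ ¬ bad x x'} with hZ
    have hZcard : (#A : ℝ) ≤ 8 * K * #Z := by
      have h : #{x ∈ A | r x y} ≤ #Z + #{x' ∈ A | bad x x'} := by
        refine (card_le_card ?_).trans (card_union_le _ _)
        intro x' hx'
        simp only [hZ, mem_union, mem_filter] at hx' ⊢
        tauto
      have h' : (#{x ∈ A | r x y} : ℝ) ≤ #Z + #{x' ∈ A | bad x x'} := by exact_mod_cast h
      have h2 : (#A : ℝ) / (4 * K) = #A / (8 * K) + #A / (8 * K) := by field_simp; norm_num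
      have h3 : (#A : ℝ) / (8 * K) ≤ #Z := by linarith
      rw [div_le_iff₀ (by positivity)] at h3
      linarith
    have hpaths : #Z * (n / (128 * K ^ 3)) ≤
        (#{p ∈ X ×ˢ Y | r x p.2 ∧ r p.1 p.2 ∧ r p.1 y} : ℝ) := by
      calc #Z * (n / (128 * K ^ 3)) ≤ ∑ x' ∈ Z, (#{y' ∈ Y | r x y' ∧ r x' y'} : ℝ) := by
            rw [← nsmul_eq_mul, ← sum_const]
            exact sum_le_sum fun x' hx' => not_lt.1 (mem_filter.1 hx').2.2
        _ = #{p ∈ Z ×ˢ Y | r x p.2 ∧ r p.1 p.2} := by rw [card_filter_product_eq_sum Z Y (fun x' y' => r x y' ∧ r x' y')]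
        _ ≤ _ := by
            norm_cast
            apply card_le_card
            intro p hp
            simp only [hZ, mem_filter, mem_product] at hp ⊢
            exact ⟨⟨hAX hp.1.1.1, hp.1.2⟩, hp.2.1, hp.2.2, hp.1.1.2.1⟩
    calc n ^ 2 ≤ n * (3 * K * (8 * K * #Z)) := by
          rw [sq]; gcongr; exact hA1.trans (by gcongr)
      _ = 3072 * K ^ 5 * (#Z * (n / (128 * K ^ 3))) := by field_simp; ring
      _ ≤ _ := by gcongr

theorem sum_card_fiber_le {α β : Type*} [DecidableEq β] (s : Finset α) (t : Finset β) (f : α → β) :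
    ∑ z ∈ t, (#{x ∈ s | f x = z} : ℝ) ≤ #s := by
  rw [← sum_card_filter_comm s t (fun x z => f x = z)]
  calc _ ≤ ∑ x ∈ s, (1 : ℝ) := by
        refine sum_le_sum fun x _ => ?_
        rw [filter_eq]
        split_ifs <;> simp
    _ = _ := by simp

theorem sq_card_le_card_image_mul {α β : Type*} [DecidableEq β] (s : Finset α) (f : α → β) :
    (#s : ℝ) ^ 2 ≤ #(s.image f) * #{p ∈ s ×ˢ s | f p.1 = f p.2} := by
  have h1 : (#s : ℝ) = ∑ z ∈ s.image f, (#{x ∈ s | f x = z} : ℝ) := by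
    exact_mod_cast card_eq_sum_card_image f s
  have h2 : (#{p ∈ s ×ˢ s | f p.1 = f p.2} : ℝ) = ∑ z ∈ s.image f, (#{x ∈ s | f x = z} : ℝ) ^ 2 := by
    rw [card_eq_sum_card_fiberwise (f := fun p => f p.1) (t := s.image f)]
    · push_cast
      refine sum_congr rfl fun z _ => ?_
      rw [sq, ← Nat.cast_mul, ← card_product]
      congr 2
      ext p
      simp only [mem_filter, mem_product]
      constructor
      · rintro ⟨⟨⟨h1, h2⟩, h3⟩, h4⟩
        exact ⟨⟨h1, h4⟩, h2, h3 ▸ h4⟩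
      · rintro ⟨⟨h1, h4⟩, h2, h3⟩
        exact ⟨⟨⟨h1, h2⟩, h4.trans h3.symm⟩, h4⟩
    · intro p hp
      simp only [coe_filter, mem_product, Set.mem_ofPred_eq] at hp
      exact mem_coe.2 (mem_image_of_mem f hp.1.1)
  rw [h2]
  nth_rewrite 1 [h1]
  exact sq_sum_le_card_mul_sum_sq

/-- **Balog–Szemerédi–Gowers**: if many sums `x + μ * y` lie in a small set, then `X` and `Y` have
large subsets with a small sumset. -/
theorem exists_large_subsets_card_add_smul_le {F : Type*} [Field F] [DecidableEq F]
    (X Y S : Finset F) {μ : F} (hμ : μ ≠ 0) {n K : ℝ} (hn : 0 < n) (hK : 0 < K)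
    (hX : #X ≤ n) (hY : #Y ≤ n) (hS : #S ≤ n)
    (hE : n ^ 2 ≤ K * #{p ∈ X ×ˢ Y | p.1 + μ * p.2 ∈ S}) :
    ∃ X' ⊆ X, ∃ Y' ⊆ Y, n ≤ 6 * K * #X' ∧ n ≤ 4 * K * #Y' ∧
      #(X' + μ • Y') ≤ 3072 * K ^ 5 * n := by
  obtain ⟨X', hX', Y', hY', h1, h2, h3⟩ := exists_large_subsets_many_paths X Y
    (fun x y => x + μ * y ∈ S) hn hK hX hY (by convert hE)
  refine ⟨X', hX', Y', hY', h1, h2, ?_⟩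
  have h4 : ∀ z ∈ X' + μ • Y', n ^ 2 / (3072 * K ^ 5) ≤
      (#{s ∈ S ×ˢ S ×ˢ S | s.1 - s.2.1 + s.2.2 = z} : ℝ) := by
    intro z hz
    obtain ⟨x, hx, w, hw, rfl⟩ := mem_add.1 hz
    obtain ⟨y, hy, rfl⟩ := mem_smul_finset.1 hw
    rw [div_le_iff₀' (by positivity)]
    refine (h3 x hx y hy).trans ?_
    gcongr 3072 * K ^ 5 * ?_
    norm_cast
    apply card_le_card_of_injOn (fun p => (x + μ * p.2, p.1 + μ * p.2, p.1 + μ * y))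
    · intro p hp
      simp only [coe_filter, mem_product, Set.mem_ofPred_eq, smul_eq_mul] at hp ⊢
      exact ⟨hp.2, by ring⟩
    · rintro ⟨a, b⟩ _ ⟨c, d⟩ _ h
      simp only [Prod.mk.injEq, add_right_inj, add_left_inj] at h
      rw [h.2.2, mul_left_cancel₀ hμ h.1]
  have h5 : #(X' + μ • Y') * (n ^ 2 / (3072 * K ^ 5)) ≤ n ^ 3 := by
    rw [← nsmul_eq_mul, ← sum_const]
    refine (sum_le_sum h4).trans ((sum_card_fiber_le _ _ _).trans ?_)
    rw [card_product, card_product]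
    push_cast
    calc (#S : ℝ) * (#S * #S) ≤ n * (n * n) := by gcongr
      _ = n ^ 3 := by ring
  rw [← mul_div_assoc, div_le_iff₀ (by positivity)] at h5
  refine le_of_mul_le_mul_right ?_ (by positivity : 0 < n ^ 2)
  linarith

section Dilates

variable {F : Type*} [Field F] [DecidableEq F]

/-- The difference set of `C` and its dilate by `μ` has at most `M * #C` elements. -/
def DilateBound (C : Finset F) (M : ℝ) (μ : F) : Prop :=
  (#(C - μ • C) : ℝ) ≤ M * #C

variable {C : Finset F} {M : ℝ} {μ ν : F}

theorem DilateBound.mono {M' : ℝ} (h : DilateBound C M μ) (hM : M ≤ M') : DilateBound C M' μ :=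
  h.trans (by gcongr)

theorem card_nsmul_sub_nsmul_le (hC : C.Nonempty) (hμ : DilateBound C M μ)
    (hν : DilateBound C M ν) (h1 : DilateBound C M 1) (i j : ℕ) :
    (#(i • (C ∪ μ • C ∪ ν • C) - j • (C ∪ μ • C ∪ ν • C)) : ℝ) ≤ (3 * M) ^ (i + j) * #C := by
  have h := pluennecke_ruzsa_inequality_nsmul_sub_nsmul_sub hC (C ∪ μ • C ∪ ν • C) i j
  have h' : (#(i • (C ∪ μ • C ∪ ν • C) - j • (C ∪ μ • C ∪ ν • C)) : ℝ) ≤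
      (#(C - (C ∪ μ • C ∪ ν • C)) / #C : ℝ) ^ (i + j) * #C := by
    have := (NNRat.cast_le (K := ℝ)).2 h
    push_cast at this
    exact this
  refine h'.trans ?_
  have hC' : (0 : ℝ) < #C := by exact_mod_cast hC.card_pos
  gcongr
  rw [div_le_iff₀ hC', sub_union, sub_union]
  have h2 : #((C - C) ∪ (C - μ • C) ∪ (C - ν • C)) ≤
      #(C - C) + #(C - μ • C) + #(C - ν • C) :=
    (card_union_le _ _).trans (by gcongr; exact card_union_le _ _)
  have h2' : (#((C - C) ∪ (C - μ • C) ∪ (C - ν • C)) : ℝ) ≤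
      #(C - C) + #(C - μ • C) + #(C - ν • C) := by exact_mod_cast h2
  unfold DilateBound at hμ hν h1
  rw [one_smul] at h1
  linarith

theorem DilateBound.add (hC : C.Nonempty) (hμ : DilateBound C M μ)
    (hν : DilateBound C M ν) (h1 : DilateBound C M 1) :
    DilateBound C (27 * M ^ 3) (μ + ν) := by
  have h := card_nsmul_sub_nsmul_le hC hμ hν h1 1 2
  have h2 : (3 * M) ^ (1 + 2) = 27 * M ^ 3 := by ring
  rw [h2] at h
  refine le_trans ?_ h
  norm_cast
  apply card_le_card
  rw [one_nsmul, two_nsmul]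
  apply sub_subset_sub
  · exact subset_union_left.trans subset_union_left
  · intro z hz
    obtain ⟨b, hb, rfl⟩ := mem_smul_finset.1 hz
    rw [add_smul]
    exact add_mem_add
      (mem_union_left _ (mem_union_right _ (smul_mem_smul_finset hb)))
      (mem_union_right _ (smul_mem_smul_finset hb))

theorem DilateBound.sub (hC : C.Nonempty) (hμ : DilateBound C M μ)
    (hν : DilateBound C M ν) (h1 : DilateBound C M 1) :
    DilateBound C (27 * M ^ 3) (μ - ν) := by
  have h := card_nsmul_sub_nsmul_le hC hμ hν h1 2 1
  have h2 : (3 * M) ^ (2 + 1) = 27 * M ^ 3 := by ring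
  rw [h2] at h
  refine le_trans ?_ h
  norm_cast
  apply card_le_card
  rw [one_nsmul, two_nsmul]
  intro z hz
  obtain ⟨a, ha, w, hw, rfl⟩ := mem_sub.1 hz
  obtain ⟨b, hb, rfl⟩ := mem_smul_finset.1 hw
  have e : a - (μ - ν) • b = a + ν • b - μ • b := by rw [sub_smul]; abel
  rw [e]
  exact sub_mem_sub (add_mem_add (mem_union_left _ (mem_union_left _ ha))
    (mem_union_right _ (smul_mem_smul_finset hb)))
    (mem_union_left _ (mem_union_right _ (smul_mem_smul_finset hb)))

theorem card_smul_finset_field (hμ : μ ≠ 0) (s : Finset F) : #(μ • s) = #s :=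
  card_image_of_injective _ (mul_right_injective₀ hμ)

theorem smul_finset_sub_field (s t : Finset F) : μ • (s - t) = μ • s - μ • t := by
  ext z
  simp only [mem_smul_finset, mem_sub]
  constructor
  · rintro ⟨_, ⟨a, ha, b, hb, rfl⟩, rfl⟩
    exact ⟨_, ⟨a, ha, rfl⟩, _, ⟨b, hb, rfl⟩, (smul_sub _ _ _).symm⟩
  · rintro ⟨_, ⟨a, ha, rfl⟩, _, ⟨b, hb, rfl⟩, rfl⟩
    exact ⟨_, ⟨a, ha, b, hb, rfl⟩, smul_sub _ _ _⟩

theorem DilateBound.mul (hM : 1 ≤ M) (hμ : DilateBound C M μ) (hν : DilateBound C M ν) :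
    DilateBound C (M ^ 2) (μ * ν) := by
  unfold DilateBound at *
  rcases C.eq_empty_or_nonempty with rfl | hC
  · simp
  have hC' : (0 : ℝ) < #C := by exact_mod_cast hC.card_pos
  rcases eq_or_ne μ 0 with rfl | hμ0
  · rw [zero_mul]
    rw [zero_smul_finset hC] at hμ ⊢
    refine hμ.trans ?_
    gcongr
    nlinarith
  have h : #(C - (μ * ν) • C) * #C ≤ #(C - μ • C) * #(C - ν • C) := by
    have h := ruzsa_triangle_inequality_sub_sub_sub C (μ • C) ((μ * ν) • C)
    rwa [← neg_sub (μ • C) ((μ * ν) • C), card_neg, mul_smul, ← smul_finset_sub_field,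
      card_smul_finset_field hμ0, card_smul_finset_field hμ0, ← mul_smul] at h
  have h' : (#(C - (μ * ν) • C) : ℝ) * #C ≤ #(C - μ • C) * #(C - ν • C) := by exact_mod_cast h
  refine le_of_mul_le_mul_right (h'.trans ?_) hC'
  calc (#(C - μ • C) : ℝ) * #(C - ν • C) ≤ (M * #C) * (M * #C) := by gcongr
    _ = _ := by ring

/-- Summed over a set of dilates, the number of coincidences between dilated differences is small,
since a dilate is determined by a nontrivial coincidence. -/
theorem sum_card_coincidences_le (X C : Finset F) :
    ∑ μ ∈ X, (#{p ∈ (C ×ˢ C) ×ˢ (C ×ˢ C) |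
      p.1.1 - μ * p.1.2 = p.2.1 - μ * p.2.2} : ℝ) ≤ #X * #C ^ 2 + #C ^ 4 := by
  rw [sum_card_filter_comm X _
    (fun μ (p : (F × F) × F × F) => p.1.1 - μ * p.1.2 = p.2.1 - μ * p.2.2)]
  have h : ∀ p ∈ (C ×ˢ C) ×ˢ (C ×ˢ C), (#{μ ∈ X | p.1.1 - μ * p.1.2 = p.2.1 - μ * p.2.2} : ℝ) ≤
      #X * (if p.1 = p.2 then 1 else 0) + 1 := by
    rintro ⟨⟨a, b⟩, c, d⟩ _
    by_cases hbd : b = d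
    · subst hbd
      by_cases hac : a = c
      · subst hac
        simp
      · simp [hac]
    · have : #{μ ∈ X | a - μ * b = c - μ * d} ≤ 1 := by
        rw [card_le_one]
        intro μ hμ ν hν
        have hμ := (mem_filter.1 hμ).2
        have hν := (mem_filter.1 hν).2
        have : (μ - ν) * (b - d) = 0 := by linear_combination hν - hμ
        rcases mul_eq_zero.1 this with h | h
        · exact sub_eq_zero.1 h
        · exact absurd (sub_eq_zero.1 h) hbd
      have : (#{μ ∈ X | a - μ * b = c - μ * d} : ℝ) ≤ 1 := by exact_mod_cast this
      refine this.trans ?_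
      have : (0 : ℝ) ≤ #X * (if (a, b) = (c, d) then 1 else 0) := by positivity
      simpa using this
  refine (sum_le_sum h).trans ?_
  rw [sum_add_distrib, ← mul_sum, sum_boole, sum_const, card_product, card_product]
  have h2 : (#{p ∈ (C ×ˢ C) ×ˢ (C ×ˢ C) | p.1 = p.2} : ℝ) ≤ #C ^ 2 := by
    have : #{p ∈ (C ×ˢ C) ×ˢ (C ×ˢ C) | p.1 = p.2} ≤ #(C ×ˢ C) := by
      apply card_le_card_of_injOn (fun p => p.1)
      · intro p hp
        simp only [coe_filter, mem_product, Set.mem_ofPred_eq] at hp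
        simpa using hp.1.1
      · rintro ⟨p, p'⟩ hp ⟨r, r'⟩ hr h
        simp only [coe_filter, Set.mem_ofPred_eq] at hp hr h
        rw [← hp.2, ← hr.2, h]
    rw [card_product, ← sq] at this
    exact_mod_cast this
  have h3 : (#X : ℝ) * #{p ∈ (C ×ˢ C) ×ˢ (C ×ˢ C) | p.1 = p.2} ≤ #X * #C ^ 2 := by gcongr
  rw [nsmul_eq_mul]
  push_cast
  linarith [show (#C : ℝ) ^ 4 = #C * #C * (#C * #C) * 1 by ring]

theorem card_sub_smul_eq_card_image (C : Finset F) (μ : F) :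
    #(C - μ • C) = #((C ×ˢ C).image fun p => p.1 - μ * p.2) := by
  congr 1
  ext z
  simp only [mem_sub, mem_smul_finset, mem_image, mem_product, Prod.exists, smul_eq_mul]
  constructor
  · rintro ⟨a, ha, _, ⟨b, hb, rfl⟩, rfl⟩
    exact ⟨a, b, ⟨ha, hb⟩, rfl⟩
  · rintro ⟨a, b, ⟨ha, hb⟩, rfl⟩
    exact ⟨a, ha, _, ⟨b, hb, rfl⟩, rfl⟩

/-- There are few dilates with a small difference set. -/
theorem card_le_of_dilateBound {X : Finset F} (hM : 0 < M) (hX : ∀ μ ∈ X, DilateBound C M μ)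
    (hC : 2 * M ≤ #C) : (#X : ℝ) ≤ 2 * M * #C := by
  have hC' : (0 : ℝ) < #C := by linarith
  have h1 : ∀ μ ∈ X, (#C : ℝ) ^ 3 / M ≤ (#{p ∈ (C ×ˢ C) ×ˢ (C ×ˢ C) |
      p.1.1 - μ * p.1.2 = p.2.1 - μ * p.2.2} : ℝ) := by
    intro μ hμ
    have h := sq_card_le_card_image_mul (C ×ˢ C) (fun p => p.1 - μ * p.2)
    rw [← card_sub_smul_eq_card_image, card_product] at h
    push_cast at h
    set E : ℝ := (#{p ∈ (C ×ˢ C) ×ˢ (C ×ˢ C) |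
      p.1.1 - μ * p.1.2 = p.2.1 - μ * p.2.2} : ℝ)
    have h2 : (#(C - μ • C) : ℝ) * E ≤ M * #C * E := by
      gcongr
      exact hX μ hμ
    rw [div_le_iff₀ hM]
    refine le_of_mul_le_mul_right ?_ hC'
    linarith
  have h2 := (sum_le_sum h1).trans (sum_card_coincidences_le X C)
  rw [sum_const, nsmul_eq_mul] at h2
  have h3 : (#X : ℝ) * #C ^ 2 ≤ #X * (#C ^ 3 / (2 * M)) := by
    gcongr
    rw [le_div_iff₀ (by positivity)]
    calc (#C : ℝ) ^ 2 * (2 * M) ≤ #C ^ 2 * #C := by gcongr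
      _ = _ := by ring
  have h4 : (#C : ℝ) ^ 3 / M = #C ^ 3 / (2 * M) + #C ^ 3 / (2 * M) := by field_simp; norm_num
  rw [h4] at h2
  have h5 : (#X : ℝ) * (#C ^ 3 / (2 * M)) ≤ #C ^ 4 := by linarith
  rw [← mul_div_assoc, div_le_iff₀ (by positivity)] at h5
  refine le_of_mul_le_mul_right ?_ (by positivity : (0 : ℝ) < #C ^ 3)
  linarith

end Dilates

/-- A pivot for `Λ`: some ratio built from differences of `Λ` takes almost as many values as
possible. This is where primality of the field enters. -/
theorem exists_pivot {q : ℕ} [Fact q.Prime] (Λ : Finset (ZMod q)) (hΛ : 2 ≤ #Λ) :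
    ∃ a ∈ Λ, ∃ b ∈ Λ, ∃ c ∈ Λ, ∃ d ∈ Λ, ∃ x, (x = a - b ∨ x = a - b + (c - d)) ∧
      min ((#Λ : ℝ) ^ 2) q ≤ 2 * #((Λ ×ˢ Λ).image fun p => (c - d) * p.1 - x * p.2) := by
  obtain ⟨c₀, hc₀, d₀, hd₀, hcd₀⟩ := one_lt_card.1 hΛ
  have hq : (0 : ℝ) < q := by exact_mod_cast (Fact.out : q.Prime).pos
  have hs : (0 : ℝ) < #Λ := by exact_mod_cast (by omega : 0 < #Λ)
  by_cases hR : ∀ r : ZMod q, ∃ a ∈ Λ, ∃ b ∈ Λ, ∃ c ∈ Λ, ∃ d ∈ Λ, c ≠ d ∧ r * (c - d) = a - b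
  · have h := sum_card_coincidences_le univ Λ
    rw [card_univ, ZMod.card] at h
    obtain ⟨r, -, hr⟩ : ∃ r ∈ (univ : Finset (ZMod q)), (#{p ∈ (Λ ×ˢ Λ) ×ˢ (Λ ×ˢ Λ) |
        p.1.1 - r * p.1.2 = p.2.1 - r * p.2.2} : ℝ) ≤ #Λ ^ 2 + #Λ ^ 4 / q := by
      apply exists_le_of_sum_le univ_nonempty
      refine h.trans_eq ?_
      rw [sum_const, card_univ, ZMod.card, nsmul_eq_mul]
      field_simp
    obtain ⟨a, ha, b, hb, c, hc, d, hd, hcd, hrr⟩ := hR r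
    refine ⟨a, ha, b, hb, c, hc, d, hd, a - b, Or.inl rfl, ?_⟩
    have hcd' := sub_ne_zero.2 hcd
    have himg : #((Λ ×ˢ Λ).image fun p => (c - d) * p.1 - (a - b) * p.2) =
        #((Λ ×ˢ Λ).image fun p => p.1 - r * p.2) := by
      rw [← card_smul_finset_field hcd' ((Λ ×ˢ Λ).image fun p => p.1 - r * p.2),
        smul_finset_def, image_image]
      congr 2
      ext p
      simp only [Function.comp, smul_eq_mul]
      rw [← hrr]
      ring
    rw [himg]
    have h2 := sq_card_le_card_image_mul (Λ ×ˢ Λ) (fun p => p.1 - r * p.2)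
    set I : ℝ := (#((Λ ×ˢ Λ).image fun p => p.1 - r * p.2) : ℝ)
    have h3 : ((#(Λ ×ˢ Λ) : ℝ)) ^ 2 ≤ I * (#Λ ^ 2 + #Λ ^ 4 / q) :=
      h2.trans (by gcongr)
    rw [card_product] at h3
    push_cast at h3
    have h4 : (#Λ : ℝ) ^ 2 * q ≤ I * (q + #Λ ^ 2) := by
      refine le_of_mul_le_mul_right ?_ (by positivity : (0 : ℝ) < #Λ ^ 2 / q)
      calc (#Λ : ℝ) ^ 2 * q * (#Λ ^ 2 / q) = (#Λ * #Λ) ^ 2 := by field_simp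
        _ ≤ _ := h3
        _ = _ := by field_simp
    have hI : 0 ≤ I := by positivity
    rcases le_total ((#Λ : ℝ) ^ 2) q with h5 | h5
    · rw [min_eq_left h5]
      refine le_of_mul_le_mul_right (h4.trans ?_) hq
      nlinarith
    · rw [min_eq_right h5]
      refine le_of_mul_le_mul_left (h4.trans ?_) (by positivity : (0 : ℝ) < #Λ ^ 2)
      nlinarith
  · obtain ⟨r, ⟨a, ha, b, hb, c, hc, d, hd, hcd, hr⟩, hr1⟩ : ∃ r : ZMod q,
        (∃ a ∈ Λ, ∃ b ∈ Λ, ∃ c ∈ Λ, ∃ d ∈ Λ, c ≠ d ∧ r * (c - d) = a - b) ∧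
        ¬ (∃ a ∈ Λ, ∃ b ∈ Λ, ∃ c ∈ Λ, ∃ d ∈ Λ, c ≠ d ∧ (r + 1) * (c - d) = a - b) := by
      by_contra! hcon
      apply hR
      intro r
      rw [← ZMod.natCast_zmod_val r]
      induction r.val with
      | zero => exact ⟨c₀, hc₀, c₀, hc₀, c₀, hc₀, d₀, hd₀, hcd₀, by simp⟩
      | succ k ih =>
        push_cast
        exact hcon _ ih
    refine ⟨a, ha, b, hb, c, hc, d, hd, a - b + (c - d), Or.inr rfl, ?_⟩
    have hcd' := sub_ne_zero.2 hcd
    rw [card_image_of_injOn, card_product]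
    · refine (min_le_left _ _).trans ?_
      push_cast
      nlinarith
    · rintro ⟨x, y⟩ hxy ⟨z, w⟩ hzw h
      simp only [coe_product, Set.mem_prod, mem_coe] at hxy hzw h
      have h' : (r + 1) * (y - w) = x - z := by
        apply mul_left_cancel₀ hcd'
        linear_combination -h + (y - w) * hr
      by_cases hyw : y = w
      · subst hyw
        rw [sub_self, mul_zero] at h'
        rw [sub_eq_zero.1 h'.symm]
      · exact absurd ⟨x, hxy.1, z, hzw.1, y, hxy.2, w, hzw.2, hyw, h'⟩ hr1

/-- A sum-product estimate: a set of dilates of bounded growth on `C` cannot be much larger than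
the square root of `#C`, unless it fills the field. -/
theorem min_le_of_dilateBound {q : ℕ} [Fact q.Prime] {C Λ : Finset (ZMod q)} {M : ℝ}
    (hM : 27 ≤ M) (h1 : DilateBound C M 1) (hΛ : ∀ μ ∈ Λ, DilateBound C M μ) (hΛ2 : 2 ≤ #Λ)
    (hC : 2 * M ^ 79 ≤ #C) : min ((#Λ : ℝ) ^ 2) q ≤ 4 * M ^ 79 * #C := by
  obtain ⟨a, ha, b, hb, c, hc, d, hd, x, hx, h⟩ := exists_pivot Λ hΛ2
  have hM1 : 1 ≤ M := by linarith
  have hCne : C.Nonempty := by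
    rw [← card_pos]
    have : (0 : ℝ) < #C := lt_of_lt_of_le (by positivity) hC
    exact_mod_cast this
  have cube : ∀ k : ℕ, 27 * (M ^ k) ^ 3 ≤ M ^ (3 * k + 1) := by
    intro k
    rw [← pow_mul, mul_comm k 3, pow_succ, mul_comm]
    gcongr
  have up : ∀ {k : ℕ} {μ : ZMod q}, DilateBound C M μ → DilateBound C (M ^ (k + 1)) μ :=
    fun h => h.mono (le_self_pow₀ hM1 (Nat.succ_ne_zero _))
  have hsub : ∀ μ ∈ Λ, ∀ ν ∈ Λ, DilateBound C (M ^ 4) (μ - ν) := fun μ hμ ν hν =>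
    (DilateBound.sub hCne (hΛ μ hμ) (hΛ ν hν) h1).mono (by simpa using cube 1)
  have hx' : DilateBound C (M ^ 13) x := by
    rcases hx with rfl | rfl
    · exact (hsub a ha b hb).mono (pow_le_pow_right₀ hM1 (by norm_num))
    · exact (DilateBound.add hCne (hsub a ha b hb) (hsub c hc d hd) (up h1)).mono (cube 4)
  have hmul : ∀ {y μ : ZMod q}, DilateBound C (M ^ 13) y → μ ∈ Λ →
      DilateBound C (M ^ 26) (y * μ) := fun hy hμ =>
    (DilateBound.mul (one_le_pow₀ hM1) hy (up (hΛ _ hμ))).mono (by rw [← pow_mul])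
  have hX : ∀ μ ∈ (Λ ×ˢ Λ).image fun p => (c - d) * p.1 - x * p.2,
      DilateBound C (M ^ 79) μ := by
    intro μ hμ
    obtain ⟨p, hp, rfl⟩ := mem_image.1 hμ
    have hp := mem_product.1 hp
    exact (DilateBound.sub hCne
      (hmul ((hsub c hc d hd).mono (pow_le_pow_right₀ hM1 (by norm_num))) hp.1)
      (hmul hx' hp.2) (up h1)).mono (cube 26)
  have := card_le_of_dilateBound (by positivity) hX hC
  linarith

/-- Some member of a family of large subsets of `T` has large average intersection with the
family. -/
theorem exists_sum_card_inter_ge {ι α : Type*} [DecidableEq α] {I : Finset ι} (hI : I.Nonempty)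
    (T : Finset α) (R : ι → Finset α) (hR : ∀ i ∈ I, R i ⊆ T) {θ : ℝ} (hθ : 0 ≤ θ)
    (hRθ : ∀ i ∈ I, θ ≤ #(R i)) :
    ∃ i₀ ∈ I, #I * θ ^ 2 ≤ #T * ∑ i ∈ I, (#(R i ∩ R i₀) : ℝ) := by
  have h1 : ∑ i ∈ I, (#(R i) : ℝ) = ∑ t ∈ T, (#{i ∈ I | t ∈ R i} : ℝ) := by
    rw [← sum_card_filter_comm I T (fun i t => t ∈ R i)]
    refine sum_congr rfl fun i hi => ?_
    rw [filter_mem_eq_inter, inter_eq_right.2 (hR i hi)]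
  have h2 : ∑ i₀ ∈ I, ∑ i ∈ I, (#(R i ∩ R i₀) : ℝ) = ∑ t ∈ T, (#{i ∈ I | t ∈ R i} : ℝ) ^ 2 := by
    rw [← sum_product' (f := fun i₀ i => (#(R i ∩ R i₀) : ℝ))]
    have h3 : ∀ p ∈ I ×ˢ I, (#(R p.2 ∩ R p.1) : ℝ) = #{t ∈ T | t ∈ R p.1 ∧ t ∈ R p.2} := by
      intro p hp
      congr 2
      ext t
      simp only [mem_inter, mem_filter]
      constructor
      · rintro ⟨h, h'⟩
        exact ⟨hR _ (mem_product.1 hp).1 h', h', h⟩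
      · rintro ⟨_, h', h⟩
        exact ⟨h, h'⟩
    rw [sum_congr rfl h3, sum_card_filter_comm (I ×ˢ I) T (fun p t => t ∈ R p.1 ∧ t ∈ R p.2)]
    refine sum_congr rfl fun t _ => ?_
    rw [filter_product (fun i => t ∈ R i) (fun i => t ∈ R i), card_product, Nat.cast_mul, sq]
  have h4 : #I * θ ≤ ∑ i ∈ I, (#(R i) : ℝ) := by
    rw [← nsmul_eq_mul, ← sum_const]
    exact sum_le_sum hRθ
  have h5 : (#I * θ) ^ 2 ≤ #T * ∑ i₀ ∈ I, ∑ i ∈ I, (#(R i ∩ R i₀) : ℝ) := by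
    rw [h2]
    refine (pow_le_pow_left₀ (by positivity) h4 2).trans ?_
    rw [h1]
    exact sq_sum_le_card_mul_sum_sq
  apply exists_le_of_sum_le hI
  rw [sum_const, nsmul_eq_mul, ← mul_sum]
  linarith

/-- Ruzsa-type transfer: if `X₀ + ν • C` is small, and so is `X' + μ • Y'` for large subsets
`X'` of `X₀` and `Y'` of `C`, then `μ • C - ν • C` is small. -/
theorem card_smul_sub_smul_le {F : Type*} [Field F] [DecidableEq F] {X₀ C X' Y' : Finset F}
    (hX : X' ⊆ X₀) (hY : Y' ⊆ C) {μ ν : F} (hμ : μ ≠ 0) (hν : ν ≠ 0) {n a b : ℝ} (hn : 0 < n)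
    (ha : 0 ≤ a) (hb : 0 ≤ b) (h1 : #(X₀ + ν • C) ≤ a * n) (h2 : #(X' + μ • Y') ≤ a * n)
    (hX' : n ≤ b * #X') (hY' : n ≤ b * #Y') :
    #(C - C) ≤ a ^ 2 * b * n ∧ #(μ • C - ν • C) ≤ a ^ 4 * b ^ 3 * n := by
  have h3 : (#(X' + ν • C) : ℝ) ≤ a * n := by
    refine le_trans ?_ h1
    exact_mod_cast card_le_card (add_subset_add_right hX)
  have tri : ∀ {U V W : Finset F} {u v : ℝ}, 0 ≤ u → (#U * #V : ℝ) ≤ u * v → n ≤ b * #V →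
      (#U : ℝ) ≤ b * (u * v) / n := by
    intro U V W u v hu h hV
    rw [le_div_iff₀ hn]
    calc (#U : ℝ) * n ≤ #U * (b * #V) := by gcongr
      _ = b * (#U * #V) := by ring
      _ ≤ b * (u * v) := by gcongr
  have key : ∀ {U V : Finset F}, (#(X' + U) : ℝ) ≤ a * n → (#(X' + V) : ℝ) ≤ a * n →
      (#(U - V) : ℝ) ≤ a ^ 2 * b * n := by
    intro U V hU hV
    have h := ruzsa_triangle_inequality_sub_add_add U X' V
    rw [add_comm U, add_comm V] at h
    have h' : (#(U - V) : ℝ) * #X' ≤ #(X' + U) * #(X' + V) := by exact_mod_cast h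
    have h'' : (#(U - V) : ℝ) * #X' ≤ (a * n) * (a * n) := h'.trans (by gcongr)
    refine le_of_mul_le_mul_right ?_ hn
    calc (#(U - V) : ℝ) * n ≤ #(U - V) * (b * #X') := by gcongr
      _ = b * (#(U - V) * #X') := by ring
      _ ≤ b * ((a * n) * (a * n)) := by gcongr
      _ = _ := by ring
  have hCC : (#(C - C) : ℝ) ≤ a ^ 2 * b * n := by
    have := key h3 h3
    rwa [← smul_finset_sub_field, card_smul_finset_field hν] at this
  refine ⟨hCC, ?_⟩
  have h4 := key h2 h3
  have h := ruzsa_triangle_inequality_sub_sub_sub (μ • C) (μ • Y') (ν • C)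
  rw [← smul_finset_sub_field, card_smul_finset_field hμ, card_smul_finset_field hμ,
    ← neg_sub (μ • Y'), card_neg] at h
  have h' : (#(μ • C - ν • C) : ℝ) * #Y' ≤ #(C - Y') * #(μ • Y' - ν • C) := by exact_mod_cast h
  have h5 : (#(C - Y') : ℝ) ≤ a ^ 2 * b * n := by
    refine le_trans ?_ hCC
    exact_mod_cast card_le_card (sub_subset_sub_left hY)
  refine le_of_mul_le_mul_right ?_ hn
  calc (#(μ • C - ν • C) : ℝ) * n ≤ #(μ • C - ν • C) * (b * #Y') := by gcongr
    _ = b * (#(μ • C - ν • C) * #Y') := by ring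
    _ ≤ b * ((a ^ 2 * b * n) * (a ^ 2 * b * n)) := by
        exact mul_le_mul_of_nonneg_left
          (h'.trans (mul_le_mul h5 h4 (by positivity) (by positivity))) hb
    _ = _ := by ring

set_option maxHeartbeats 1000000 in
/-- A common refinement of the Balog–Szemerédi–Gowers theorem for a family of dilates: after
rescaling, a large subfamily has bounded growth on a single large set. -/
theorem exists_dilateBound_of_many_sums {F : Type*} [Field F] [DecidableEq F] {B Λ : Finset F}
    {n K : ℝ} (hn : 0 < n) (hK : 3072 ≤ K) (hB : #B ≤ n) (hΛ : n ≤ K * #Λ) (h0 : 0 ∉ Λ)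
    (hS : ∀ μ ∈ Λ, ∃ S : Finset F, (#S : ℝ) ≤ n ∧
      n ^ 2 ≤ K * #{p ∈ B ×ˢ B | p.1 + μ * p.2 ∈ S}) :
    ∃ C Λ' : Finset F, #C ≤ n ∧ n ≤ K ^ 2 * #C ∧ n ≤ K ^ 10 * #Λ' ∧ DilateBound C (K ^ 53) 1 ∧
      ∀ μ ∈ Λ', DilateBound C (K ^ 53) μ := by
  have hK0 : 0 < K := by linarith
  have hK1 : 1 ≤ K := by linarith
  have e₁ : ∀ c : ℝ, c * (n ^ 2 / K ^ 4) ^ 2 = n ^ 2 * (c * (n ^ 2 / K ^ 8)) := by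
    intro c
    field_simp
  have e₂ : n ^ 2 / K ^ 8 = n ^ 2 / (2 * K ^ 8) + n ^ 2 / (2 * K ^ 8) := by field_simp; norm_num
  have e₃ : ∀ {a b : ℝ}, 0 ≤ a → b ≤ n → n * n ≤ K ^ 9 * (a * b) → n ≤ K ^ 9 * a := by
    intro a b ha hb h
    refine le_of_mul_le_mul_right (h.trans ?_) hn
    rw [mul_assoc]
    gcongr
  have hne : ∀ μ ∈ Λ, μ ≠ 0 := fun μ hμ h => h0 (h ▸ hμ)
  have hXY : ∀ μ ∈ Λ, ∃ X Y : Finset F, X ⊆ B ∧ Y ⊆ B ∧ n ≤ K ^ 2 * #X ∧ n ≤ K ^ 2 * #Y ∧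
      #(X + μ • Y) ≤ K ^ 6 * n := by
    intro μ hμ
    obtain ⟨S, hS1, hS2⟩ := hS μ hμ
    obtain ⟨X, hX, Y, hY, h1, h2, h3⟩ :=
      exists_large_subsets_card_add_smul_le B B S (hne μ hμ) hn hK0 hB hB hS1 hS2
    refine ⟨X, Y, hX, hY, h1.trans ?_, h2.trans ?_, h3.trans ?_⟩
    · gcongr; nlinarith
    · gcongr; nlinarith
    · gcongr; nlinarith [pow_pos hK0 5]
  choose! X Y hX hY hXn hYn hXYn using hXY
  have hΛne : Λ.Nonempty := by
    rw [nonempty_iff_ne_empty]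
    rintro rfl
    simp at hΛ
    linarith
  have hBB : (#(B ×ˢ B) : ℝ) ≤ n ^ 2 := by
    rw [card_product, sq]
    push_cast
    gcongr
  obtain ⟨ν, hν, hνsum⟩ := exists_sum_card_inter_ge hΛne (B ×ˢ B) (fun μ => X μ ×ˢ Y μ)
    (fun μ hμ => product_subset_product (hX μ hμ) (hY μ hμ)) (θ := n ^ 2 / K ^ 4) (by positivity)
    (by
      intro μ hμ
      rw [div_le_iff₀ (by positivity), card_product]
      push_cast
      calc n ^ 2 = n * n := sq n
        _ ≤ (K ^ 2 * #(X μ)) * (K ^ 2 * #(Y μ)) := by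
            gcongr
            · exact hXn μ hμ
            · exact hYn μ hμ
        _ = _ := by ring)
  simp only [product_inter_product, card_product, Nat.cast_mul] at hνsum
  set f : F → ℝ := fun μ => (#(X μ ∩ X ν) : ℝ) * #(Y μ ∩ Y ν) with hf
  have hcX : ∀ μ ∈ Λ, (#(X μ ∩ X ν) : ℝ) ≤ n := fun μ hμ =>
    le_trans (by exact_mod_cast card_le_card (inter_subset_left.trans (hX μ hμ))) hB
  have hcY : ∀ μ ∈ Λ, (#(Y μ ∩ Y ν) : ℝ) ≤ n := fun μ hμ =>
    le_trans (by exact_mod_cast card_le_card (inter_subset_left.trans (hY μ hμ))) hB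
  have hfM : ∀ μ ∈ Λ, f μ ≤ n ^ 2 := by
    intro μ hμ
    rw [sq]
    exact mul_le_mul (hcX μ hμ) (hcY μ hμ) (by positivity) hn.le
  have hpop := sum_le_card_filter_mul_add Λ f (θ := n ^ 2 / (2 * K ^ 8)) (by positivity) hfM
  set Λ₁ := {μ ∈ Λ | n ^ 2 / (2 * K ^ 8) ≤ f μ} with hΛ₁
  have hΛ₁n : n ≤ K ^ 10 * #Λ₁ := by
    have h1 : (#Λ : ℝ) * (n ^ 2 / K ^ 4) ^ 2 ≤ n ^ 2 * ∑ μ ∈ Λ, f μ := by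
      have hsum : 0 ≤ ∑ μ ∈ Λ, f μ := sum_nonneg fun _ _ => by positivity
      have : (#B * #B : ℝ) ≤ n ^ 2 := by
        rw [sq]
        exact mul_le_mul hB hB (Nat.cast_nonneg _) hn.le
      exact hνsum.trans (mul_le_mul_of_nonneg_right this hsum)
    rw [e₁] at h1
    have h3 := le_of_mul_le_mul_left h1 (by positivity)
    rw [e₂] at h3
    have h5 : (#Λ : ℝ) * (n ^ 2 / (2 * K ^ 8)) ≤ #Λ₁ * n ^ 2 := by linarith
    rw [← mul_div_assoc, div_le_iff₀ (by positivity)] at h5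
    have h6 : (#Λ : ℝ) ≤ #Λ₁ * (2 * K ^ 8) := by
      refine le_of_mul_le_mul_right ?_ (by positivity : 0 < n ^ 2)
      linarith
    calc n ≤ K * #Λ := hΛ
      _ ≤ K * (#Λ₁ * (K * K ^ 8)) :=
          mul_le_mul_of_nonneg_left (h6.trans (mul_le_mul_of_nonneg_left
            (mul_le_mul_of_nonneg_right (by linarith) (by positivity)) (Nat.cast_nonneg _))) hK0.le
      _ = _ := by ring
  have hY₀ : (0 : ℝ) < #(Y ν) := by
    by_contra h
    have : (#(Y ν) : ℝ) = 0 := le_antisymm (not_lt.1 h) (by positivity)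
    have h' := hYn ν hν
    rw [this] at h'
    linarith
  have hmain : ∀ μ ∈ Λ₁, #(Y ν - Y ν) ≤ K ^ 51 * n ∧ #(μ • Y ν - ν • Y ν) ≤ K ^ 51 * n := by
    intro μ hμ
    obtain ⟨hμ, hμf⟩ := mem_filter.1 hμ
    rw [div_le_iff₀ (by positivity)] at hμf
    have hμf' : n * n ≤ K ^ 9 * (#(X μ ∩ X ν) * #(Y μ ∩ Y ν)) := by
      calc n * n = n ^ 2 := (sq n).symm
        _ ≤ f μ * (2 * K ^ 8) := hμf
        _ ≤ f μ * (K * K ^ 8) :=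
            mul_le_mul_of_nonneg_left (mul_le_mul_of_nonneg_right (by linarith) (by positivity))
              (mul_nonneg (Nat.cast_nonneg _) (Nat.cast_nonneg _))
        _ = K ^ 9 * f μ := by ring
    have hX1 : n ≤ K ^ 9 * #(X μ ∩ X ν) := e₃ (Nat.cast_nonneg _) (hcY μ hμ) hμf'
    have hY1 : n ≤ K ^ 9 * #(Y μ ∩ Y ν) :=
      e₃ (Nat.cast_nonneg _) (hcX μ hμ) (hμf'.trans_eq (by rw [mul_comm (#(X μ ∩ X ν) : ℝ)]))
    have hsub : X μ ∩ X ν + μ • (Y μ ∩ Y ν) ⊆ X μ + μ • Y μ :=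
      add_subset_add inter_subset_left (smul_finset_subset_smul_finset inter_subset_left)
    have hsum : (#(X μ ∩ X ν + μ • (Y μ ∩ Y ν)) : ℝ) ≤ K ^ 6 * n :=
      (Nat.cast_le.2 (card_le_card hsub)).trans (hXYn μ hμ)
    have h := card_smul_sub_smul_le (inter_subset_right : X μ ∩ X ν ⊆ X ν)
      (inter_subset_right : Y μ ∩ Y ν ⊆ Y ν) (hne μ hμ) (hne ν hν) hn (pow_nonneg hK0.le 6)
      (pow_nonneg hK0.le 9) (hXYn ν hν) hsum hX1 hY1
    refine ⟨h.1.trans ?_, h.2.trans_eq (by rw [← pow_mul, ← pow_mul, ← pow_add])⟩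
    rw [← pow_mul, ← pow_add]
    exact mul_le_mul_of_nonneg_right (pow_le_pow_right₀ hK1 (by norm_num)) hn.le
  have hfin : ∀ {s : Finset F}, (#s : ℝ) ≤ K ^ 51 * n → (#s : ℝ) ≤ K ^ 53 * #(Y ν) := by
    intro s hs
    refine hs.trans ?_
    calc K ^ 51 * n ≤ K ^ 51 * (K ^ 2 * #(Y ν)) :=
          mul_le_mul_of_nonneg_left (hYn ν hν) (by positivity)
      _ = _ := by ring
  obtain ⟨μ₁, hμ₁⟩ : Λ₁.Nonempty := by
    rw [nonempty_iff_ne_empty]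
    intro h
    rw [h] at hΛ₁n
    simp at hΛ₁n
    linarith
  refine ⟨Y ν, ν⁻¹ • Λ₁, le_trans (by exact_mod_cast card_le_card (hY ν hν)) hB, hYn ν hν, ?_,
    ?_, ?_⟩
  · rwa [card_smul_finset_field (inv_ne_zero (hne ν hν))]
  · unfold DilateBound
    rw [one_smul]
    exact hfin (hmain μ₁ hμ₁).1
  · intro μ hμ
    obtain ⟨κ, hκ, rfl⟩ := mem_smul_finset.1 hμ
    have h := hfin (hmain κ hκ).2
    rw [← neg_sub, card_neg, ← card_smul_finset_field (inv_ne_zero (hne ν hν)),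
      smul_finset_sub_field, smul_smul, smul_smul, inv_mul_cancel₀ (hne ν hν), one_smul] at h
    rwa [DilateBound, smul_eq_mul]

theorem le_pow_or_le_of_many_sums {q : ℕ} [Fact q.Prime] {B Λ : Finset (ZMod q)}
    {n K : ℝ} (hn : 0 < n) (hK : 3072 ≤ K) (hB : #B ≤ n) (hΛ : n ≤ K * #Λ) (h0 : 0 ∉ Λ)
    (hS : ∀ μ ∈ Λ, ∃ S : Finset (ZMod q), (#S : ℝ) ≤ n ∧
      n ^ 2 ≤ K * #{p ∈ B ×ˢ B | p.1 + μ * p.2 ∈ S}) :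
    n ≤ K ^ 5000 ∨ (q : ℝ) ≤ K ^ 5000 * n := by
  have hK0 : 0 < K := by linarith
  have hK1 : 1 ≤ K := by linarith
  obtain ⟨C, Λ', hCn, hC, hΛ', h1, hμ⟩ := exists_dilateBound_of_many_sums hn hK hB hΛ h0 hS
  have habs : ∀ {i j : ℕ} {x : ℝ}, i ≤ j → 0 ≤ x → K ^ i * x ≤ K ^ j * x := by
    intro i j x hij hx
    gcongr
  by_cases hΛ2 : 2 ≤ #Λ'
  swap
  · left
    have : (#Λ' : ℝ) ≤ 1 := by exact_mod_cast (by omega : #Λ' ≤ 1)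
    calc n ≤ K ^ 10 * #Λ' := hΛ'
      _ ≤ K ^ 10 * 1 := by gcongr
      _ ≤ K ^ 5000 * 1 := habs (by norm_num) (by norm_num)
      _ = _ := mul_one _
  by_cases hC2 : 2 * (K ^ 53) ^ 79 ≤ (#C : ℝ)
  swap
  · left
    calc n ≤ K ^ 2 * #C := hC
      _ ≤ K ^ 2 * (K * (K ^ 53) ^ 79) := by
          gcongr
          refine (not_le.1 hC2).le.trans ?_
          gcongr
          linarith
      _ = K ^ 4190 * 1 := by rw [← pow_mul, ← pow_succ', ← pow_add, mul_one]
      _ ≤ K ^ 5000 * 1 := habs (by norm_num) (by norm_num)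
      _ = _ := mul_one _
  have hM : 27 ≤ K ^ 53 := le_trans (by linarith) (le_self_pow₀ hK1 (by norm_num))
  have h := min_le_of_dilateBound hM h1 hμ hΛ2 hC2
  have h' : min ((#Λ' : ℝ) ^ 2) q ≤ K ^ 4188 * n := by
    refine h.trans ?_
    calc 4 * (K ^ 53) ^ 79 * #C ≤ K * (K ^ 53) ^ 79 * n := by gcongr; linarith
      _ = _ := by rw [← pow_mul, ← pow_succ']
  rcases min_le_iff.1 h' with h2 | h2
  · left
    refine le_of_mul_le_mul_right ?_ hn
    calc n * n ≤ (K ^ 10 * #Λ') * (K ^ 10 * #Λ') := by gcongr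
      _ = K ^ 20 * #Λ' ^ 2 := by ring
      _ ≤ K ^ 20 * (K ^ 4188 * n) := by gcongr
      _ = K ^ 4208 * n := by rw [← mul_assoc, ← pow_add]
      _ ≤ _ := habs (by norm_num) hn.le
  · right
    exact h2.trans (habs (by norm_num) hn.le)

set_option maxHeartbeats 1000000 in
/-- An incidence bound for lines `y = m * x + b` and a Cartesian product. -/
theorem le_pow_or_le_of_grid_incidences {q : ℕ} [Fact q.Prime] {A B : Finset (ZMod q)}
    {L : Finset (ZMod q × ZMod q)} {n K : ℝ} (hn : 0 < n) (hK : 3072 ≤ K) (hA : #A ≤ n)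
    (hB : #B ≤ n) (hL : #L ≤ n ^ 2)
    (hI : n ^ 3 ≤ K * ∑ l ∈ L, (#{x ∈ A | l.1 * x + l.2 ∈ B} : ℝ)) :
    n ≤ K ^ 20000 ∨ (q : ℝ) ≤ K ^ 20000 * n := by
  have hK0 : 0 < K := by linarith
  have hK1 : 1 ≤ K := by linarith
  have hK4 : 8 * K ^ 3 ≤ K ^ 4 := by
    rw [pow_succ K 3, mul_comm]
    gcongr
    linarith
  have e₁ : n ^ 3 / (2 * K ^ 3) = n ^ 3 / (4 * K ^ 3) + n ^ 3 / (4 * K ^ 3) := by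
    field_simp; norm_num
  have e₂ : n ^ 3 / (4 * K ^ 3) = n * (n ^ 2 / (8 * K ^ 3)) + n / (8 * K ^ 3) * n ^ 2 := by
    field_simp; norm_num
  by_cases hnK : n ≤ 8 * K ^ 3
  · left
    exact (hnK.trans hK4).trans (pow_le_pow_right₀ hK1 (by norm_num))
  rw [not_le] at hnK
  set f : ZMod q × ZMod q → ℝ := fun l => (#{x ∈ A | l.1 * x + l.2 ∈ B} : ℝ) with hf
  have hf0 : ∀ l, 0 ≤ f l := fun l => by positivity
  have hfn : ∀ l, f l ≤ n := fun l =>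
    le_trans (Nat.cast_le.2 (card_le_card (filter_subset _ _))) hA
  have hf3 : n ^ 5 ≤ K ^ 3 * ∑ l ∈ L, f l ^ (2 + 1) := by
    have h1 := pow_sum_div_card_le_sum_pow (s := L) (f := f) (fun l _ => hf0 l) 2
    have hsum : 0 ≤ ∑ l ∈ L, f l ^ (2 + 1) := sum_nonneg fun l _ => pow_nonneg (hf0 l) _
    have hLpos : (0 : ℝ) < #L := by
      rw [Nat.cast_pos, card_pos, nonempty_iff_ne_empty]
      rintro rfl
      rw [sum_empty, mul_zero] at hI
      have : 0 < n ^ 3 := by positivity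
      linarith
    rw [div_le_iff₀ (by positivity)] at h1
    refine le_of_mul_le_mul_right ?_ (by positivity : 0 < n ^ 4)
    change n ^ 3 ≤ K * ∑ l ∈ L, f l at hI
    generalize ∑ l ∈ L, f l = S₁ at *
    generalize ∑ l ∈ L, f l ^ (2 + 1) = S₃ at *
    calc n ^ 5 * n ^ 4 = (n ^ 3) ^ 3 := by ring
      _ ≤ (K * S₁) ^ 3 := by gcongr
      _ = K ^ 3 * S₁ ^ (2 + 1) := by ring
      _ ≤ K ^ 3 * (S₃ * #L ^ 2) := by gcongr
      _ ≤ K ^ 3 * (S₃ * (n ^ 2) ^ 2) := by gcongr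
      _ = _ := by ring
  -- weight of a pair of abscissae
  set w : ZMod q × ZMod q → ℝ := fun p =>
    ∑ l ∈ L with l.1 * p.1 + l.2 ∈ B ∧ l.1 * p.2 + l.2 ∈ B, f l with hw
  have hw1 : ∑ p ∈ A ×ˢ A, w p = ∑ l ∈ L, f l ^ (2 + 1) := by
    simp only [hw, sum_filter]
    rw [sum_comm]
    refine sum_congr rfl fun l _ => ?_
    rw [← sum_filter, sum_const, nsmul_eq_mul,
      filter_product (fun x => l.1 * x + l.2 ∈ B) (fun x => l.1 * x + l.2 ∈ B), card_product]
    simp only [hf]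
    push_cast
    ring
  have hw2 : ∑ p ∈ A.diag, w p ≤ n ^ 4 := by
    rw [sum_diag]
    simp only [hw, sum_filter, and_self]
    rw [sum_comm]
    calc _ ≤ ∑ l ∈ L, n ^ 2 := by
          refine sum_le_sum fun l _ => ?_
          rw [← sum_filter, sum_const, nsmul_eq_mul, sq]
          exact mul_le_mul (hfn l) (hfn l) (hf0 l) hn.le
      _ ≤ n ^ 2 * n ^ 2 := by
          rw [sum_const, nsmul_eq_mul]
          gcongr
      _ = _ := by ring
  have hw3 : n ^ 5 / (2 * K ^ 3) ≤ ∑ p ∈ A.offDiag, w p := by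
    have h1 : ∑ p ∈ A ×ˢ A, w p = ∑ p ∈ A.diag, w p + ∑ p ∈ A.offDiag, w p := by
      rw [← sum_union (disjoint_diag_offDiag A), diag_union_offDiag]
    rw [div_le_iff₀ (by positivity)]
    have h2 : K ^ 3 * n ^ 4 * 8 ≤ n ^ 5 := by
      calc K ^ 3 * n ^ 4 * 8 = (8 * K ^ 3) * n ^ 4 := by ring
        _ ≤ n * n ^ 4 := by gcongr
        _ = _ := by ring
    have h3 : K ^ 3 * ∑ l ∈ L, f l ^ (2 + 1) ≤ K ^ 3 * (n ^ 4 + ∑ p ∈ A.offDiag, w p) := by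
      rw [← hw1, h1]
      exact mul_le_mul_of_nonneg_left (add_le_add_left hw2 _) (by positivity)
    linarith [pow_pos hn 5]
  obtain ⟨⟨x₀, x₁⟩, hp, hpw⟩ : ∃ p ∈ A.offDiag, n ^ 3 / (2 * K ^ 3) ≤ w p := by
    apply exists_le_of_sum_le
    · rw [nonempty_iff_ne_empty]
      intro h
      rw [h, sum_empty] at hw3
      have : 0 < n ^ 5 / (2 * K ^ 3) := by positivity
      linarith
    · refine le_trans ?_ hw3
      rw [sum_const, nsmul_eq_mul]
      calc (#A.offDiag : ℝ) * (n ^ 3 / (2 * K ^ 3)) ≤ n ^ 2 * (n ^ 3 / (2 * K ^ 3)) := by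
            gcongr
            calc (#A.offDiag : ℝ) ≤ #(A ×ˢ A) := by
                  rw [offDiag_card, card_product]
                  exact Nat.cast_le.2 (Nat.sub_le _ _)
              _ ≤ n ^ 2 := by
                  rw [card_product, sq]; push_cast; gcongr
        _ = _ := by ring
  obtain ⟨hx₀, hx₁, hne⟩ := mem_offDiag.1 hp
  simp only at hx₀ hx₁ hne
  set g : ZMod q → ℝ := fun x =>
    (#{l ∈ {l ∈ L | l.1 * x₀ + l.2 ∈ B ∧ l.1 * x₁ + l.2 ∈ B} | l.1 * x + l.2 ∈ B} : ℝ) with hg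
  have hinj : ∀ (l l' : ZMod q × ZMod q), l.1 * x₀ + l.2 = l'.1 * x₀ + l'.2 →
      l.1 * x₁ + l.2 = l'.1 * x₁ + l'.2 → l = l' := by
    rintro ⟨m, b⟩ ⟨m', b'⟩ h h'
    simp only at h h'
    have : (m - m') * (x₀ - x₁) = 0 := by linear_combination h - h'
    have hm : m = m' := by
      rcases mul_eq_zero.1 this with h | h
      · exact sub_eq_zero.1 h
      · exact absurd (sub_eq_zero.1 h) hne
    subst hm
    rw [add_left_cancel h]
  have hgw : ∑ x ∈ A, g x = w (x₀, x₁) := by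
    simp only [hg, hw, hf]
    rw [sum_card_filter_comm A _ (fun x (l : ZMod q × ZMod q) => l.1 * x + l.2 ∈ B)]
  have hgn : ∀ x, g x ≤ n ^ 2 := by
    intro x
    calc g x ≤ #(B ×ˢ B) := by
          simp only [hg]
          norm_cast
          apply card_le_card_of_injOn (fun l => (l.1 * x₀ + l.2, l.1 * x₁ + l.2))
          · intro l hl
            simp only [coe_filter, mem_filter, Set.mem_ofPred_eq] at hl
            simpa using hl.1.2
          · intro l _ l' _ h
            exact hinj l l' (Prod.mk.inj h).1 (Prod.mk.inj h).2
      _ ≤ n ^ 2 := by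
          rw [card_product, sq]; push_cast; gcongr
  set A' := (A.erase x₀).erase x₁ with hA'
  have hA'A : A' ⊆ A := (erase_subset _ _).trans (erase_subset _ _)
  have hgA' : n ^ 3 / (4 * K ^ 3) ≤ ∑ x ∈ A', g x := by
    have h1 := add_sum_erase A g hx₀
    have h2 := add_sum_erase (A.erase x₀) g (mem_erase.2 ⟨hne.symm, hx₁⟩)
    have h4 : 2 * n ^ 2 ≤ n ^ 3 / (4 * K ^ 3) := by
      rw [le_div_iff₀ (by positivity)]
      calc 2 * n ^ 2 * (4 * K ^ 3) = (8 * K ^ 3) * n ^ 2 := by ring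
        _ ≤ n * n ^ 2 := by gcongr
        _ = _ := by ring
    linarith [hgn x₀, hgn x₁]
  have hpop := sum_le_card_filter_mul_add A' g (θ := n ^ 2 / (8 * K ^ 3)) (by positivity)
    (fun x _ => hgn x)
  set T := {x ∈ A' | n ^ 2 / (8 * K ^ 3) ≤ g x} with hT
  have hTn : n ≤ 8 * K ^ 3 * #T := by
    have h1 : (#A' : ℝ) * (n ^ 2 / (8 * K ^ 3)) ≤ n * (n ^ 2 / (8 * K ^ 3)) := by
      gcongr
      exact le_trans (by exact_mod_cast card_le_card hA'A) hA
    have h3 := le_of_mul_le_mul_right (by linarith : n / (8 * K ^ 3) * n ^ 2 ≤ #T * n ^ 2)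
      (by positivity)
    rw [div_le_iff₀ (by positivity)] at h3
    linarith
  have hTne : ∀ x ∈ T, x - x₀ ≠ 0 ∧ x₁ - x ≠ 0 := by
    intro x hx
    have hx := (mem_filter.1 hx).1
    rw [hA', mem_erase, mem_erase] at hx
    exact ⟨sub_ne_zero.2 hx.2.1, sub_ne_zero.2 hx.1.symm⟩
  have hne' : x₁ - x₀ ≠ 0 := sub_ne_zero.2 hne.symm
  have hΛcard : #(T.image fun x => (x - x₀) / (x₁ - x)) = #T := by
    apply card_image_of_injOn
    intro x hx y hy h
    simp only at h
    rw [div_eq_div_iff (hTne x hx).2 (hTne y hy).2] at h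
    have : (x - y) * (x₁ - x₀) = 0 := by linear_combination h
    exact sub_eq_zero.1 ((mul_eq_zero.1 this).resolve_right hne')
  have hfinal := le_pow_or_le_of_many_sums (B := B) (Λ := T.image fun x => (x - x₀) / (x₁ - x))
    (n := n) (K := K ^ 4) hn (by nlinarith [pow_le_pow_right₀ hK1 (by norm_num : 1 ≤ 4)]) hB
    (by rw [hΛcard]; exact hTn.trans (by gcongr))
    (by
      intro h
      obtain ⟨x, hx, h⟩ := mem_image.1 h
      exact div_ne_zero (hTne x hx).1 (hTne x hx).2 h)
    (by
      intro μ hμ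
      obtain ⟨x, hx, rfl⟩ := mem_image.1 hμ
      refine ⟨((x₁ - x₀) / (x₁ - x)) • B,
        le_trans (by exact_mod_cast card_image_le) hB, ?_⟩
      have hgx := (mem_filter.1 hx).2
      rw [div_le_iff₀ (by positivity), mul_comm] at hgx
      refine (hgx.trans (mul_le_mul_of_nonneg_right hK4 (by positivity))).trans ?_
      gcongr K ^ 4 * ?_
      refine Nat.cast_le.2 ?_
      apply card_le_card_of_injOn (fun l => (l.1 * x₀ + l.2, l.1 * x₁ + l.2))
      · intro l hl
        simp only [coe_filter, mem_filter, Set.mem_ofPred_eq, mem_product] at hl ⊢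
        refine ⟨hl.1.2, mem_smul_finset.2 ⟨_, hl.2, ?_⟩⟩
        have := (hTne x hx).2
        rw [smul_eq_mul]
        field_simp
        ring
      · intro l _ l' _ h
        exact hinj l l' (Prod.mk.inj h).1 (Prod.mk.inj h).2)
  rwa [← pow_mul] at hfinal

section Incidences

open scoped Classical

variable {V W : Type*} {P : Finset V} {L : Finset W} {r : V → W → Prop}

theorem sum_sq_card_filter_le
    (hr : ∀ p ∈ P, ∀ p' ∈ P, p ≠ p' → ∀ l ∈ L, ∀ l' ∈ L, r p l → r p' l → r p l' → r p' l' →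
      l = l') :
    ∑ l ∈ L, (#{p ∈ P | r p l} : ℝ) ^ 2 ≤ ∑ l ∈ L, (#{p ∈ P | r p l} : ℝ) +
      ∑ p ∈ P, (#{p' ∈ P | p ≠ p' ∧ ∃ l ∈ L, r p l ∧ r p' l} : ℝ) := by
  have h1 : ∑ l ∈ L, (#{p ∈ P | r p l} : ℝ) ^ 2 =
      ∑ x ∈ P ×ˢ P, (#{l ∈ L | r x.1 l ∧ r x.2 l} : ℝ) := by
    rw [sum_card_filter_comm (P ×ˢ P) L (fun x l => r x.1 l ∧ r x.2 l)]
    refine sum_congr rfl fun l _ => ?_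
    rw [filter_product (fun p => r p l) (fun p => r p l), card_product, Nat.cast_mul, sq]
  rw [h1, sum_product, ← sum_card_filter_comm P L r, ← sum_add_distrib]
  refine sum_le_sum fun p hp => ?_
  have h2 : (#{l ∈ L | r p l} : ℝ) = ∑ p' ∈ P, if p' = p then (#{l ∈ L | r p l} : ℝ) else 0 := by
    rw [sum_ite_eq' P p, if_pos hp]
  rw [h2, card_filter (fun p' => p ≠ p' ∧ ∃ l ∈ L, r p l ∧ r p' l), Nat.cast_sum,
    ← sum_add_distrib]
  refine sum_le_sum fun p' hp' => ?_
  by_cases hpp : p' = p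
  · subst hpp
    simp
  · rw [if_neg hpp, zero_add]
    norm_cast
    split_ifs with h
    · rw [card_le_one]
      intro l hl l' hl'
      obtain ⟨hl, h1, h2⟩ := mem_filter.1 hl
      obtain ⟨hl', h1', h2'⟩ := mem_filter.1 hl'
      exact hr p hp p' hp' (Ne.symm hpp) l hl l' hl' h1 h2 h1' h2'
    · rw [Nat.le_zero, card_eq_zero, filter_eq_empty_iff]
      intro l hl h'
      exact h ⟨Ne.symm hpp, l, hl, h'⟩

theorem sq_sum_card_filter_le
    (hr : ∀ p ∈ P, ∀ p' ∈ P, p ≠ p' → ∀ l ∈ L, ∀ l' ∈ L, r p l → r p' l → r p l' → r p' l' →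
      l = l') :
    (∑ l ∈ L, (#{p ∈ P | r p l} : ℝ)) ^ 2 ≤
      #L * (∑ l ∈ L, (#{p ∈ P | r p l} : ℝ) + (#P : ℝ) ^ 2) := by
  refine sq_sum_le_card_mul_sum_sq.trans ?_
  refine mul_le_mul_of_nonneg_left ((sum_sq_card_filter_le hr).trans ?_) (Nat.cast_nonneg _)
  gcongr
  rw [sq, ← nsmul_eq_mul, ← sum_const]
  exact sum_le_sum fun p _ => Nat.cast_le.2 (card_le_card (filter_subset _ _))

theorem sum_card_filter_le_of_heavy {n : ℝ} (hn : 0 < n) (hL : #L ≤ n ^ 2)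
    (hr : ∀ p ∈ P, ∀ p' ∈ P, p ≠ p' → ∀ l ∈ L, ∀ l' ∈ L, r p l → r p' l → r p l' → r p' l' →
      l = l') (hP : ∀ p ∈ P, 2 * n ≤ #{l ∈ L | r p l}) :
    ∑ p ∈ P, (#{l ∈ L | r p l} : ℝ) ≤ 2 * n ^ 2 := by
  have h := sq_sum_card_filter_le hr
  rw [← sum_card_filter_comm P L r] at h
  have h1 : (#P : ℝ) * (2 * n) ≤ ∑ p ∈ P, (#{l ∈ L | r p l} : ℝ) := by
    rw [← nsmul_eq_mul, ← sum_const]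
    exact sum_le_sum hP
  have h0 : (0 : ℝ) ≤ #P := Nat.cast_nonneg _
  generalize ∑ p ∈ P, (#{l ∈ L | r p l} : ℝ) = S at *
  have hS : 0 ≤ S := le_trans (by positivity) h1
  have h2 : S ^ 2 ≤ n ^ 2 * (S + (#P : ℝ) ^ 2) := h.trans (by gcongr)
  have h3 : ((#P : ℝ) * (2 * n)) ^ 2 ≤ S ^ 2 := by gcongr
  by_contra! h4
  nlinarith [mul_lt_mul_of_pos_right h4 (lt_of_le_of_lt (by positivity) h4)]

theorem exists_light_incidences {n K : ℝ} (hn : 0 < n) (hK : 1 ≤ K) (hnK : 16 * K ≤ n)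
    (hP : #P ≤ n ^ 2) (hL : #L ≤ n ^ 2)
    (hr : ∀ p ∈ P, ∀ p' ∈ P, p ≠ p' → ∀ l ∈ L, ∀ l' ∈ L, r p l → r p' l → r p l' → r p' l' →
      l = l') (hI : n ^ 3 ≤ K * ∑ l ∈ L, (#{p ∈ P | r p l} : ℝ)) :
    ∃ P₁ ⊆ P, ∃ L₁ ⊆ L, (∀ l ∈ L₁, #{p ∈ P₁ | r p l} ≤ 2 * n) ∧
      (∀ p ∈ P₁, n ≤ 4 * K * #{l ∈ L₁ | r p l} ∧ #{l ∈ L₁ | r p l} ≤ 2 * n) ∧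
      n ^ 3 ≤ 2 * K * ∑ l ∈ L₁, (#{p ∈ P₁ | r p l} : ℝ) := by
  have hK0 : 0 < K := by linarith
  set L₁ := {l ∈ L | ¬ 2 * n ≤ #{p ∈ P | r p l}} with hL₁
  have hL₁L : L₁ ⊆ L := filter_subset _ _
  have h1 : ∑ l ∈ L, (#{p ∈ P | r p l} : ℝ) ≤
      2 * n ^ 2 + ∑ l ∈ L₁, (#{p ∈ P | r p l} : ℝ) := by
    rw [← sum_filter_add_sum_filter_not L (fun l => 2 * n ≤ #{p ∈ P | r p l})]
    refine add_le_add_left (sum_card_filter_le_of_heavy (r := fun l p => r p l) hn hP ?_ ?_) _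
    · intro l hl l' hl' hne p hp p' hp' h1 h2 h3 h4
      by_contra h
      exact hne (hr p hp p' hp' h l (filter_subset _ _ hl) l' (filter_subset _ _ hl') h1 h3 h2 h4)
    · exact fun l hl => (mem_filter.1 hl).2
  set P₂ := {p ∈ P | n / (4 * K) ≤ #{l ∈ L₁ | r p l}} with hP₂
  have hP₂P : P₂ ⊆ P := filter_subset _ _
  have h2 : ∑ l ∈ L₁, (#{p ∈ P | r p l} : ℝ) ≤
      ∑ p ∈ P₂, (#{l ∈ L₁ | r p l} : ℝ) + n ^ 2 * (n / (4 * K)) := by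
    rw [← sum_card_filter_comm P L₁ r]
    refine (sum_le_sum_filter_add P (fun p => (#{l ∈ L₁ | r p l} : ℝ))
      (θ := n / (4 * K)) (by positivity)).trans ?_
    exact add_le_add_right (mul_le_mul_of_nonneg_right hP (by positivity)) _
  set P₁ := {p ∈ P₂ | ¬ 2 * n ≤ #{l ∈ L₁ | r p l}} with hP₁
  have hP₁P₂ : P₁ ⊆ P₂ := filter_subset _ _
  have h3 : ∑ p ∈ P₂, (#{l ∈ L₁ | r p l} : ℝ) ≤
      2 * n ^ 2 + ∑ l ∈ L₁, (#{p ∈ P₁ | r p l} : ℝ) := by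
    rw [← sum_filter_add_sum_filter_not P₂ (fun p => 2 * n ≤ #{l ∈ L₁ | r p l}),
      ← sum_card_filter_comm P₁ L₁ r]
    refine add_le_add_left (sum_card_filter_le_of_heavy hn
      (le_trans (Nat.cast_le.2 (card_le_card hL₁L)) hL) ?_ ?_) _
    · intro p hp p' hp' hne l hl l' hl'
      exact hr p (hP₂P (filter_subset _ _ hp)) p' (hP₂P (filter_subset _ _ hp')) hne l (hL₁L hl)
        l' (hL₁L hl')
    · exact fun p hp => (mem_filter.1 hp).2
  refine ⟨P₁, hP₁P₂.trans hP₂P, L₁, hL₁L, ?_, ?_, ?_⟩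
  · intro l hl
    refine le_trans (Nat.cast_le.2 (card_le_card (filter_subset_filter _ ?_)))
      (not_le.1 (mem_filter.1 hl).2).le
    exact hP₁P₂.trans hP₂P
  · intro p hp
    refine ⟨?_, (not_le.1 (mem_filter.1 hp).2).le⟩
    have := (mem_filter.1 (hP₁P₂ hp)).2
    rwa [div_le_iff₀ (by positivity), mul_comm] at this
  · generalize ∑ l ∈ L₁, (#{p ∈ P₁ | r p l} : ℝ) = S at *
    have h4 : ∑ l ∈ L, (#{p ∈ P | r p l} : ℝ) ≤ 4 * n ^ 2 + S + n ^ 2 * (n / (4 * K)) := by linarith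
    have h5 := hI.trans (mul_le_mul_of_nonneg_left h4 hK0.le)
    have h6 : K * (4 * n ^ 2 + S + n ^ 2 * (n / (4 * K))) =
        (16 * K) * n ^ 2 / 4 + K * S + n ^ 3 / 4 := by
      field_simp
      ring
    have h7 : (16 * K) * n ^ 2 ≤ n ^ 3 := by
      rw [pow_succ n 2, mul_comm]; gcongr
    linarith

theorem exists_ne_many_common_neighbours {V : Type*} {P : Finset V} {adj : V → V → Prop}
    {N M : ℝ} (hN : 0 < N) (hM : 0 < M) (hMN : 2 * M ^ 2 ≤ N) (hP : #P ≤ N)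
    (hadj : N ^ 2 ≤ M * ∑ p ∈ P, (#{t ∈ P | adj p t} : ℝ)) :
    ∃ p₁ ∈ P, ∃ p₂ ∈ P, p₁ ≠ p₂ ∧ N ≤ 2 * M ^ 2 * #{t ∈ P | adj p₁ t ∧ adj p₂ t} := by
  set c : V × V → ℝ := fun x => (#{t ∈ P | adj x.1 t ∧ adj x.2 t} : ℝ) with hc
  have hcN : ∀ x, c x ≤ N := fun x => (Nat.cast_le.2 (card_le_card (filter_subset _ _))).trans hP
  have h1 : ∑ x ∈ P ×ˢ P, c x = ∑ t ∈ P, (#{p ∈ P | adj p t} : ℝ) ^ 2 := by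
    simp only [hc]
    rw [sum_card_filter_comm (P ×ˢ P) P (fun x t => adj x.1 t ∧ adj x.2 t)]
    refine sum_congr rfl fun t _ => ?_
    rw [filter_product (fun p => adj p t) (fun p => adj p t), card_product, Nat.cast_mul, sq]
  have h2 : (∑ p ∈ P, (#{t ∈ P | adj p t} : ℝ)) ^ 2 ≤ N * ∑ x ∈ P ×ˢ P, c x := by
    rw [h1, sum_card_filter_comm P P adj]
    exact sq_sum_le_card_mul_sum_sq.trans
      (mul_le_mul_of_nonneg_right hP (sum_nonneg fun _ _ => sq_nonneg _))
  have h3 : ∑ x ∈ P ×ˢ P, c x ≤ N ^ 2 + ∑ x ∈ P.offDiag, c x := by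
    rw [← diag_union_offDiag, sum_union (disjoint_diag_offDiag P)]
    refine add_le_add_left ?_ _
    calc ∑ x ∈ P.diag, c x ≤ ∑ x ∈ P.diag, N := sum_le_sum fun x _ => hcN x
      _ = #P * N := by rw [sum_const, nsmul_eq_mul, diag_card]
      _ ≤ N ^ 2 := by rw [sq]; exact mul_le_mul_of_nonneg_right hP hN.le
  have h4 : N ^ 3 ≤ 2 * M ^ 2 * ∑ x ∈ P.offDiag, c x := by
    generalize ∑ x ∈ P ×ˢ P, c x = S at *
    generalize ∑ x ∈ P.offDiag, c x = S' at *
    generalize ∑ p ∈ P, (#{t ∈ P | adj p t} : ℝ) = D at *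
    refine le_of_mul_le_mul_right ?_ hN
    have h5 : (N ^ 2) ^ 2 ≤ (M * D) ^ 2 := by gcongr
    have h6 : (M * D) ^ 2 ≤ M ^ 2 * (N * (N ^ 2 + S')) := by
      rw [mul_pow]
      gcongr
      exact h2.trans (by gcongr)
    have h7 : 2 * M ^ 2 * N ^ 3 ≤ N * N ^ 3 := by gcongr
    linarith
  have hne : P.offDiag.Nonempty := by
    rw [nonempty_iff_ne_empty]
    intro h
    rw [h, sum_empty, mul_zero] at h4
    exact absurd h4 (not_le.2 (by positivity))
  have hcard : (#P.offDiag : ℝ) ≤ N ^ 2 := by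
    calc (#P.offDiag : ℝ) ≤ #P * #P := by
          rw [offDiag_card, ← Nat.cast_mul]
          exact Nat.cast_le.2 (Nat.sub_le _ _)
      _ ≤ N ^ 2 := by rw [sq]; gcongr
  obtain ⟨⟨p₁, p₂⟩, hp, hpc⟩ : ∃ x ∈ P.offDiag, N / (2 * M ^ 2) ≤ c x := by
    apply exists_le_of_sum_le hne
    rw [sum_const, nsmul_eq_mul]
    refine (mul_le_mul_of_nonneg_right hcard (by positivity)).trans ?_
    rw [← mul_div_assoc, div_le_iff₀ (by positivity)]
    linarith
  obtain ⟨hp₁, hp₂, hne⟩ := mem_offDiag.1 hp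
  rw [div_le_iff₀ (by positivity), mul_comm] at hpc
  exact ⟨p₁, hp₁, p₂, hp₂, hne, hpc⟩

/-- A configuration with many incidences contains a large one whose points are covered by few
lines through each of two given points. -/
theorem exists_pencils {n K : ℝ} (hK : 3072 ≤ K) (hnK : K ^ 5 ≤ n)
    (hP : #P ≤ n ^ 2) (hL : #L ≤ n ^ 2)
    (hr : ∀ p ∈ P, ∀ p' ∈ P, p ≠ p' → ∀ l ∈ L, ∀ l' ∈ L, r p l → r p' l → r p l' → r p' l' →
      l = l') (hI : n ^ 3 ≤ K * ∑ l ∈ L, (#{p ∈ P | r p l} : ℝ)) :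
    ∃ p₁ ∈ P, ∃ p₂ ∈ P, ∃ L₁ ⊆ L, ∃ P' ⊆ P, p₁ ≠ p₂ ∧
      #{l ∈ L₁ | r p₁ l} ≤ 2 * n ∧ #{l ∈ L₁ | r p₂ l} ≤ 2 * n ∧
      (∀ p ∈ P', (∃ l ∈ L₁, r p l ∧ r p₁ l ∧ ¬ r p₂ l) ∧ ∃ l ∈ L₁, r p l ∧ r p₂ l ∧ ¬ r p₁ l) ∧
      n ^ 3 ≤ K ^ 6 * ∑ l ∈ L₁ with ¬ r p₂ l, (#{p ∈ P' | r p l} : ℝ) := by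
  have hK0 : 0 < K := by linarith
  have hK1 : 1 ≤ K := by linarith
  have hKn₄ : 3072 * K ^ 4 ≤ n := by
    refine le_trans ?_ hnK
    rw [pow_succ K 4, mul_comm]
    gcongr
  have hKn : 3072 * K ^ 2 ≤ n := by
    refine le_trans ?_ hKn₄
    gcongr
    · norm_num
  have hn : 0 < n := lt_of_lt_of_le (by positivity) hKn
  have hK2 : 3072 * K ≤ K ^ 2 := by rw [sq]; gcongr
  obtain ⟨P₁, hP₁, L₁, hL₁, hl, hp, hI₁⟩ :=
    exists_light_incidences hn hK1 (by linarith) hP hL hr hI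
  have hr₁ : ∀ p ∈ P₁, ∀ p' ∈ P₁, p ≠ p' → ∀ l ∈ L₁, ∀ l' ∈ L₁, r p l → r p' l → r p l' →
      r p' l' → l = l' := fun p hp p' hp' hne l hl l' hl' =>
    hr p (hP₁ hp) p' (hP₁ hp') hne l (hL₁ hl) l' (hL₁ hl')
  have hL₁n : (#L₁ : ℝ) ≤ n ^ 2 := (Nat.cast_le.2 (card_le_card hL₁)).trans hL
  have hadj : (n ^ 2) ^ 2 ≤
      8 * K ^ 2 * ∑ p ∈ P₁, (#{p' ∈ P₁ | p ≠ p' ∧ ∃ l ∈ L₁, r p l ∧ r p' l} : ℝ) := by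
    have h1 := sum_sq_card_filter_le hr₁
    have h2 : (∑ l ∈ L₁, (#{p ∈ P₁ | r p l} : ℝ)) ^ 2 ≤
        #L₁ * ∑ l ∈ L₁, (#{p ∈ P₁ | r p l} : ℝ) ^ 2 := sq_sum_le_card_mul_sum_sq
    have h3 : ∑ l ∈ L₁, (#{p ∈ P₁ | r p l} : ℝ) ≤ n ^ 2 * (2 * n) := by
      refine (sum_le_sum hl).trans ?_
      rw [sum_const, nsmul_eq_mul]
      gcongr
    generalize ∑ p ∈ P₁, (#{p' ∈ P₁ | p ≠ p' ∧ ∃ l ∈ L₁, r p l ∧ r p' l} : ℝ) = D at *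
    generalize ∑ l ∈ L₁, (#{p ∈ P₁ | r p l} : ℝ) ^ 2 = S₂ at *
    generalize ∑ l ∈ L₁, (#{p ∈ P₁ | r p l} : ℝ) = S at *
    have h4 : S ^ 2 ≤ n ^ 2 * (n ^ 2 * (2 * n) + D) := by
      have h5 : S₂ ≤ n ^ 2 * (2 * n) + D := by linarith
      refine h2.trans (mul_le_mul hL₁n h5 ?_ (by positivity))
      by_contra! h6
      have : (#L₁ : ℝ) * S₂ ≤ 0 := mul_nonpos_of_nonneg_of_nonpos (Nat.cast_nonneg _) h6.le
      have h7 : S ≤ 0 := by nlinarith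
      have h8 : 2 * K * S ≤ 0 := mul_nonpos_of_nonneg_of_nonpos (by positivity) h7
      have : 0 < n ^ 3 := by positivity
      linarith
    have h5 : (n ^ 3) ^ 2 ≤ (2 * K * S) ^ 2 := by gcongr
    have h6 : (2 * K * S) ^ 2 ≤ 4 * K ^ 2 * (n ^ 2 * (n ^ 2 * (2 * n) + D)) := by
      rw [show (2 * K * S) ^ 2 = 4 * K ^ 2 * S ^ 2 by ring]
      gcongr
    have h7 : 3072 * K ^ 2 * n ^ 3 ≤ n * n ^ 3 := by gcongr
    have h8 : (n ^ 2) ^ 2 * n ^ 2 ≤ 4 * K ^ 2 * (n ^ 2 * (2 * n) + D) * n ^ 2 := by linarith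
    have h9 := le_of_mul_le_mul_right h8 (by positivity)
    have : 0 < K ^ 2 * n ^ 3 := by positivity
    linarith
  obtain ⟨p₁, hp₁, p₂, hp₂, hne, hN⟩ := exists_ne_many_common_neighbours
    (adj := fun p p' => p ≠ p' ∧ ∃ l ∈ L₁, r p l ∧ r p' l) (by positivity : 0 < n ^ 2)
    (by positivity : 0 < 8 * K ^ 2) (by
      have : (3072 * K ^ 2) ^ 2 ≤ n ^ 2 := by gcongr
      have : 0 < K ^ 4 := by positivity
      linarith) ((Nat.cast_le.2 (card_le_card hP₁)).trans hP) (by convert hadj)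
  set T := {t ∈ P₁ | (p₁ ≠ t ∧ ∃ l ∈ L₁, r p₁ l ∧ r t l) ∧ p₂ ≠ t ∧ ∃ l ∈ L₁, r p₂ l ∧ r t l}
    with hT
  set P' := {t ∈ T | ¬ ∃ l ∈ L₁, r t l ∧ r p₁ l ∧ r p₂ l} with hP'
  have hTP₁ : T ⊆ P₁ := filter_subset _ _
  have hP'T : P' ⊆ T := filter_subset _ _
  have hbad : (#{t ∈ T | ∃ l ∈ L₁, r t l ∧ r p₁ l ∧ r p₂ l} : ℝ) ≤ 2 * n := by
    by_cases h : ∃ l ∈ L₁, r p₁ l ∧ r p₂ l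
    · obtain ⟨l₀, hl₀, h1, h2⟩ := h
      refine le_trans (Nat.cast_le.2 (card_le_card ?_)) (hl l₀ hl₀)
      intro t ht
      obtain ⟨ht, l, hl, h3, h4, h5⟩ := mem_filter.1 ht
      rw [mem_filter]
      exact ⟨hTP₁ ht, hr₁ p₁ hp₁ p₂ hp₂ hne l hl l₀ hl₀ h4 h5 h1 h2 ▸ h3⟩
    · rw [filter_eq_empty_iff.2]
      · simpa using hn.le
      · rintro t - ⟨l, hl, -, h1, h2⟩
        exact h ⟨l, hl, h1, h2⟩
  have hcard : (#T : ℝ) = #{t ∈ T | ∃ l ∈ L₁, r t l ∧ r p₁ l ∧ r p₂ l} + #P' := by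
    exact_mod_cast (card_filter_add_card_filter_not _).symm
  have hP'n : n ^ 2 ≤ 256 * K ^ 4 * #P' := by
    have h1 : n ^ 2 ≤ 2 * (8 * K ^ 2) ^ 2 * #T := by convert hN
    have h2 : (#T : ℝ) ≤ 2 * n + #P' := by linarith
    have h3 : n ^ 2 ≤ 2 * (8 * K ^ 2) ^ 2 * (2 * n + #P') := h1.trans (by gcongr)
    have h4 : 3072 * K ^ 4 * n ≤ n ^ 2 := by rw [sq]; gcongr
    have : 0 ≤ K ^ 4 * n := by positivity
    linarith
  have hdeg : ∀ p ∈ P', n ≤ 8 * K * #{l ∈ {l ∈ L₁ | ¬ r p₂ l} | r p l} := by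
    intro p hpP
    have h1 : #{l ∈ L₁ | r p l} ≤ #{l ∈ {l ∈ L₁ | ¬ r p₂ l} | r p l} + 1 := by
      rw [filter_filter]
      rw [← card_filter_add_card_filter_not (s := {l ∈ L₁ | r p l}) (fun l => ¬ r p₂ l),
        filter_filter, filter_filter]
      simp only [not_not, and_comm]
      refine Nat.add_le_add_left ?_ _
      rw [card_le_one]
      intro l hl l' hl'
      obtain ⟨hl, h1, h2⟩ := mem_filter.1 hl
      obtain ⟨hl', h1', h2'⟩ := mem_filter.1 hl'
      have hpT := (mem_filter.1 (hP'T hpP))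
      exact hr₁ p₂ hp₂ p hpT.1 hpT.2.2.1 l hl l' hl' (by assumption) (by assumption)
        (by assumption) (by assumption)
    have h2 : (#{l ∈ L₁ | r p l} : ℝ) ≤ #{l ∈ {l ∈ L₁ | ¬ r p₂ l} | r p l} + 1 := by
      exact_mod_cast h1
    have h3 := (hp p (hTP₁ (hP'T hpP))).1
    have h4 := h3.trans (mul_le_mul_of_nonneg_left h2 (by positivity))
    linarith
  refine ⟨p₁, hP₁ hp₁, p₂, hP₁ hp₂, L₁, hL₁, P', (hP'T.trans hTP₁).trans hP₁, hne,
    (hp p₁ hp₁).2, (hp p₂ hp₂).2, ?_, ?_⟩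
  · intro p hpP
    obtain ⟨hpT, hpn⟩ := mem_filter.1 hpP
    obtain ⟨-, ⟨-, l, hl, h1, h2⟩, -, l', hl', h1', h2'⟩ := mem_filter.1 hpT
    exact ⟨⟨l, hl, h2, h1, fun h => hpn ⟨l, hl, h2, h1, h⟩⟩,
      ⟨l', hl', h2', h1', fun h => hpn ⟨l', hl', h2', h, h1'⟩⟩⟩
  · rw [← sum_card_filter_comm P' _ r]
    have h1 := sum_le_sum hdeg
    rw [sum_const, nsmul_eq_mul, ← mul_sum] at h1
    generalize ∑ p ∈ P', (#{l ∈ {l ∈ L₁ | ¬ r p₂ l} | r p l} : ℝ) = S at *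
    calc n ^ 3 = n ^ 2 * n := by ring
      _ ≤ 256 * K ^ 4 * #P' * n := by gcongr
      _ = 256 * K ^ 4 * (#P' * n) := by ring
      _ ≤ 256 * K ^ 4 * (8 * K * S) := by gcongr
      _ = 2048 * K ^ 5 * S := by ring
      _ ≤ K * K ^ 5 * S := by
          have : 0 ≤ S := by
            have : 0 ≤ 8 * K * S := le_trans (by positivity) h1
            exact nonneg_of_mul_nonneg_right this (by positivity)
          gcongr
          linarith
      _ = _ := by ring

end Incidences

section Plane

variable {F : Type*} [Field F]

theorem eq_of_le_of_le_of_finrank_eq {V : Type*} [AddCommGroup V] [Module F V]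
    [FiniteDimensional F V] {p p' l l' : Submodule F V} (hp : Module.finrank F p = 1)
    (hp' : Module.finrank F p' = 1) (hne : p ≠ p') (hl : Module.finrank F l = 2)
    (hl' : Module.finrank F l' = 2) (h1 : p ≤ l) (h2 : p' ≤ l) (h3 : p ≤ l') (h4 : p' ≤ l') :
    l = l' := by
  have hlt : p < p ⊔ p' := by
    refine lt_of_le_of_ne le_sup_left fun h => hne ?_
    have : p' ≤ p := h ▸ le_sup_right
    exact (Submodule.eq_of_le_of_finrank_eq this (by rw [hp, hp'])).symm
  have h5 := Submodule.finrank_lt_finrank_of_lt hlt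
  rw [← Submodule.eq_of_le_of_finrank_le (sup_le h1 h2) (by omega),
    ← Submodule.eq_of_le_of_finrank_le (sup_le h3 h4) (by omega)]

theorem exists_eq_span_singleton_of_finrank_eq_one {V : Type*} [AddCommGroup V] [Module F V]
    {p : Submodule F V} (hp : Module.finrank F p = 1) : ∃ v ≠ 0, p = Submodule.span F {v} := by
  obtain ⟨v, hv, h⟩ := finrank_eq_one_iff'.1 hp
  refine ⟨v, fun h' => hv (Subtype.ext h'), le_antisymm ?_ ?_⟩
  · intro w hw
    obtain ⟨c, hc⟩ := h ⟨w, hw⟩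
    exact Submodule.mem_span_singleton.2 ⟨c, congrArg Subtype.val hc⟩
  · rw [Submodule.span_singleton_le_iff_mem]
    exact v.2

theorem exists_eq_ker_of_finrank_eq_two {l : Submodule F (Fin 3 → F)}
    (hl : Module.finrank F l = 2) : ∃ φ : Module.Dual F (Fin 3 → F), l = LinearMap.ker φ := by
  have hlt : l < ⊤ := by
    rw [lt_top_iff_ne_top]
    rintro rfl
    simp at hl
  obtain ⟨φ, hφ, h⟩ := Submodule.exists_le_ker_of_lt_top l hlt
  refine ⟨φ, Submodule.eq_of_le_of_finrank_eq h ?_⟩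
  have := Module.Dual.finrank_ker_add_one_of_ne_zero hφ
  rw [Module.finrank_fin_fun] at this
  omega

theorem exists_basis_of_notMem_span {v₁ v₂ : Fin 3 → F} (h1 : v₁ ≠ 0)
    (h2 : v₂ ∉ Submodule.span F {v₁}) :
    ∃ b : Module.Basis (Fin 3) F (Fin 3 → F), b 0 = v₁ ∧ b 1 = v₂ := by
  have hli : LinearIndependent F ![v₂, v₁] :=
    linearIndependent_fin2.2 ⟨h1, fun a h => h2 (Submodule.mem_span_singleton.2 ⟨a, h⟩)⟩
  obtain ⟨v₃, h3⟩ : ∃ v₃, v₃ ∉ Submodule.span F (Set.range ![v₂, v₁]) := by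
    by_contra! h
    have h4 : Submodule.span F (Set.range ![v₂, v₁]) = ⊤ := eq_top_iff.2 fun w _ => h w
    have h5 := finrank_range_le_card (R := F) ![v₂, v₁]
    rw [Set.finrank, h4, finrank_top, Module.finrank_fin_fun] at h5
    simp at h5
  have hli₃ : LinearIndependent F ![v₃, v₂, v₁] := hli.finCons h3
  refine ⟨(basisOfLinearIndependentOfCardEqFinrank hli₃ (by simp)).reindex Fin.revPerm, ?_, ?_⟩ <;>
  simp [Fin.rev]

open scoped Classical in
/-- Affine coordinates in which two given points lie at infinity in the axis directions: points
covered by few lines through each of the two given points become a subset of a small grid. -/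
theorem exists_grid_of_pencils {P' L₁ : Finset (Submodule F (Fin 3 → F))}
    {p₁ p₂ : Submodule F (Fin 3 → F)} (hp₁ : Module.finrank F p₁ = 1)
    (hp₂ : Module.finrank F p₂ = 1) (hne : p₁ ≠ p₂) (hP : ∀ p ∈ P', Module.finrank F p = 1)
    (hL : ∀ l ∈ L₁, Module.finrank F l = 2)
    (hP₁ : ∀ p ∈ P', ∃ l ∈ L₁, p ≤ l ∧ p₁ ≤ l ∧ ¬ p₂ ≤ l)
    (hP₂ : ∀ p ∈ P', ∃ l ∈ L₁, p ≤ l ∧ p₂ ≤ l ∧ ¬ p₁ ≤ l) :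
    ∃ (A B : Finset F) (G : Finset (F × F)), #A ≤ #{l ∈ L₁ | p₂ ≤ l} ∧
      #B ≤ #{l ∈ L₁ | p₁ ≤ l} ∧ #G ≤ #L₁ ∧
      ∑ l ∈ L₁ with ¬ p₂ ≤ l, (#{p ∈ P' | p ≤ l} : ℝ) ≤
        ∑ g ∈ G, (#{x ∈ A | g.1 * x + g.2 ∈ B} : ℝ) := by
  obtain ⟨v₁, hv₁, rfl⟩ := exists_eq_span_singleton_of_finrank_eq_one hp₁
  obtain ⟨v₂, hv₂, rfl⟩ := exists_eq_span_singleton_of_finrank_eq_one hp₂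
  have hv : v₂ ∉ Submodule.span F {v₁} := by
    intro h
    exact hne (Submodule.eq_of_le_of_finrank_eq
      ((Submodule.span_singleton_le_iff_mem _ _).2 h) (by rw [hp₁, hp₂])).symm
  obtain ⟨b, hb₁, hb₂⟩ := exists_basis_of_notMem_span hv₁ hv
  have hb : ∀ w, w = b.repr w 0 • v₁ + b.repr w 1 • v₂ + b.repr w 2 • b 2 := by
    intro w
    conv_lhs => rw [← b.sum_repr w, Fin.sum_univ_three, hb₁, hb₂]
  simp only [Submodule.span_singleton_le_iff_mem] at *
  have hker : ∀ l ∈ L₁, ∃ φ : Module.Dual F (Fin 3 → F), ∀ w, w ∈ l ↔ φ w = 0 := by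
    intro l hl
    obtain ⟨φ, rfl⟩ := exists_eq_ker_of_finrank_eq_two (hL l hl)
    exact ⟨φ, fun w => LinearMap.mem_ker⟩
  choose! φ hφ using hker
  have hgen : ∀ p ∈ P', ∃ w, b.repr w 2 = 1 ∧ p = Submodule.span F {w} := by
    intro p hp
    obtain ⟨u, hu, rfl⟩ := exists_eq_span_singleton_of_finrank_eq_one (hP p hp)
    obtain ⟨l, hl, h1, h2, h3⟩ := hP₁ _ hp
    obtain ⟨l', hl', h1', h2', h3'⟩ := hP₂ _ hp
    rw [Submodule.span_singleton_le_iff_mem] at h1 h1'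
    have hZ : b.repr u 2 ≠ 0 := by
      intro hZ
      have hu' := hb u
      rw [hZ, zero_smul, add_zero] at hu'
      have hY : b.repr u 1 = 0 := by
        by_contra hY
        refine h3 ((Submodule.smul_mem_iff l hY).1 ?_)
        rw [← add_sub_cancel_left (b.repr u 0 • v₁) (b.repr u 1 • v₂), ← hu']
        exact l.sub_mem h1 (l.smul_mem _ h2)
      rw [hY, zero_smul, add_zero] at hu'
      have hX : b.repr u 0 ≠ 0 := by
        intro hX
        rw [hX, zero_smul] at hu'
        exact hu hu'
      refine h3' ((Submodule.smul_mem_iff l' hX).1 ?_)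
      rwa [← hu']
    refine ⟨(b.repr u 2)⁻¹ • u, by simp [hZ], ?_⟩
    exact (Submodule.span_singleton_smul_eq (IsUnit.mk0 _ (inv_ne_zero hZ)) u).symm
  choose! w hwZ hwp using hgen
  have hmem : ∀ p ∈ P', ∀ l ∈ L₁, p ≤ l ↔
      b.repr (w p) 0 * φ l v₁ + b.repr (w p) 1 * φ l v₂ + φ l (b 2) = 0 := by
    intro p hp l hl
    conv_lhs => rw [hwp p hp]
    rw [Submodule.span_singleton_le_iff_mem, hφ l hl]
    conv_lhs => rw [hb (w p), hwZ p hp]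
    simp
  refine ⟨P'.image fun p => b.repr (w p) 0, P'.image fun p => b.repr (w p) 1,
    {l ∈ L₁ | v₂ ∉ l}.image fun l => (-(φ l v₁ / φ l v₂), -(φ l (b 2) / φ l v₂)), ?_, ?_,
    card_image_le.trans (card_le_card (filter_subset _ _)), ?_⟩
  · refine (card_le_card ?_).trans
      (card_image_le (s := {l ∈ L₁ | v₂ ∈ l}) (f := fun l => -(φ l (b 2) / φ l v₁)))
    intro x hx
    obtain ⟨p, hp, rfl⟩ := mem_image.1 hx
    obtain ⟨l, hl, h1, h2, h3⟩ := hP₂ _ hp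
    refine mem_image.2 ⟨l, mem_filter.2 ⟨hl, h2⟩, ?_⟩
    rw [hmem p hp l hl, (hφ l hl v₂).1 h2] at h1
    rw [hφ l hl] at h3
    field_simp
    linear_combination -h1
  · refine (card_le_card ?_).trans
      (card_image_le (s := {l ∈ L₁ | v₁ ∈ l}) (f := fun l => -(φ l (b 2) / φ l v₂)))
    intro x hx
    obtain ⟨p, hp, rfl⟩ := mem_image.1 hx
    obtain ⟨l, hl, h1, h2, h3⟩ := hP₁ _ hp
    refine mem_image.2 ⟨l, mem_filter.2 ⟨hl, h2⟩, ?_⟩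
    rw [hmem p hp l hl, (hφ l hl v₁).1 h2] at h1
    rw [hφ l hl] at h3
    field_simp
    linear_combination -h1
  · have hφ₂ : ∀ l ∈ ({l ∈ L₁ | v₂ ∉ l} : Finset _), l ∈ L₁ ∧ φ l v₂ ≠ 0 := by
      intro l hl
      obtain ⟨hl, h⟩ := mem_filter.1 hl
      exact ⟨hl, fun h' => h ((hφ l hl v₂).2 h')⟩
    rw [sum_image]
    · refine sum_le_sum fun l hl => Nat.cast_le.2 ?_
      obtain ⟨hl, h2⟩ := hφ₂ l hl
      apply card_le_card_of_injOn (fun p => b.repr (w p) 0)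
      · intro p hp
        obtain ⟨hp, h1⟩ := mem_filter.1 hp
        rw [hmem p hp l hl] at h1
        refine mem_filter.2 ⟨mem_image_of_mem _ hp, mem_image.2 ⟨p, hp, ?_⟩⟩
        simp only
        field_simp
        linear_combination h1
      · intro p hp p' hp' h
        obtain ⟨hp, h1⟩ := mem_filter.1 hp
        obtain ⟨hp', h1'⟩ := mem_filter.1 hp'
        simp only at h
        rw [hmem p hp l hl] at h1
        rw [hmem p' hp' l hl, ← h] at h1'
        have h3 : b.repr (w p) 1 = b.repr (w p') 1 :=
          mul_right_cancel₀ h2 (by linear_combination h1 - h1')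
        rw [hwp p hp, hwp p' hp', hb (w p), hb (w p'), hwZ p hp, hwZ p' hp', h, h3]
    · intro l hl l' hl' h
      obtain ⟨hl, h2⟩ := hφ₂ l hl
      obtain ⟨hl', h2'⟩ := hφ₂ l' hl'
      simp only [Prod.mk.injEq, neg_inj] at h
      obtain ⟨h3, h4⟩ := h
      rw [div_eq_div_iff h2 h2'] at h3 h4
      ext u
      rw [hφ l hl, hφ l' hl', hb u]
      simp only [map_add, map_smul, smul_eq_mul]
      constructor
      · intro h
        refine (mul_eq_zero.1 ?_).resolve_left h2
        linear_combination φ l' v₂ * h - b.repr u 0 * h3 - b.repr u 2 * h4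
      · intro h
        refine (mul_eq_zero.1 ?_).resolve_left h2'
        linear_combination φ l v₂ * h + b.repr u 0 * h3 + b.repr u 2 * h4

end Plane

open scoped Classical in
theorem le_pow_or_le_of_incidences {q : ℕ} [Fact q.Prime]
    {P L : Finset (Submodule (ZMod q) (Fin 3 → ZMod q))}
    (hP : ∀ p ∈ P, Module.finrank (ZMod q) p = 1) (hL : ∀ l ∈ L, Module.finrank (ZMod q) l = 2)
    {n K : ℝ} (hK : 3072 ≤ K) (hPn : #P ≤ n ^ 2) (hLn : #L ≤ n ^ 2)
    (hI : n ^ 3 ≤ K * ∑ l ∈ L, (#{p ∈ P | p ≤ l} : ℝ)) :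
    n ≤ K ^ 140001 ∨ (q : ℝ) ≤ K ^ 140001 * n := by
  have hK0 : 0 < K := by linarith
  have hK1 : 1 ≤ K := by linarith
  by_cases hnK : n ≤ K ^ 5
  · exact Or.inl (hnK.trans (pow_le_pow_right₀ hK1 (by norm_num)))
  rw [not_le] at hnK
  have hn : 0 < n := lt_trans (by positivity) hnK
  obtain ⟨p₁, hp₁, p₂, hp₂, L₁, hL₁, P', hP', hne, h1, h2, h3, h4⟩ :=
    exists_pencils (r := fun p l => p ≤ l) hK hnK.le hPn hLn
      (fun p hp p' hp' hne l hl l' hl' h1 h2 h3 h4 => eq_of_le_of_le_of_finrank_eq (hP p hp)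
        (hP p' hp') hne (hL l hl) (hL l' hl') h1 h2 h3 h4) hI
  obtain ⟨A, B, G, hA, hB, hG, hS⟩ := exists_grid_of_pencils (hP p₁ hp₁) (hP p₂ hp₂) hne
    (fun p hp => hP p (hP' hp)) (fun l hl => hL l (hL₁ hl)) (fun p hp => (h3 p hp).1)
    (fun p hp => (h3 p hp).2)
  have hK7 : ∀ {S : ℝ}, n ^ 3 ≤ K ^ 6 * S → 0 ≤ S → (2 * n) ^ 3 ≤ K ^ 7 * S := by
    intro S h hS
    have h' : 8 * (K ^ 6 * S) ≤ K * (K ^ 6 * S) :=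
      mul_le_mul_of_nonneg_right (by linarith) (by positivity)
    linarith
  have hgrid := le_pow_or_le_of_grid_incidences (A := A) (B := B) (L := G) (n := 2 * n)
    (K := K ^ 7) (by positivity) (hK.trans (le_self_pow₀ hK1 (by norm_num)))
    ((Nat.cast_le.2 hA).trans h2) ((Nat.cast_le.2 hB).trans h1)
    (by
      have : (#G : ℝ) ≤ #L := Nat.cast_le.2 (hG.trans (card_le_card hL₁))
      linarith [sq_nonneg n])
    (by
      have h5 := h4.trans (mul_le_mul_of_nonneg_left hS (by positivity))
      convert hK7 h5 (sum_nonneg fun _ _ => Nat.cast_nonneg _))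
  rw [← pow_mul] at hgrid
  have h9 : K ^ (7 * 20000) * (2 * n) ≤ K ^ 140001 * n := by
    rw [pow_succ K 140000, mul_assoc _ K]
    exact mul_le_mul_of_nonneg_left (mul_le_mul_of_nonneg_right (by linarith) hn.le) (by positivity)
  rcases hgrid with h | h
  · left
    have : K ^ (7 * 20000) ≤ K ^ 140001 := pow_le_pow_right₀ hK1 (by norm_num)
    linarith
  · exact Or.inr (h.trans h9)

open scoped Classical in
theorem card_incidences_le {q : ℕ} [Fact q.Prime]
    {P L : Finset (Submodule (ZMod q) (Fin 3 → ZMod q))}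
    (hP : ∀ p ∈ P, Module.finrank (ZMod q) p = 1) (hL : ∀ l ∈ L, Module.finrank (ZMod q) l = 2)
    {N ε : ℝ} (hN1 : 1 < N) (hPN : #P ≤ N) (hLN : #L ≤ N)
    (hεN : ε * 140001 < 1 / 2) (hq : N ^ (ε * 140001 + 1 / 2) < q) :
    (#{pl ∈ P ×ˢ L | pl.1 ≤ pl.2} : ℝ) ≤ 6144 * N ^ (3 / 2 - ε) := by
  have hN0 : 0 < N := by linarith
  rw [card_filter_product_eq_sum P L (fun p l => p ≤ l), sum_card_filter_comm P L (fun p l => p ≤ l)]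
  by_contra! hI
  have hr : ∀ p ∈ P, ∀ p' ∈ P, p ≠ p' → ∀ l ∈ L, ∀ l' ∈ L, p ≤ l → p' ≤ l → p ≤ l' → p' ≤ l' →
      l = l' := fun p hp p' hp' hne l hl l' hl' h1 h2 h3 h4 =>
    eq_of_le_of_le_of_finrank_eq (hP p hp) (hP p' hp') hne (hL l hl) (hL l' hl') h1 h2 h3 h4
  have hsq := sq_sum_card_filter_le hr
  have hmain := le_pow_or_le_of_incidences hP hL (n := N ^ (1 / 2 : ℝ)) (K := N ^ ε)
  have hn2 : (N ^ (1 / 2 : ℝ)) ^ 2 = N := by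
    rw [← Real.rpow_natCast, ← Real.rpow_mul hN0.le]
    norm_num
  have hn3 : (N ^ (1 / 2 : ℝ)) ^ 3 = N ^ ε * N ^ (3 / 2 - ε) := by
    rw [← Real.rpow_natCast, ← Real.rpow_mul hN0.le, ← Real.rpow_add hN0]
    norm_num
  rw [hn2, hn3] at hmain
  have hn1 : 1 < N ^ (1 / 2 : ℝ) := Real.one_lt_rpow hN1 (by norm_num)
  have hK0 : 0 < N ^ ε := Real.rpow_pos_of_pos hN0 _
  have hE0 : 0 < N ^ (3 / 2 - ε) := Real.rpow_pos_of_pos hN0 _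
  have htrivial : ∑ l ∈ L, (#{p ∈ P | p ≤ l} : ℝ) ≤ 2 * (N ^ (1 / 2 : ℝ)) ^ 3 := by
    generalize ∑ l ∈ L, (#{p ∈ P | p ≤ l} : ℝ) = S at *
    generalize N ^ (1 / 2 : ℝ) = n at *
    subst hn2
    have hS : 0 ≤ S := le_trans (by positivity) hI.le
    have h1 : S ^ 2 ≤ n ^ 2 * (S + (n ^ 2) ^ 2) := hsq.trans (by gcongr)
    by_contra! h2
    have h3 : n ^ 2 * S ≤ n ^ 3 * S := by
      gcongr
      · exact hn1.le
      · norm_num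
    have h4 : 0 < n ^ 3 := by positivity
    nlinarith
  have hK : 3072 ≤ N ^ ε := by
    rw [hn3] at htrivial
    have h1 : 6144 * N ^ (3 / 2 - ε) ≤ (2 * N ^ ε) * N ^ (3 / 2 - ε) := by linarith
    linarith [le_of_mul_le_mul_right h1 hE0]
  rw [← Real.rpow_natCast, ← Real.rpow_mul hN0.le] at hmain
  rcases hmain hK hPN hLN (mul_le_mul_of_nonneg_left (by linarith) hK0.le) with h | h
  · exact absurd h (not_le.2 (Real.rpow_lt_rpow_of_exponent_lt hN1 (by push_cast; exact hεN)))
  · rw [← Real.rpow_add hN0] at h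
    push_cast at h
    exact absurd hq (not_lt.2 h)

end

open scoped Classical in
theorem szemeredi_trotter_finite_field :
    ∀ α : ℝ, 0 < α → α < 2 →
      ∃ ε : ℝ, 0 < ε ∧ ∃ C : ℝ, 0 < C ∧
        ∀ q : ℕ, q.Prime →
          ∀ P L : Finset (Submodule (ZMod q) (Fin 3 → ZMod q)),
            (∀ p ∈ P, Module.finrank (ZMod q) p = 1) →
            (∀ l ∈ L, Module.finrank (ZMod q) l = 2) →
            (P.card : ℝ) ≤ (q : ℝ) ^ α → (L.card : ℝ) ≤ (q : ℝ) ^ α →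
            (((P ×ˢ L).filter fun pl => pl.1 ≤ pl.2).card : ℝ)
              ≤ C * ((q : ℝ) ^ α) ^ (3 / 2 - ε : ℝ) := by
  intro α hα0 hα2
  have hα : 1 / 2 < 1 / α := one_div_lt_one_div_of_lt hα0 hα2
  obtain ⟨ε, hε0, hε1, hε2⟩ : ∃ ε : ℝ, 0 < ε ∧ ε * 140001 < 1 / 2 ∧
      ε * 140001 + 1 / 2 < 1 / α := by
    refine ⟨min (1 / 2) (1 / α - 1 / 2) / 140002, ?_, ?_, ?_⟩
    · have : 0 < min (1 / 2) (1 / α - 1 / 2) := lt_min (by norm_num) (by linarith)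
      positivity
    · linarith [min_le_left (1 / 2) (1 / α - 1 / 2)]
    · have : 0 < min (1 / 2) (1 / α - 1 / 2) := lt_min (by norm_num) (by linarith)
      linarith [min_le_right (1 / 2) (1 / α - 1 / 2)]
  refine ⟨ε, hε0, 6144, by norm_num, fun q hq P L hP hL hPN hLN => ?_⟩
  have : Fact q.Prime := ⟨hq⟩
  have hq1 : (1 : ℝ) < q := by exact_mod_cast hq.one_lt
  have hqN : (q : ℝ) = ((q : ℝ) ^ α) ^ (1 / α) := by
    rw [← Real.rpow_mul (by linarith), mul_one_div_cancel hα0.ne', Real.rpow_one]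
  have hN1 : 1 < (q : ℝ) ^ α := Real.one_lt_rpow hq1 hα0
  refine card_incidences_le hP hL hN1 hPN hLN hε1 ?_
  conv_rhs => rw [hqN]
  exact Real.rpow_lt_rpow_of_exponent_lt hN1 hε2
end

section
/- For every α with 0 < α < 2 there exist ε = ε(α) > 0 and c = c(α) > 0 such that: for every prime p with p ≡ 3 (mod 4), setting F = ℤ/pℤ, and every subset P of F² with (1/2)·|F|^α ≤ |P| ≤ |F|^α, the distance set Δ(P) := {(x₁−x₂)² + (y₁−y₂)² : (x₁,y₁), (x₂,y₂) ∈ P} satisfies |Δ(P)| ≥ c·|P|^{1/2 + ε}. -/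
open Finset
open scoped Pointwise

section Dilates

variable {F : Type*} [Field F] [DecidableEq F]

/-- The dilate `t B` of a finite set `B` has a small difference set with `B`. -/
def SmallDilate (B : Finset F) (K : ℝ) (t : F) : Prop :=
  (#(B - B.image (t * ·)) : ℝ) ≤ K * #B

namespace SmallDilate

variable {B : Finset F} {K : ℝ} {s t : F}

lemma mono {K' : ℝ} (h : SmallDilate B K t) (hK : K ≤ K') : SmallDilate B K' t :=
  le_trans h (by gcongr)

lemma exists_cover (hB : B.Nonempty) (h : SmallDilate B K t) :
    ∃ Z : Finset F, (#Z : ℝ) ≤ K ∧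
      ∀ b ∈ B, ∃ z ∈ Z, ∃ b₁ ∈ B, ∃ b₂ ∈ B, t * b = z + (b₁ - b₂) := by
  have hcard : (#(B.image (t * ·) + -B) : ℝ) ≤ K * #(-B) := by
    rw [card_neg, ← sub_eq_add_neg, ← card_neg, neg_sub]
    exact h
  obtain ⟨Z, -, hZ, hsub⟩ := ruzsa_covering_add hB.neg hcard
  refine ⟨Z, hZ, fun b hb => ?_⟩
  obtain ⟨z, hz, d, hd, hzd⟩ := mem_add.1 (hsub (mem_image_of_mem _ hb))
  obtain ⟨x, hx, y, hy, rfl⟩ := mem_sub.1 hd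
  exact ⟨z, hz, -y, mem_neg'.1 hy, -x, mem_neg'.1 hx, by rw [← hzd]; ring⟩

lemma of_cover (hB : B.Nonempty) (h₁ : SmallDilate B K 1) (Z : Finset F)
    (hZ : ∀ b ∈ B, ∃ z ∈ Z, ∃ b₁ ∈ B, ∃ b₂ ∈ B, ∃ b₃ ∈ B, ∃ b₄ ∈ B,
      t * b = z + (b₁ + b₂) - (b₃ + b₄)) :
    SmallDilate B (#Z * K ^ 5) t := by
  have hsub : B - B.image (t * ·) ⊆ -Z + (3 • B - 2 • B) := by
    intro x hx
    obtain ⟨b, hb, y, hy, rfl⟩ := mem_sub.1 hx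
    obtain ⟨c, hc, rfl⟩ := mem_image.1 hy
    obtain ⟨z, hz, b₁, h₁, b₂, h₂, b₃, h₃, b₄, h₄, h⟩ := hZ c hc
    refine mem_add.2 ⟨-z, neg_mem_neg hz, (b + b₃ + b₄) - (b₁ + b₂), ?_, ?_⟩
    · refine sub_mem_sub ?_ ?_
      · rw [succ_nsmul, two_nsmul]
        exact add_mem_add (add_mem_add hb h₃) h₄
      · rw [two_nsmul]
        exact add_mem_add h₁ h₂
    · simp only [h]
      ring
  have hpl : (#(3 • B - 2 • B) : ℝ) ≤ (#(B - B) / #B : ℝ) ^ 5 * #B := by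
    have h := pluennecke_ruzsa_inequality_nsmul_sub_nsmul_sub hB B 3 2
    simpa using (NNRat.cast_le (K := ℝ)).2 h
  have hB0 : (0 : ℝ) < #B := by exact_mod_cast hB.card_pos
  have hd : (#(B - B) / #B : ℝ) ≤ K := by
    rw [div_le_iff₀ hB0]
    simpa [SmallDilate] using h₁
  calc (#(B - B.image (t * ·)) : ℝ) ≤ #(-Z + (3 • B - 2 • B)) := by
        exact_mod_cast card_le_card hsub
    _ ≤ #Z * #(3 • B - 2 • B) := by
        have := card_add_le (s := -Z) (t := 3 • B - 2 • B)
        rw [card_neg] at this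
        exact_mod_cast this
    _ ≤ #Z * ((#(B - B) / #B : ℝ) ^ 5 * #B) := by gcongr
    _ ≤ #Z * (K ^ 5 * #B) := by gcongr
    _ = #Z * K ^ 5 * #B := by ring

lemma add (hs : SmallDilate B K s) (ht : SmallDilate B K t) (hB : B.Nonempty) (hK : 1 ≤ K)
    (h₁ : SmallDilate B K 1) : SmallDilate B (K ^ 8) (s + t) := by
  obtain ⟨Z, hZ, hsZ⟩ := hs.exists_cover hB
  obtain ⟨W, hW, htW⟩ := ht.exists_cover hB
  refine (of_cover hB h₁ (Z + W) fun b hb => ?_).mono ?_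
  · obtain ⟨z, hz, b₁, h₁, b₂, h₂, e⟩ := hsZ b hb
    obtain ⟨w, hw, b₃, h₃, b₄, h₄, e'⟩ := htW b hb
    exact ⟨z + w, add_mem_add hz hw, b₁, h₁, b₃, h₃, b₂, h₂, b₄, h₄, by rw [add_mul, e, e']; ring⟩
  · have : (#(Z + W) : ℝ) ≤ #Z * #W := by exact_mod_cast card_add_le
    calc (#(Z + W) : ℝ) * K ^ 5 ≤ (K * K) * K ^ 5 := by
          gcongr; exact this.trans (by gcongr)
      _ = K ^ 7 := by ring
      _ ≤ K ^ 8 := pow_le_pow_right₀ hK (by norm_num)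

lemma sub (hs : SmallDilate B K s) (ht : SmallDilate B K t) (hB : B.Nonempty) (hK : 1 ≤ K)
    (h₁ : SmallDilate B K 1) : SmallDilate B (K ^ 8) (s - t) := by
  obtain ⟨Z, hZ, hsZ⟩ := hs.exists_cover hB
  obtain ⟨W, hW, htW⟩ := ht.exists_cover hB
  refine (of_cover hB h₁ (Z - W) fun b hb => ?_).mono ?_
  · obtain ⟨z, hz, b₁, h₁, b₂, h₂, e⟩ := hsZ b hb
    obtain ⟨w, hw, b₃, h₃, b₄, h₄, e'⟩ := htW b hb
    exact ⟨z - w, sub_mem_sub hz hw, b₁, h₁, b₄, h₄, b₂, h₂, b₃, h₃, by rw [sub_mul, e, e']; ring⟩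
  · have : (#(Z - W) : ℝ) ≤ #Z * #W := by exact_mod_cast card_sub_le
    calc (#(Z - W) : ℝ) * K ^ 5 ≤ (K * K) * K ^ 5 := by
          gcongr; exact this.trans (by gcongr)
      _ = K ^ 7 := by ring
      _ ≤ K ^ 8 := pow_le_pow_right₀ hK (by norm_num)

lemma mul (hs : SmallDilate B K s) (ht : SmallDilate B K t) (hB : B.Nonempty) (hK : 1 ≤ K)
    (h₁ : SmallDilate B K 1) : SmallDilate B (K ^ 8) (s * t) := by
  obtain ⟨Z, hZ, hsZ⟩ := hs.exists_cover hB
  obtain ⟨W, hW, htW⟩ := ht.exists_cover hB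
  refine (of_cover hB h₁ (W.image (s * ·) + (Z - Z)) fun b hb => ?_).mono ?_
  · obtain ⟨w, hw, b₁, h₁, b₂, h₂, e⟩ := htW b hb
    obtain ⟨z, hz, c₁, k₁, c₂, k₂, e₁⟩ := hsZ b₁ h₁
    obtain ⟨y, hy, c₃, k₃, c₄, k₄, e₂⟩ := hsZ b₂ h₂
    refine ⟨s * w + (z - y), add_mem_add (mem_image_of_mem _ hw) (sub_mem_sub hz hy),
      c₁, k₁, c₄, k₄, c₂, k₂, c₃, k₃, ?_⟩
    rw [mul_assoc, e, mul_add, mul_sub, e₁, e₂]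
    ring
  · have h : #(W.image (s * ·) + (Z - Z)) ≤ #W * (#Z * #Z) :=
      card_add_le.trans (Nat.mul_le_mul card_image_le card_sub_le)
    have h' : (#(W.image (s * ·) + (Z - Z)) : ℝ) ≤ #W * (#Z * #Z) := by exact_mod_cast h
    calc (#(W.image (s * ·) + (Z - Z)) : ℝ) * K ^ 5 ≤ (K * (K * K)) * K ^ 5 := by
          gcongr; exact h'.trans (by gcongr)
      _ = K ^ 8 := by ring

lemma inv (h : SmallDilate B K t) : SmallDilate B K t⁻¹ := by
  rcases eq_or_ne t 0 with rfl | ht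
  · simpa using h
  have hcard : #(B - B.image (t⁻¹ * ·)) = #(B - B.image (t * ·)) := by
    have hneg : B.image (t * ·) - B = (B - B.image (t⁻¹ * ·)).image (t * ·) := by
      ext x
      simp only [mem_sub, mem_image]
      constructor
      · rintro ⟨_, ⟨b, hb, rfl⟩, c, hc, rfl⟩
        exact ⟨_, ⟨b, hb, _, ⟨c, hc, rfl⟩, rfl⟩, by field_simp⟩
      · rintro ⟨_, ⟨b, hb, _, ⟨c, hc, rfl⟩, rfl⟩, rfl⟩
        exact ⟨_, ⟨b, hb, rfl⟩, c, hc, by field_simp⟩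
    rw [← card_neg (B - B.image (t * ·)), neg_sub, hneg,
      card_image_of_injective _ (mul_right_injective₀ ht)]
  unfold SmallDilate
  rw [hcard]
  exact h

end SmallDilate

end Dilates

section Pivot

variable {p : ℕ} [Fact p.Prime]

/-- If `(M - M) / (M - M)` is not everything, then it contains some `x` but not `x + 1`. -/
lemma exists_quotient_succ_notMem {M : Finset (ZMod p)} {ξ : ZMod p}
    (hξ : ∀ a ∈ M, ∀ b ∈ M, ∀ c ∈ M, ∀ d ∈ M, c ≠ d → ξ ≠ (a - b) / (c - d)) (h2 : 2 ≤ #M) :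
    ∃ a ∈ M, ∃ b ∈ M, ∃ c ∈ M, ∃ d ∈ M, c ≠ d ∧
      ∀ a' ∈ M, ∀ b' ∈ M, ∀ c' ∈ M, ∀ d' ∈ M, c' ≠ d' →
        (a - b) / (c - d) + 1 ≠ (a' - b') / (c' - d') := by
  by_contra! hcon
  have key : ∀ n : ℕ, ∃ a ∈ M, ∃ b ∈ M, ∃ c ∈ M, ∃ d ∈ M, c ≠ d ∧ (n : ZMod p) = (a - b) / (c - d) := by
    intro n
    induction n with
    | zero =>
      obtain ⟨c, hc, d, hd, hcd⟩ := one_lt_card.1 h2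
      exact ⟨c, hc, c, hc, c, hc, d, hd, hcd, by simp⟩
    | succ n ih =>
      obtain ⟨a, ha, b, hb, c, hc, d, hd, hcd, e⟩ := ih
      obtain ⟨a', ha', b', hb', c', hc', d', hd', hcd', e'⟩ := hcon a ha b hb c hc d hd hcd
      exact ⟨a', ha', b', hb', c', hc', d', hd', hcd', by push_cast; rw [e, e']⟩
  obtain ⟨a, ha, b, hb, c, hc, d, hd, hcd, e⟩ := key ξ.val
  rw [ZMod.natCast_zmod_val] at e
  exact hξ a ha b hb c hc d hd hcd e

/-- One pivoting step: the dilates with small difference set either exhaust the prime field, or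
contain a set quadratically larger than a given one. -/
lemma smallDilate_all_or_square {B M : Finset (ZMod p)} {K : ℝ} (hB : B.Nonempty) (hK : 1 ≤ K)
    (h₁ : SmallDilate B K 1) (hM : ∀ t ∈ M, SmallDilate B K t) (h2 : 2 ≤ #M) :
    (∀ t, SmallDilate B ((((K ^ 8) ^ 8) ^ 8) ^ 8) t) ∨
      ∃ M' : Finset (ZMod p), #M' = #M ^ 2 ∧
        ∀ t ∈ M', SmallDilate B ((((K ^ 8) ^ 8) ^ 8) ^ 8) t := by
  obtain ⟨K₁, hK₁⟩ : ∃ x, x = K ^ 8 := ⟨_, rfl⟩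
  obtain ⟨K₂, hK₂⟩ : ∃ x, x = K₁ ^ 8 := ⟨_, rfl⟩
  obtain ⟨K₃, hK₃⟩ : ∃ x, x = K₂ ^ 8 := ⟨_, rfl⟩
  have l₁ : K ≤ K₁ := hK₁ ▸ le_self_pow₀ hK (by norm_num)
  have l₂ : K₁ ≤ K₂ := hK₂ ▸ le_self_pow₀ (hK.trans l₁) (by norm_num)
  have l₃ : K₂ ≤ K₃ := hK₃ ▸ le_self_pow₀ (hK.trans (l₁.trans l₂)) (by norm_num)
  have o₁ := hK.trans l₁
  have o₂ := o₁.trans l₂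
  have o₃ := o₂.trans l₃
  have u₁ := h₁.mono l₁
  have u₂ := u₁.mono l₂
  have u₃ := u₂.mono l₃
  have hsub : ∀ a ∈ M, ∀ b ∈ M, SmallDilate B K₁ (a - b) := fun a ha b hb =>
    hK₁ ▸ (hM a ha).sub (hM b hb) hB hK h₁
  rw [← hK₁, ← hK₂, ← hK₃]
  by_cases hQ : ∀ ξ : ZMod p, ∃ a ∈ M, ∃ b ∈ M, ∃ c ∈ M, ∃ d ∈ M, c ≠ d ∧ ξ = (a - b) / (c - d)
  · left
    intro t
    obtain ⟨a, ha, b, hb, c, hc, d, hd, -, rfl⟩ := hQ t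
    rw [div_eq_mul_inv]
    have h : SmallDilate B K₂ ((a - b) * (c - d)⁻¹) :=
      hK₂ ▸ (hsub a ha b hb).mul (hsub c hc d hd).inv hB o₁ u₁
    exact h.mono (l₃.trans (le_self_pow₀ o₃ (by norm_num)))
  · right
    push Not at hQ
    obtain ⟨ξ, hξ⟩ := hQ
    obtain ⟨a, ha, b, hb, c, hc, d, hd, hcd, hx⟩ := exists_quotient_succ_notMem hξ h2
    have hcd0 : c - d ≠ 0 := sub_ne_zero.2 hcd
    refine ⟨(M ×ˢ M).image fun m => (c - d) * m.1 + (a - b + (c - d)) * m.2, ?_, ?_⟩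
    · rw [card_image_of_injOn, card_product, sq]
      rintro ⟨m, n⟩ hm ⟨m', n'⟩ hm' h
      simp only [coe_product, Set.mem_prod, mem_coe] at hm hm' h
      have hn : n = n' := by
        by_contra hne
        refine hx m' hm'.1 m hm.1 n hm.2 n' hm'.2 hne ?_
        have hne0 : n - n' ≠ 0 := sub_ne_zero.2 hne
        field_simp
        linear_combination h
      subst hn
      have : (c - d) * m = (c - d) * m' := by linear_combination h
      rw [mul_left_cancel₀ hcd0 this]
    · intro t ht
      obtain ⟨⟨m, n⟩, hm, rfl⟩ := mem_image.1 ht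
      obtain ⟨hm, hn⟩ := mem_product.1 hm
      have hy : SmallDilate B K₂ (a - b + (c - d)) :=
        hK₂ ▸ (hsub a ha b hb).add (hsub c hc d hd) hB o₁ u₁
      have hl : SmallDilate B K₃ ((c - d) * m) :=
        hK₃ ▸ ((hsub c hc d hd).mono l₂).mul ((hM m hm).mono (l₁.trans l₂)) hB o₂ u₂
      have hr : SmallDilate B K₃ ((a - b + (c - d)) * n) :=
        hK₃ ▸ hy.mul ((hM n hn).mono (l₁.trans l₂)) hB o₂ u₂
      exact hl.add hr hB o₃ u₃

end Pivot

lemma exists_smallDilate_all (k : ℕ) : ∃ C : ℕ, ∀ (p : ℕ) [Fact p.Prime] (B M : Finset (ZMod p))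
    (K : ℝ), B.Nonempty → 1 ≤ K → SmallDilate B K 1 → (∀ t ∈ M, SmallDilate B K t) → 2 ≤ #M →
      p < #M ^ 2 ^ k → ∀ t, SmallDilate B (K ^ C) t := by
  induction k with
  | zero =>
    refine ⟨0, fun p _ B M K _ _ _ _ _ hp => ?_⟩
    have := card_le_univ M
    rw [ZMod.card] at this
    simp at hp
    omega
  | succ k ih =>
    obtain ⟨C, hC⟩ := ih
    refine ⟨8 * (8 * (8 * (8 * (C + 1)))), fun p _ B M K hB hK h₁ hM h2 hp t => ?_⟩
    simp only [pow_mul K, pow_mul]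
    have hK' : 1 ≤ (((K ^ 8) ^ 8) ^ 8) ^ 8 :=
      one_le_pow₀ (one_le_pow₀ (one_le_pow₀ (one_le_pow₀ hK)))
    have hKK' : K ≤ (((K ^ 8) ^ 8) ^ 8) ^ 8 := by
      simp only [← pow_mul]
      exact le_self_pow₀ hK (by norm_num)
    have key := smallDilate_all_or_square hB hK h₁ hM h2
    revert key hK' hKK'
    generalize (((K ^ 8) ^ 8) ^ 8) ^ 8 = K'
    intro hK' hKK' key
    rcases key with h | ⟨M', hM', h⟩
    · exact (h t).mono (le_self_pow₀ hK' (by omega))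
    · refine (hC p B M' K' hB hK' (h₁.mono hKK') h ?_ ?_ t).mono
        (pow_le_pow_right₀ hK' (by omega))
      · rw [hM']
        nlinarith
      · rwa [hM', ← pow_mul, ← pow_succ']

section Dichotomy

variable {p : ℕ} [Fact p.Prime]

/-- If every dilate of `B` has small difference set with `B`, then `B` is tiny or almost
everything. -/
lemma le_of_smallDilate_all {B : Finset (ZMod p)} {K : ℝ} (hK : 0 < K) (hB : B.Nonempty)
    (h : ∀ t, SmallDilate B K t) : (#B : ℝ) * p ≤ K * (p + #B ^ 2) := by
  have hp0 : (0 : ℝ) < p := by exact_mod_cast (Fact.out : p.Prime).pos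
  have hB0 : (0 : ℝ) < #B := by exact_mod_cast hB.card_pos
  let Q := (B ×ˢ B) ×ˢ (B ×ˢ B)
  let E : ZMod p → ℕ := fun t => #(Q.filter fun x => x.1.1 - t * x.1.2 = x.2.1 - t * x.2.2)
  have hE : ∀ t, (#B : ℝ) ^ 3 ≤ K * E t := by
    intro t
    have hmaps : Set.MapsTo (fun x : ZMod p × ZMod p => x.1 - t * x.2) ↑(B ×ˢ B)
        ↑(B - B.image (t * ·)) := by
      rintro ⟨x, y⟩ hx
      simp only [coe_product, Set.mem_prod, mem_coe] at hx
      exact mem_coe.2 (sub_mem_sub hx.1 (mem_image_of_mem _ hx.2))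
    have hsum := card_eq_sum_card_fiberwise hmaps
    have hEs : E t = ∑ s ∈ B - B.image (t * ·),
        #((B ×ˢ B).filter fun x => x.1 - t * x.2 = s) ^ 2 := by
      have : Set.MapsTo (fun x : (ZMod p × ZMod p) × (ZMod p × ZMod p) => x.1.1 - t * x.1.2)
          ↑(Q.filter fun x => x.1.1 - t * x.1.2 = x.2.1 - t * x.2.2)
          ↑(B - B.image (t * ·)) := by
        rintro x hx
        simp only [mem_coe, mem_filter, Q, mem_product] at hx
        exact mem_coe.2 (sub_mem_sub hx.1.1.1 (mem_image_of_mem _ hx.1.1.2))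
      simp only [E]
      rw [card_eq_sum_card_fiberwise this]
      refine sum_congr rfl fun s _ => ?_
      rw [sq, ← card_product]
      congr 1
      ext x
      simp only [mem_filter, Q, mem_product]
      constructor
      · rintro ⟨⟨⟨h1, h2⟩, h3⟩, rfl⟩
        exact ⟨⟨h1, rfl⟩, h2, h3.symm⟩
      · rintro ⟨⟨h1, h3⟩, h2, h4⟩
        exact ⟨⟨⟨h1, h2⟩, h3.trans h4.symm⟩, h3⟩
    have hcs := sq_sum_le_card_mul_sum_sq (s := B - B.image (t * ·))
      (f := fun s => (#((B ×ˢ B).filter fun x => x.1 - t * x.2 = s) : ℝ))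
    have hsum' : ∑ s ∈ B - B.image (t * ·),
        (#((B ×ˢ B).filter fun x => x.1 - t * x.2 = s) : ℝ) = #B * #B := by
      rw [card_product] at hsum
      exact_mod_cast hsum.symm
    have hEs' : ∑ s ∈ B - B.image (t * ·),
        (#((B ×ˢ B).filter fun x => x.1 - t * x.2 = s) : ℝ) ^ 2 = E t := by
      rw [hEs]; push_cast; rfl
    rw [hsum', hEs'] at hcs
    have h4 : (#B * #B : ℝ) ^ 2 ≤ K * #B * E t :=
      hcs.trans (mul_le_mul_of_nonneg_right (h t) (by positivity))
    refine le_of_mul_le_mul_left (a := (#B : ℝ)) ?_ hB0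
    linarith [h4]
  have hsumE : ∑ t, E t ≤ p * #B ^ 2 + #B ^ 4 := by
    have hpt : ∀ x ∈ Q, #((univ : Finset (ZMod p)).filter
        fun t => x.1.1 - t * x.1.2 = x.2.1 - t * x.2.2) ≤ (if x.1 = x.2 then p else 0) + 1 := by
      intro x hx
      split_ifs with hxe
      · exact (card_le_univ _).trans (by rw [ZMod.card]; omega)
      · rw [zero_add, card_le_one]
        intro s hs t ht
        simp only [mem_filter, mem_univ, true_and] at hs ht
        by_contra hst
        have h2 : (s - t) * (x.1.2 - x.2.2) = 0 := by linear_combination ht - hs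
        have h3 := (mul_eq_zero.1 h2).resolve_left (sub_ne_zero.2 hst)
        refine hxe (Prod.ext ?_ (sub_eq_zero.1 h3))
        linear_combination hs + s * h3
    have hswap : ∑ t, E t = ∑ x ∈ Q, #((univ : Finset (ZMod p)).filter
        fun t => x.1.1 - t * x.1.2 = x.2.1 - t * x.2.2) := by
      simp only [E, card_filter]
      exact sum_comm
    rw [hswap]
    refine (sum_le_sum hpt).trans (le_of_eq ?_)
    rw [sum_add_distrib, ← sum_filter, sum_const, sum_const]
    have hdiag : #(Q.filter fun x => x.1 = x.2) = #B ^ 2 := by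
      rw [show Q.filter (fun x => x.1 = x.2) = (B ×ˢ B).diag from ?_, diag_card, card_product, sq]
      ext x
      simp only [Q, mem_filter, mem_product, mem_diag]
      constructor
      · rintro ⟨⟨h1, -⟩, h3⟩
        exact ⟨h1, h3⟩
      · rintro ⟨h1, h3⟩
        exact ⟨⟨h1, h3 ▸ h1⟩, h3⟩
    rw [hdiag]
    simp only [Q, card_product, smul_eq_mul]
    ring
  have hlow : (p : ℝ) * #B ^ 3 ≤ K * ∑ t, (E t : ℝ) := by
    rw [mul_sum]
    calc (p : ℝ) * #B ^ 3 = ∑ _t : ZMod p, (#B : ℝ) ^ 3 := by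
          rw [sum_const, card_univ, ZMod.card, nsmul_eq_mul]
      _ ≤ _ := sum_le_sum fun t _ => hE t
  have hup : ∑ t, (E t : ℝ) ≤ p * #B ^ 2 + #B ^ 4 := by exact_mod_cast hsumE
  have hfin : (p : ℝ) * #B ^ 3 ≤ K * (p * #B ^ 2 + #B ^ 4) :=
    hlow.trans (mul_le_mul_of_nonneg_left hup hK.le)
  refine le_of_mul_le_mul_left (a := (#B : ℝ) ^ 2) ?_ (by positivity)
  linarith

end Dichotomy

section Paths

variable {α : Type*} [DecidableEq α]

/-- A dense bipartite graph has a large set of vertices all of whose pairs share a neighbourhood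
in which almost all pairs of vertices have many common neighbours. -/
lemma exists_dense_neighbourhood {X : Finset α} {G : Finset (α × α)} (hG : G ⊆ X ×ˢ X) {δ η : ℝ}
    (hδ : 0 < δ) (hη : 0 < η) (hX : X.Nonempty) (hd : δ * (#X : ℝ) ^ 2 ≤ #G) :
    ∃ A ⊆ X, δ / 4 * #X ≤ (#A : ℝ) ∧
      (∀ a ∈ A, δ / 2 * #X ≤ (#(X.filter fun b => (a, b) ∈ G) : ℝ)) ∧
      (#((A ×ˢ A).filter fun x =>
        (#(X.filter fun b => (x.1, b) ∈ G ∧ (x.2, b) ∈ G) : ℝ) < η * δ ^ 2 / 8 * #X) : ℝ)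
          ≤ η * (#A : ℝ) ^ 2 := by
  have hD : (0 : ℝ) < #X := by exact_mod_cast hX.card_pos
  set D : ℝ := (#X : ℝ) with hDdef
  let deg : α → ℝ := fun a => #(X.filter fun b => (a, b) ∈ G)
  let cod : α × α → ℝ := fun x => #(X.filter fun b => (x.1, b) ∈ G ∧ (x.2, b) ∈ G)
  let A₁ := X.filter fun a => δ / 2 * D ≤ deg a
  let N : α → Finset α := fun b => A₁.filter fun a => (a, b) ∈ G
  let bad : α → ℝ := fun b => #((N b ×ˢ N b).filter fun x => cod x < η * δ ^ 2 / 8 * D)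
  have hdeg : ∑ a ∈ X, deg a = #G := by
    have hmaps : Set.MapsTo Prod.fst (G : Set (α × α)) (X : Set α) := fun x hx =>
      mem_coe.2 (mem_product.1 (hG hx)).1
    rw [card_eq_sum_card_fiberwise hmaps]
    push_cast
    refine sum_congr rfl fun a _ => ?_
    simp only [deg]
    congr 1
    refine card_bij (fun b _ => (a, b)) ?_ ?_ ?_
    · intro b hb
      exact mem_filter.2 ⟨(mem_filter.1 hb).2, rfl⟩
    · intro b _ b' _ h
      exact (Prod.mk.inj h).2
    · rintro ⟨a', b⟩ hx
      obtain ⟨h1, rfl⟩ := mem_filter.1 hx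
      exact ⟨b, mem_filter.2 ⟨(mem_product.1 (hG h1)).2, h1⟩, rfl⟩
  have hA₁ : δ / 2 * D ^ 2 ≤ ∑ a ∈ A₁, deg a := by
    have hsplit := sum_filter_add_sum_filter_not X (fun a => δ / 2 * D ≤ deg a) deg
    have hsmall : ∑ a ∈ X with ¬ δ / 2 * D ≤ deg a, deg a ≤ D * (δ / 2 * D) := by
      calc ∑ a ∈ X with ¬ δ / 2 * D ≤ deg a, deg a
          ≤ ∑ a ∈ X with ¬ δ / 2 * D ≤ deg a, δ / 2 * D :=
            sum_le_sum fun a ha => (not_le.1 (mem_filter.1 ha).2).le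
        _ = #(X.filter fun a => ¬ δ / 2 * D ≤ deg a) * (δ / 2 * D) := by
            rw [sum_const, nsmul_eq_mul]
        _ ≤ D * (δ / 2 * D) := by
            gcongr
            exact Nat.cast_le.2 (card_filter_le X _)
    have : ∑ a ∈ A₁, deg a = ∑ a ∈ X with δ / 2 * D ≤ deg a, deg a := rfl
    nlinarith
  have hN : ∑ b ∈ X, (#(N b) : ℝ) = ∑ a ∈ A₁, deg a := by
    simp only [N, deg, card_filter]
    push_cast
    exact sum_comm
  have hN2 : δ ^ 2 / 4 * D ^ 3 ≤ ∑ b ∈ X, (#(N b) : ℝ) ^ 2 := by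
    have h := sq_sum_le_card_mul_sum_sq (s := X) (f := fun b => (#(N b) : ℝ))
    rw [hN] at h
    have h' : (δ / 2 * D ^ 2) ^ 2 ≤ D * ∑ b ∈ X, (#(N b) : ℝ) ^ 2 :=
      (pow_le_pow_left₀ (by positivity) hA₁ 2).trans h
    refine le_of_mul_le_mul_left (a := D) ?_ hD
    linarith
  have hbad : ∑ b ∈ X, bad b ≤ η * (δ ^ 2 / 8 * D ^ 3) := by
    have hswap : ∑ b ∈ X, bad b
        = ∑ x ∈ (A₁ ×ˢ A₁).filter (fun x => cod x < η * δ ^ 2 / 8 * D), cod x := by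
      have h1 : ∀ b ∈ X, bad b =
          ∑ x ∈ (A₁ ×ˢ A₁).filter (fun x => cod x < η * δ ^ 2 / 8 * D),
            if (x.1, b) ∈ G ∧ (x.2, b) ∈ G then (1 : ℝ) else 0 := by
        intro b _
        rw [← sum_filter, sum_const, nsmul_eq_mul, mul_one]
        simp only [bad]
        congr 2
        ext x
        simp only [N, mem_filter, mem_product]
        tauto
      rw [sum_congr rfl h1, sum_comm]
      refine sum_congr rfl fun x _ => ?_
      rw [← sum_filter, sum_const, nsmul_eq_mul, mul_one]
    rw [hswap]
    have hcard : (#((A₁ ×ˢ A₁).filter fun x => cod x < η * δ ^ 2 / 8 * D) : ℝ) ≤ D * D := by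
      have h : #((A₁ ×ˢ A₁).filter fun x => cod x < η * δ ^ 2 / 8 * D) ≤ #X * #X := by
        refine (card_filter_le _ _).trans ?_
        rw [card_product]
        exact Nat.mul_le_mul (card_filter_le _ _) (card_filter_le _ _)
      calc _ ≤ ((#X * #X : ℕ) : ℝ) := Nat.cast_le.2 h
        _ = D * D := by push_cast; rfl
    calc _ ≤ ∑ x ∈ (A₁ ×ˢ A₁).filter (fun x => cod x < η * δ ^ 2 / 8 * D), η * δ ^ 2 / 8 * D :=
          sum_le_sum fun x hx => (mem_filter.1 hx).2.le
      _ = #((A₁ ×ˢ A₁).filter fun x => cod x < η * δ ^ 2 / 8 * D) * (η * δ ^ 2 / 8 * D) := by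
          rw [sum_const, nsmul_eq_mul]
      _ ≤ D * D * (η * δ ^ 2 / 8 * D) := by gcongr
      _ = _ := by ring
  obtain ⟨b, -, hb⟩ : ∃ b ∈ X, δ ^ 2 / 8 * D ^ 2 ≤ (#(N b) : ℝ) ^ 2 - bad b / η := by
    refine exists_le_of_sum_le hX ?_
    rw [sum_const, nsmul_eq_mul, sum_sub_distrib, ← sum_div]
    have : (∑ b ∈ X, bad b) / η ≤ δ ^ 2 / 8 * D ^ 3 := by
      rw [div_le_iff₀ hη]
      linarith
    change D * _ ≤ _
    linarith
  have hbad0 : 0 ≤ bad b / η := div_nonneg (Nat.cast_nonneg _) hη.le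
  refine ⟨N b, (filter_subset _ _).trans (filter_subset _ _), ?_, ?_, ?_⟩
  · refine le_of_sq_le_sq ?_ (Nat.cast_nonneg _)
    have : 0 ≤ δ ^ 2 * D ^ 2 := by positivity
    linarith
  · intro a ha
    exact (mem_filter.1 (mem_filter.1 ha).1).2
  · have h : bad b / η ≤ (#(N b) : ℝ) ^ 2 := by
      have : 0 ≤ δ ^ 2 / 8 * D ^ 2 := by positivity
      linarith
    rw [div_le_iff₀ hη, mul_comm ((#(N b) : ℝ) ^ 2)] at h
    exact h

/-- A dense bipartite graph has a large set of vertices any two of which are joined by many paths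
of length four. -/
lemma exists_many_paths {X : Finset α} {G : Finset (α × α)} (hG : G ⊆ X ×ˢ X) {δ : ℝ}
    (hδ : 0 < δ) (hX : X.Nonempty) (hd : δ * (#X : ℝ) ^ 2 ≤ #G) :
    ∃ Y ⊆ X, δ / 4 * #X ≤ (#Y : ℝ) ∧ ∀ b ∈ Y, ∀ b' ∈ Y,
      δ ^ 8 / 2 ^ 17 * (#X : ℝ) ^ 3 ≤ (#(((X ×ˢ X) ×ˢ X).filter fun x =>
        ((x.1.1, b) ∈ G ∧ (x.1.2, b') ∈ G) ∧ (x.1.1, x.2) ∈ G ∧ (x.1.2, x.2) ∈ G) : ℝ) := by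
  have hD : (0 : ℝ) < #X := by exact_mod_cast hX.card_pos
  obtain ⟨A, hAX, hA, hAdeg, hAbad⟩ :=
    exists_dense_neighbourhood hG hδ (η := δ ^ 2 / 32) (by positivity) hX hd
  set D : ℝ := (#X : ℝ) with hDdef
  have hA0 : (0 : ℝ) < #A := lt_of_lt_of_le (by positivity) hA
  let nb : α → Finset α := fun b => A.filter fun a => (a, b) ∈ G
  refine ⟨X.filter fun b => δ / 4 * #A ≤ (#(nb b) : ℝ), filter_subset _ _, ?_, ?_⟩
  · have hsum : ∑ b ∈ X, (#(nb b) : ℝ) = ∑ a ∈ A, (#(X.filter fun b => (a, b) ∈ G) : ℝ) := by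
      simp only [nb, card_filter]
      push_cast
      exact sum_comm
    have hlow : #A * (δ / 2 * D) ≤ ∑ b ∈ X, (#(nb b) : ℝ) := by
      rw [hsum, ← nsmul_eq_mul, ← sum_const]
      exact sum_le_sum hAdeg
    have hsplit := sum_filter_add_sum_filter_not X (fun b => δ / 4 * #A ≤ (#(nb b) : ℝ))
      (fun b => (#(nb b) : ℝ))
    have hsmall : ∑ b ∈ X with ¬ δ / 4 * #A ≤ (#(nb b) : ℝ), (#(nb b) : ℝ)
        ≤ D * (δ / 4 * #A) := by
      calc _ ≤ ∑ b ∈ X with ¬ δ / 4 * #A ≤ (#(nb b) : ℝ), δ / 4 * #A :=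
            sum_le_sum fun a ha => (not_le.1 (mem_filter.1 ha).2).le
        _ = #(X.filter fun b => ¬ δ / 4 * #A ≤ (#(nb b) : ℝ)) * (δ / 4 * #A) := by
            rw [sum_const, nsmul_eq_mul]
        _ ≤ _ := by
            gcongr
            exact Nat.cast_le.2 (card_filter_le X _)
    have hbig : ∑ b ∈ X with δ / 4 * #A ≤ (#(nb b) : ℝ), (#(nb b) : ℝ)
        ≤ #(X.filter fun b => δ / 4 * #A ≤ (#(nb b) : ℝ)) * #A := by
      rw [← nsmul_eq_mul, ← sum_const]
      refine sum_le_sum fun b _ => ?_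
      exact_mod_cast card_filter_le _ _
    refine le_of_mul_le_mul_right (a := (#A : ℝ)) ?_ hA0
    linarith
  · intro b hb b' hb'
    replace hb := (mem_filter.1 hb).2
    replace hb' := (mem_filter.1 hb').2
    let cod : α × α → ℝ := fun x => #(X.filter fun b => (x.1, b) ∈ G ∧ (x.2, b) ∈ G)
    let τ : ℝ := δ ^ 2 / 32 * δ ^ 2 / 8
    let good := (nb b ×ˢ nb b').filter fun x => ¬ cod x < τ * D
    have hgood : δ ^ 2 / 32 * (#A : ℝ) ^ 2 ≤ #good := by
      have hs : #((nb b ×ˢ nb b').filter fun x => cod x < τ * D) + #good = #(nb b) * #(nb b') := by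
        rw [card_filter_add_card_filter_not, card_product]
      have hs' : (#((nb b ×ˢ nb b').filter fun x => cod x < τ * D) : ℝ) + #good
          = #(nb b) * #(nb b') := by exact_mod_cast hs
      have hle : (#((nb b ×ˢ nb b').filter fun x => cod x < τ * D) : ℝ)
          ≤ δ ^ 2 / 32 * (#A : ℝ) ^ 2 := by
        refine le_trans ?_ hAbad
        have : (nb b ×ˢ nb b').filter (fun x => cod x < τ * D) ⊆
            (A ×ˢ A).filter (fun x => cod x < τ * D) :=
          filter_subset_filter _ (product_subset_product (filter_subset _ _) (filter_subset _ _))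
        exact_mod_cast card_le_card this
      have hprod : (δ / 4 * #A) * (δ / 4 * #A) ≤ (#(nb b) : ℝ) * #(nb b') := by gcongr
      linarith
    have hpaths : ∑ x ∈ good, cod x ≤ (#(((X ×ˢ X) ×ˢ X).filter fun x =>
        ((x.1.1, b) ∈ G ∧ (x.1.2, b') ∈ G) ∧ (x.1.1, x.2) ∈ G ∧ (x.1.2, x.2) ∈ G) : ℝ) := by
      have h : #(good.sigma fun x => X.filter fun b => (x.1, b) ∈ G ∧ (x.2, b) ∈ G) ≤
          #(((X ×ˢ X) ×ˢ X).filter fun x =>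
            ((x.1.1, b) ∈ G ∧ (x.1.2, b') ∈ G) ∧ (x.1.1, x.2) ∈ G ∧ (x.1.2, x.2) ∈ G) := by
        refine card_le_card_of_injOn (fun x => (x.1, x.2)) ?_ ?_
        · rintro ⟨⟨a, a'⟩, c⟩ hx
          simp only [coe_sigma, Set.mem_sigma_iff, mem_coe, good, nb, mem_filter,
            mem_product] at hx ⊢
          exact ⟨⟨⟨hAX hx.1.1.1.1, hAX hx.1.1.2.1⟩, hx.2.1⟩, ⟨hx.1.1.1.2, hx.1.1.2.2⟩, hx.2.2⟩
        · rintro ⟨x, c⟩ _ ⟨x', c'⟩ _ h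
          simp only [Prod.mk.injEq] at h
          obtain ⟨rfl, rfl⟩ := h
          rfl
      rw [card_sigma] at h
      calc ∑ x ∈ good, cod x
          = ((∑ x ∈ good, #(X.filter fun b => (x.1, b) ∈ G ∧ (x.2, b) ∈ G) : ℕ) : ℝ) := by
            push_cast; rfl
        _ ≤ _ := Nat.cast_le.2 h
    refine le_trans ?_ hpaths
    calc δ ^ 8 / 2 ^ 17 * D ^ 3 = δ ^ 2 / 32 * (δ / 4 * D) ^ 2 * (τ * D) := by
          simp only [τ]; ring
      _ ≤ δ ^ 2 / 32 * (#A : ℝ) ^ 2 * (τ * D) := by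
          gcongr
      _ ≤ #good * (τ * D) := by gcongr
      _ = ∑ x ∈ good, τ * D := by rw [sum_const, nsmul_eq_mul]
      _ ≤ ∑ x ∈ good, cod x := sum_le_sum fun x hx => not_lt.1 (mem_filter.1 hx).2

end Paths

section PartialSums

/-- A dense subset of a grid all of whose partial sumsets `{a + λ b}` are small contains a large
set whose dilates by quotients of such `λ` have small difference sets with it. -/
lemma exists_smallDilate_of_partialSums {F : Type*} [Field F] [DecidableEq F] {X : Finset F}
    {G : Finset (F × F)} (hG : G ⊆ X ×ˢ X) {δ : ℝ} (hδ : 0 < δ) (hX : X.Nonempty)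
    (hd : δ * (#X : ℝ) ^ 2 ≤ #G) {L : Finset F} (hL0 : ∀ l ∈ L, l ≠ 0)
    (hL : ∀ l ∈ L, #(G.image fun x => x.1 + l * x.2) ≤ #X) :
    ∃ Y ⊆ X, δ / 4 * #X ≤ (#Y : ℝ) ∧
      ∀ l ∈ L, ∀ l' ∈ L, SmallDilate Y (2 ^ 19 / δ ^ 9) (l' / l) := by
  have hD : (0 : ℝ) < #X := by exact_mod_cast hX.card_pos
  obtain ⟨Y, hYX, hY, hpaths⟩ := exists_many_paths hG hδ hX hd
  refine ⟨Y, hYX, hY, fun l hl l' hl' => ?_⟩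
  have hl0 := hL0 l hl
  let T : F → F → Finset ((F × F) × F) := fun b b' => ((X ×ˢ X) ×ˢ X).filter fun x =>
    ((x.1.1, b) ∈ G ∧ (x.1.2, b') ∈ G) ∧ (x.1.1, x.2) ∈ G ∧ (x.1.2, x.2) ∈ G
  let S : F → Finset F := fun l => G.image fun x => x.1 + l * x.2
  let W := Y - Y.image (l' / l * ·)
  have hrep : ∀ w : F, ∃ b b' : F, w ∈ W → b ∈ Y ∧ b' ∈ Y ∧ l * w = l * b - l' * b' := by
    intro w
    by_cases hw : w ∈ W
    · obtain ⟨b, hb, y, hy, rfl⟩ := mem_sub.1 hw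
      obtain ⟨b', hb', rfl⟩ := mem_image.1 hy
      exact ⟨b, b', fun _ => ⟨hb, hb', by field_simp⟩⟩
    · exact ⟨0, 0, fun h => absurd h hw⟩
  choose β β' hβ using hrep
  have hcount : #(W.sigma fun w => T (β w) (β' w)) ≤ #((S l ×ˢ S l) ×ˢ (S l ×ˢ S l')) := by
    refine card_le_card_of_injOn
      (fun x => ((x.2.1.1 + l * β x.1, x.2.1.1 + l * x.2.2),
        (x.2.1.2 + l * x.2.2, x.2.1.2 + l' * β' x.1))) ?_ ?_
    · rintro ⟨w, ⟨a, a'⟩, c⟩ hx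
      simp only [coe_sigma, Set.mem_sigma_iff, mem_coe, T, mem_filter] at hx
      obtain ⟨-, -, ⟨h1, h2⟩, h3, h4⟩ := hx
      simp only [coe_product, Set.mem_prod, mem_coe, S]
      exact ⟨⟨mem_image.2 ⟨_, h1, rfl⟩, mem_image.2 ⟨_, h3, rfl⟩⟩,
        mem_image.2 ⟨_, h4, rfl⟩, mem_image.2 ⟨_, h2, rfl⟩⟩
    · rintro ⟨w, ⟨a, a'⟩, c⟩ hx ⟨v, ⟨e, e'⟩, f⟩ hy h
      simp only [coe_sigma, Set.mem_sigma_iff, mem_coe] at hx hy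
      simp only [Prod.mk.injEq] at h
      obtain ⟨⟨h1, h2⟩, h3, h4⟩ := h
      have hw := (hβ w hx.1).2.2
      have hv := (hβ v hy.1).2.2
      have hwv : w = v := mul_left_cancel₀ hl0 (by linear_combination hw - hv + h1 - h2 + h3 - h4)
      subst hwv
      have hae : a = e := by linear_combination h1
      subst hae
      have hcf : c = f := mul_left_cancel₀ hl0 (by linear_combination h2)
      subst hcf
      have : a' = e' := by linear_combination h3
      rw [this]
  rw [card_sigma, card_product, card_product, card_product] at hcount
  have hup : ∑ w ∈ W, (#(T (β w) (β' w)) : ℝ) ≤ (#X : ℝ) ^ 4 := by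
    have : ∑ w ∈ W, #(T (β w) (β' w)) ≤ #X ^ 4 := by
      calc _ ≤ _ := hcount
        _ ≤ (#X * #X) * (#X * #X) := by
            have h1 := hL l hl
            have h2 := hL l' hl'
            exact Nat.mul_le_mul (Nat.mul_le_mul h1 h1) (Nat.mul_le_mul h1 h2)
        _ = #X ^ 4 := by ring
    exact_mod_cast this
  have hlow : (#W : ℝ) * (δ ^ 8 / 2 ^ 17 * (#X : ℝ) ^ 3) ≤ ∑ w ∈ W, (#(T (β w) (β' w)) : ℝ) := by
    rw [← nsmul_eq_mul, ← sum_const]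
    exact sum_le_sum fun w hw => hpaths _ (hβ w hw).1 _ (hβ w hw).2.1
  have hW : (#W : ℝ) * (δ ^ 8 / 2 ^ 17) ≤ #X := by
    refine le_of_mul_le_mul_right (a := (#X : ℝ) ^ 3) ?_ (by positivity)
    linarith
  change (#W : ℝ) ≤ _
  rw [div_mul_eq_mul_div, le_div_iff₀ (by positivity)]
  calc (#W : ℝ) * δ ^ 9 = (#W : ℝ) * (δ ^ 8 / 2 ^ 17) * (2 ^ 17 * δ) := by ring
    _ ≤ #X * (2 ^ 17 * δ) := by gcongr
    _ = 2 ^ 19 * (δ / 4 * #X) := by ring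
    _ ≤ 2 ^ 19 * #Y := by gcongr

/-- A dense subset of a grid over a prime field cannot have many small partial sumsets
`{a + λ b}`, unless the sides of the grid are tiny or almost everything. -/
lemma exists_bound_of_partialSums (k : ℕ) : ∃ C : ℕ, ∀ (p : ℕ) [Fact p.Prime] (X : Finset (ZMod p))
    (G : Finset (ZMod p × ZMod p)) (δ : ℝ) (L : Finset (ZMod p)), G ⊆ X ×ˢ X → 0 < δ →
      X.Nonempty → δ * (#X : ℝ) ^ 2 ≤ #G → (∀ l ∈ L, l ≠ 0) →
      (∀ l ∈ L, #(G.image fun x => x.1 + l * x.2) ≤ #X) → 2 ≤ #L → p < #L ^ 2 ^ k →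
        δ / 4 * #X * p ≤ (2 ^ 19 / δ ^ 9) ^ C * (p + (#X : ℝ) ^ 2) := by
  obtain ⟨C, hC⟩ := exists_smallDilate_all k
  refine ⟨C, fun p _ X G δ L hG hδ hX hd hL0 hL h2 hp => ?_⟩
  have hD : (0 : ℝ) < #X := by exact_mod_cast hX.card_pos
  have hδ1 : δ ≤ 1 := by
    have h : #G ≤ #X * #X := by
      rw [← card_product]
      exact card_le_card hG
    have h' : (#G : ℝ) ≤ #X * #X := by exact_mod_cast h
    refine le_of_mul_le_mul_right (a := (#X : ℝ) ^ 2) ?_ (by positivity)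
    linarith
  obtain ⟨Y, hYX, hY, hYL⟩ := exists_smallDilate_of_partialSums hG hδ hX hd hL0 hL
  have hK : (1 : ℝ) ≤ 2 ^ 19 / δ ^ 9 := by
    rw [le_div_iff₀ (by positivity), one_mul]
    exact (pow_le_one₀ hδ.le hδ1).trans (by norm_num)
  have hY0 : Y.Nonempty := by
    rw [← card_pos]
    have : (0 : ℝ) < #Y := lt_of_lt_of_le (by positivity) hY
    exact_mod_cast this
  obtain ⟨l, hl⟩ := card_pos.1 (by omega : 0 < #L)
  have hl0 := hL0 l hl
  have hcard : #(L.image (· / l)) = #L :=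
    card_image_of_injective _ fun x y h => by
      simpa [div_left_inj' hl0] using h
  have h1 : SmallDilate Y (2 ^ 19 / δ ^ 9) 1 := by
    have := hYL l hl l hl
    rwa [div_self hl0] at this
  have hall := hC p Y (L.image (· / l)) _ hY0 hK h1
    (fun t ht => by
      obtain ⟨l', hl', rfl⟩ := mem_image.1 ht
      exact hYL l hl l' hl')
    (by rwa [hcard]) (by rwa [hcard])
  have hfin := le_of_smallDilate_all (by positivity) hY0 hall
  have hYX' : (#Y : ℝ) ≤ #X := by exact_mod_cast card_le_card hYX
  calc δ / 4 * #X * p ≤ #Y * p := by gcongr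
    _ ≤ _ := hfin
    _ ≤ _ := by gcongr

end PartialSums

/-- The quadratic distance between two points of the plane over `F`. -/
def quadDist {F : Type*} [Field F] (x y : F × F) : F := (x.1 - y.1) ^ 2 + (x.2 - y.2) ^ 2

lemma quadDist_ne_zero {F : Type*} [Field F]
    (hsq : ∀ x y : F, x ^ 2 + y ^ 2 = 0 → x = 0 ∧ y = 0) {a b : F × F} (hab : a ≠ b) : quadDist b a ≠ 0 := by
  intro h
  obtain ⟨h1, h2⟩ := hsq _ _ h
  exact hab (Prod.ext (sub_eq_zero.1 h1).symm (sub_eq_zero.1 h2).symm)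

section Distances

variable {F : Type*} [Field F] [DecidableEq F]

/-- The set of quadratic distances between points of `P`. -/
def distSet (P : Finset (F × F)) : Finset F := (P ×ˢ P).image fun x => quadDist x.1 x.2

lemma quadDist_mem_distSet {P : Finset (F × F)} {x y : F × F} (hx : x ∈ P) (hy : y ∈ P) :
    quadDist x y ∈ distSet P :=
  mem_image.2 ⟨(x, y), mem_product.2 ⟨hx, hy⟩, rfl⟩

/-- Few distances force a rich perpendicular bisector. -/
lemma exists_rich_bisector {P : Finset (F × F)} (hP : 2 ≤ #P) :
    ∃ q ∈ P, ∃ r ∈ P, q ≠ r ∧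
      #P ≤ #(distSet P) * (#(P.filter fun z => quadDist z q = quadDist z r) + 1) := by
  by_contra! hcon
  set D := #(distSet P) with hD
  have htri : ∀ z ∈ P, #P ^ 2 ≤ D * #((P ×ˢ P).filter fun x => quadDist z x.1 = quadDist z x.2) := by
    intro z hz
    have hmaps : Set.MapsTo (quadDist z) (P : Set (F × F)) (distSet P : Set F) :=
      fun x hx => quadDist_mem_distSet hz hx
    have hmaps2 : Set.MapsTo (fun x : (F × F) × (F × F) => quadDist z x.1)
        ((P ×ˢ P).filter fun x => quadDist z x.1 = quadDist z x.2 : Finset _) (distSet P : Set F) := by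
      intro x hx
      exact quadDist_mem_distSet hz (mem_product.1 (mem_filter.1 (mem_coe.1 hx)).1).1
    rw [card_eq_sum_card_fiberwise hmaps, card_eq_sum_card_fiberwise hmaps2]
    refine sq_sum_le_card_mul_sum_sq.trans (le_of_eq ?_)
    congr 1
    refine sum_congr rfl fun s _ => ?_
    rw [sq, ← card_product]
    congr 1
    ext x
    simp only [mem_filter, mem_product]
    constructor
    · rintro ⟨⟨h1, rfl⟩, h2, h3⟩
      exact ⟨⟨⟨h1, h2⟩, h3.symm⟩, rfl⟩
    · rintro ⟨⟨⟨h1, h2⟩, h3⟩, rfl⟩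
      exact ⟨⟨h1, rfl⟩, h2, h3.symm⟩
  obtain ⟨q, hq, r, hr, hqr⟩ := one_lt_card.1 hP
  have hDN : D < #P := lt_of_le_of_lt (Nat.le_mul_of_pos_right D (Nat.succ_pos _))
    (hcon q hq r hr hqr)
  have hsum : #P * #P ^ 2 ≤
      ∑ x ∈ P ×ˢ P, D * #(P.filter fun z => quadDist z x.1 = quadDist z x.2) := by
    calc #P * #P ^ 2 = ∑ z ∈ P, #P ^ 2 := by rw [sum_const, smul_eq_mul]
      _ ≤ ∑ z ∈ P, D * #((P ×ˢ P).filter fun x => quadDist z x.1 = quadDist z x.2) :=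
          sum_le_sum htri
      _ = _ := by
          simp only [← mul_sum, card_filter]
          rw [sum_comm]
  have hterm : ∀ x ∈ P ×ˢ P,
      ((D * #(P.filter fun z => quadDist z x.1 = quadDist z x.2) : ℕ) : ℤ) ≤
        (if x.1 = x.2 then (D * #P - (#P - D) : ℤ) else 0) + (#P - D) := by
    intro x hx
    obtain ⟨hx1, hx2⟩ := mem_product.1 hx
    split_ifs with h
    · have : D * #(P.filter fun z => quadDist z x.1 = quadDist z x.2) ≤ D * #P :=
        Nat.mul_le_mul_left _ (card_filter_le _ _)
      have : ((D * #(P.filter fun z => quadDist z x.1 = quadDist z x.2) : ℕ) : ℤ) ≤ D * #P := by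
        exact_mod_cast this
      linarith
    · have := hcon x.1 hx1 x.2 hx2 h
      rw [mul_add, mul_one] at this
      have : ((D * #(P.filter fun z => quadDist z x.1 = quadDist z x.2) : ℕ) : ℤ) + D < #P := by
        exact_mod_cast this
      linarith
  have htot := sum_le_sum hterm
  rw [sum_add_distrib, ← sum_filter, sum_const, sum_const] at htot
  have hdiag : #((P ×ˢ P).filter fun x => x.1 = x.2) = #P := by
    rw [← diag_card P]
    congr 1
    ext x
    simp only [mem_filter, mem_product, mem_diag]
    constructor
    · rintro ⟨⟨h1, -⟩, h3⟩
      exact ⟨h1, h3⟩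
    · rintro ⟨h1, h3⟩
      exact ⟨⟨h1, h3 ▸ h1⟩, h3⟩
  rw [hdiag, card_product, nsmul_eq_mul, nsmul_eq_mul] at htot
  have hsum' : (#P : ℤ) * #P ^ 2 ≤
      ∑ x ∈ P ×ˢ P, ((D * #(P.filter fun z => quadDist z x.1 = quadDist z x.2) : ℕ) : ℤ) := by
    exact_mod_cast hsum
  have hDN' : (D : ℤ) < #P := by exact_mod_cast hDN
  push_cast at htot hsum'
  nlinarith

/-- The distances to two given points determine a point up to a reflection. -/
lemma card_le_two_mul_card_image_quadDist (hsq : ∀ x y : F, x ^ 2 + y ^ 2 = 0 → x = 0 ∧ y = 0)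
    (P : Finset (F × F)) {a b : F × F} (hab : a ≠ b) :
    #P ≤ 2 * #(P.image fun z => (quadDist z a, quadDist z b)) := by
  have h2 : (2 : F) ≠ 0 := fun h => one_ne_zero (hsq 1 1 (by linear_combination h)).1
  have he := quadDist_ne_zero hsq hab
  refine card_le_mul_card_image P 2 fun y hy => ?_
  obtain ⟨w, hw, rfl⟩ := mem_image.1 hy
  let σ : F × F → F := fun z => (z.1 - a.1) * (b.2 - a.2) - (z.2 - a.2) * (b.1 - a.1)
  let ρ : F × F → F := fun z => (z.1 - a.1) * (b.1 - a.1) + (z.2 - a.2) * (b.2 - a.2)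
  have hρ : ∀ z, quadDist z a = quadDist w a → quadDist z b = quadDist w b → ρ z = ρ w := by
    intro z h h'
    simp only [quadDist] at h h'
    refine mul_left_cancel₀ h2 ?_
    simp only [ρ]
    linear_combination h - h'
  refine le_trans (card_le_card_of_injOn σ (t := {σ w, -σ w}) ?_ ?_) card_le_two
  · intro z hz
    obtain ⟨-, h⟩ := mem_filter.1 (mem_coe.1 hz)
    obtain ⟨h, h'⟩ := Prod.mk.inj h
    have e := hρ z h h'
    simp only [coe_insert, coe_singleton, Set.mem_insert_iff, Set.mem_singleton_iff]
    refine sq_eq_sq_iff_eq_or_eq_neg.1 ?_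
    simp only [quadDist, σ, ρ] at h e ⊢
    linear_combination ((b.1 - a.1) ^ 2 + (b.2 - a.2) ^ 2) * h -
      ((z.1 - a.1) * (b.1 - a.1) + (z.2 - a.2) * (b.2 - a.2) +
        ((w.1 - a.1) * (b.1 - a.1) + (w.2 - a.2) * (b.2 - a.2))) * e
  · intro z hz v hv h
    obtain ⟨-, hz⟩ := mem_filter.1 (mem_coe.1 hz)
    obtain ⟨-, hv⟩ := mem_filter.1 (mem_coe.1 hv)
    obtain ⟨hz, hz'⟩ := Prod.mk.inj hz
    obtain ⟨hv, hv'⟩ := Prod.mk.inj hv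
    have e := (hρ z hz hz').trans (hρ v hv hv').symm
    simp only [quadDist, σ, ρ] at he h e
    refine Prod.ext (mul_left_cancel₀ he ?_) (mul_left_cancel₀ he ?_)
    · linear_combination (b.1 - a.1) * e + (b.2 - a.2) * h
    · linear_combination (b.2 - a.2) * e - (b.1 - a.1) * h

/-- A set with few distances yields a dense subset of a grid with many small partial sumsets. -/
lemma exists_partialSums (hsq : ∀ x y : F, x ^ 2 + y ^ 2 = 0 → x = 0 ∧ y = 0)
    {P : Finset (F × F)} (hP : 2 * #(distSet P) < #P) :
    ∃ G ⊆ distSet P ×ˢ distSet P, ∃ L : Finset F, #P ≤ 2 * #G ∧ (∀ l ∈ L, l ≠ 0) ∧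
      (∀ l ∈ L, #(G.image fun x => x.1 + l * x.2) ≤ #(distSet P)) ∧
      #P ≤ #(distSet P) * (#L + 3) := by
  have hP0 : P.Nonempty := card_pos.1 (by omega)
  have hD : 0 < #(distSet P) := by
    obtain ⟨x, hx⟩ := hP0
    exact card_pos.2 ⟨_, quadDist_mem_distSet hx hx⟩
  obtain ⟨q, -, r, -, hqr, hrich⟩ := exists_rich_bisector (P := P) (by omega)
  set S := P.filter fun z => quadDist z q = quadDist z r with hS
  have hS2 : 1 < #S := by
    by_contra! h
    have : #(distSet P) * (#S + 1) ≤ #(distSet P) * 2 := Nat.mul_le_mul_left _ (by omega)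
    omega
  have h2 : (2 : F) ≠ 0 := fun h => one_ne_zero (hsq 1 1 (by linear_combination h)).1
  obtain ⟨a, ha, b, hb, hab⟩ := one_lt_card.1 hS2
  have he := quadDist_ne_zero hsq hab
  obtain ⟨haP, ha⟩ := mem_filter.1 ha
  obtain ⟨hbP, hb⟩ := mem_filter.1 hb
  let τ : F × F → F := fun z =>
    ((z.1 - a.1) * (b.1 - a.1) + (z.2 - a.2) * (b.2 - a.2)) / quadDist b a
  have hline : ∀ z ∈ S, z = (a.1 + τ z * (b.1 - a.1), a.2 + τ z * (b.2 - a.2)) := by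
    intro z hz
    have hz := (mem_filter.1 hz).2
    have hcross : (z.1 - a.1) * (b.2 - a.2) - (z.2 - a.2) * (b.1 - a.1) = 0 := by
      have h1 : (z.1 - a.1) * (r.1 - q.1) + (z.2 - a.2) * (r.2 - q.2) = 0 := by
        refine (mul_eq_zero.1 (?_ : (2 : F) * _ = 0)).resolve_left h2
        simp only [quadDist] at hz ha
        linear_combination hz - ha
      have h1' : (b.1 - a.1) * (r.1 - q.1) + (b.2 - a.2) * (r.2 - q.2) = 0 := by
        refine (mul_eq_zero.1 (?_ : (2 : F) * _ = 0)).resolve_left h2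
        simp only [quadDist] at hb ha
        linear_combination hb - ha
      refine (mul_eq_zero.1 (?_ : quadDist r q * _ = 0)).resolve_left (quadDist_ne_zero hsq hqr)
      simp only [quadDist]
      linear_combination ((r.1 - q.1) * (b.2 - a.2) - (r.2 - q.2) * (b.1 - a.1)) * h1 -
        ((r.1 - q.1) * (z.2 - a.2) - (r.2 - q.2) * (z.1 - a.1)) * h1'
    have hτ : τ z * quadDist b a = (z.1 - a.1) * (b.1 - a.1) + (z.2 - a.2) * (b.2 - a.2) :=
      div_mul_cancel₀ _ he
    refine Prod.ext (mul_left_cancel₀ he ?_) (mul_left_cancel₀ he ?_)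
    · simp only [quadDist] at hτ ⊢
      linear_combination (b.2 - a.2) * hcross - (b.1 - a.1) * hτ
    · simp only [quadDist] at hτ ⊢
      linear_combination -(b.1 - a.1) * hcross - (b.2 - a.2) * hτ
  have hτ0 : ∀ z ∈ (S.erase a).erase b, τ z ≠ 0 := by
    intro z hz h
    have hz' := mem_erase.1 (mem_of_mem_erase hz)
    have := hline z hz'.2
    rw [h] at this
    exact hz'.1 (this.trans (by simp))
  have hτ1 : ∀ z ∈ (S.erase a).erase b, 1 - τ z ≠ 0 := by
    intro z hz h
    have hz' := mem_erase.1 hz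
    have := hline z (mem_of_mem_erase hz'.2)
    rw [← sub_eq_zero.1 h] at this
    exact hz'.1 (this.trans (by simp))
  refine ⟨P.image fun z => (quadDist z a, quadDist z b), ?_,
    ((S.erase a).erase b).image fun z => τ z / (1 - τ z),
    card_le_two_mul_card_image_quadDist hsq P hab, ?_, ?_, ?_⟩
  · intro x hx
    obtain ⟨z, hz, rfl⟩ := mem_image.1 hx
    exact mem_product.2 ⟨quadDist_mem_distSet hz haP, quadDist_mem_distSet hz hbP⟩
  · intro l hl
    obtain ⟨z, hz, rfl⟩ := mem_image.1 hl
    exact div_ne_zero (hτ0 z hz) (hτ1 z hz)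
  · intro l hl
    obtain ⟨z, hz, rfl⟩ := mem_image.1 hl
    have h1 := hτ1 z hz
    have hzS := mem_of_mem_erase (mem_of_mem_erase hz)
    refine (card_le_card ?_).trans (card_image_le
      (f := fun s => (s + τ z * (1 - τ z) * quadDist b a) / (1 - τ z)))
    intro y hy
    obtain ⟨x, hx, rfl⟩ := mem_image.1 hy
    obtain ⟨w, hw, rfl⟩ := mem_image.1 hx
    refine mem_image.2 ⟨quadDist w z, quadDist_mem_distSet hw (mem_filter.1 hzS).1, ?_⟩
    have hstewart : quadDist w z + τ z * (1 - τ z) * quadDist b a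
        = (1 - τ z) * quadDist w a + τ z * quadDist w b := by
      have e1 : z.1 = a.1 + τ z * (b.1 - a.1) := congrArg Prod.fst (hline z hzS)
      have e2 : z.2 = a.2 + τ z * (b.2 - a.2) := congrArg Prod.snd (hline z hzS)
      generalize τ z = t at *
      simp only [quadDist, e1, e2]
      ring
    rw [hstewart]
    field_simp
  · have hinj : Set.InjOn (fun z => τ z / (1 - τ z)) ((S.erase a).erase b : Finset (F × F)) := by
      intro z hz w hw h
      have hz := mem_coe.1 hz
      have hw := mem_coe.1 hw
      have h1 := hτ1 z hz
      have h1' := hτ1 w hw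
      have h := (div_eq_div_iff h1 h1').1 h
      have hzw : τ z = τ w := by linear_combination h
      rw [hline z (mem_of_mem_erase (mem_of_mem_erase hz)),
        hline w (mem_of_mem_erase (mem_of_mem_erase hw)), hzw]
    rw [card_image_of_injOn hinj]
    have h1 := pred_card_le_card_erase (s := S) (a := a)
    have h2 := pred_card_le_card_erase (s := S.erase a) (a := b)
    exact hrich.trans (Nat.mul_le_mul_left _ (by omega))

end Distances

lemma ZMod.eq_zero_of_sq_add_sq_eq_zero {p : ℕ} [Fact p.Prime] (hp : p % 4 = 3) (x y : ZMod p)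
    (h : x ^ 2 + y ^ 2 = 0) : x = 0 ∧ y = 0 := by
  have hy : y = 0 := by
    by_contra hy
    refine ZMod.exists_sq_eq_neg_one_iff.1 ⟨x / y, ?_⟩ hp
    field_simp
    linear_combination -h
  subst hy
  exact ⟨by simpa using h, rfl⟩

lemma two_mul_lt_of_lt_rpow {N D : ℝ} (hN : 729 ≤ N) (hD : D < N ^ (2 / 3 : ℝ)) :
    2 * D < N := by
  have hN0 : 0 < N := by linarith
  have h1 : N ^ (2 / 3 : ℝ) * N ^ (1 / 3 : ℝ) = N := by
    rw [← Real.rpow_add hN0]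
    norm_num
  have h2 : 2 ≤ N ^ (1 / 3 : ℝ) := by
    refine le_of_pow_le_pow_left₀ (n := 3) (by norm_num) (by positivity) ?_
    rw [← Real.rpow_natCast (N ^ _), ← Real.rpow_mul hN0.le]
    norm_num
    linarith
  nlinarith [Real.rpow_pos_of_pos hN0 (2 / 3)]

lemma rpow_le_of_le_mul_add_three {N D l : ℝ} (hN : 729 ≤ N) (hD : D < N ^ (2 / 3 : ℝ))
    (hl : 0 ≤ l) (h : N ≤ D * (l + 3)) : 3 ≤ N ^ (1 / 6 : ℝ) ∧ N ^ (1 / 6 : ℝ) ≤ l := by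
  have hN0 : 0 < N := by linarith
  have h6 : (N ^ (1 / 6 : ℝ)) ^ 6 = N := by
    rw [← Real.rpow_natCast, ← Real.rpow_mul hN0.le]
    norm_num
  have h4 : (N ^ (1 / 6 : ℝ)) ^ 4 = N ^ (2 / 3 : ℝ) := by
    rw [← Real.rpow_natCast, ← Real.rpow_mul hN0.le]
    norm_num
  have h3 : 3 ≤ N ^ (1 / 6 : ℝ) := by
    refine le_of_pow_le_pow_left₀ (n := 6) (by norm_num) (by positivity) ?_
    rw [h6]
    linarith
  refine ⟨h3, ?_⟩
  have h1 : (N ^ (1 / 6 : ℝ)) ^ 4 * (N ^ (1 / 6 : ℝ)) ^ 2 ≤ (N ^ (1 / 6 : ℝ)) ^ 4 * (l + 3) := by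
    calc (N ^ (1 / 6 : ℝ)) ^ 4 * (N ^ (1 / 6 : ℝ)) ^ 2 = N := by rw [← pow_add, h6]
      _ ≤ D * (l + 3) := h
      _ ≤ (N ^ (1 / 6 : ℝ)) ^ 4 * (l + 3) := by rw [h4]; gcongr
  have h2 := le_of_mul_le_mul_left h1 (by positivity)
  nlinarith

lemma inv_density_le {N D ε : ℝ} (hN : 0 < N) (hD : 0 < D) (hDN : D ≤ N ^ (1 / 2 + ε : ℝ)) :
    2 ^ 19 / (N / (2 * D ^ 2)) ^ 9 ≤ 2 ^ 28 * N ^ (18 * ε : ℝ) := by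
  have h1 : 2 ^ 19 / (N / (2 * D ^ 2)) ^ 9 = 2 ^ 28 * (D ^ 18 / N ^ 9) := by
    rw [div_pow, mul_pow, ← pow_mul, div_div_eq_mul_div, ← mul_assoc, ← pow_add, mul_div_assoc]
  have h2 : D ^ 18 ≤ N ^ (18 * ε : ℝ) * N ^ 9 := by
    calc D ^ 18 ≤ (N ^ (1 / 2 + ε : ℝ)) ^ 18 := by gcongr
      _ = N ^ (18 * ε : ℝ) * N ^ 9 := by
          rw [← Real.rpow_natCast, ← Real.rpow_mul hN.le, ← Real.rpow_natCast N 9,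
            ← Real.rpow_add hN]
          congr 1
          push_cast
          ring
  rw [h1]
  gcongr
  rwa [div_le_iff₀ (by positivity)]

lemma rpow_le_of_density_bound {N D p α ε : ℝ} {C : ℕ} (hN : 1 ≤ N) (hD : 0 < D)
    (hp : N ^ (1 / α : ℝ) ≤ p) (hDN : D ≤ N ^ (1 / 2 + ε : ℝ)) (hε : 0 ≤ ε)
    (hε₁ : ε * (18 * C + 3) ≤ 1 / 2) (hε₂ : ε * (18 * C + 3) ≤ 1 / α - 1 / 2)
    (h : N / (2 * D ^ 2) / 4 * D * p ≤ (2 ^ 19 / (N / (2 * D ^ 2)) ^ 9) ^ C * (p + D ^ 2)) :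
    N ^ (1 / 2 + ε : ℝ) ≤ 2 ^ (28 * C) * 2 ^ 4 * D := by
  have hN0 : 0 < N := by linarith
  have hp0 : 0 < p := (Real.rpow_pos_of_pos hN0 _).trans_le hp
  have hpowC : (2 ^ 19 / (N / (2 * D ^ 2)) ^ 9) ^ C ≤ 2 ^ (28 * C) * N ^ (18 * ε * C : ℝ) := by
    calc _ ≤ (2 ^ 28 * N ^ (18 * ε : ℝ)) ^ C :=
          pow_le_pow_left₀ (by positivity) (inv_density_le hN0 hD hDN) C
      _ = _ := by rw [mul_pow, ← pow_mul, ← Real.rpow_natCast (N ^ _) C, ← Real.rpow_mul hN0.le]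
  have hD2 : D ^ 2 ≤ N ^ (1 + 2 * ε - 1 / α : ℝ) * p := by
    calc D ^ 2 ≤ (N ^ (1 / 2 + ε : ℝ)) ^ 2 := by gcongr
      _ = N ^ (1 + 2 * ε - 1 / α : ℝ) * N ^ (1 / α : ℝ) := by
          rw [← Real.rpow_natCast, ← Real.rpow_mul hN0.le, ← Real.rpow_add hN0]
          congr 1
          push_cast
          ring
      _ ≤ _ := by gcongr
  have hNle : N ≤ 8 * D * (2 ^ (28 * C) * N ^ (18 * ε * C : ℝ)) *
      (1 + N ^ (1 + 2 * ε - 1 / α : ℝ)) := by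
    refine le_of_mul_le_mul_right (a := p) ?_ hp0
    calc N * p = 8 * D * (N / (2 * D ^ 2) / 4 * D * p) := by field_simp; norm_num
      _ ≤ 8 * D * ((2 ^ (28 * C) * N ^ (18 * ε * C : ℝ)) *
          (p + N ^ (1 + 2 * ε - 1 / α : ℝ) * p)) :=
          mul_le_mul_of_nonneg_left
            (h.trans (mul_le_mul hpowC (by linarith) (by positivity) (by positivity)))
            (by positivity)
      _ = _ := by ring
  have hexp : ∀ x : ℝ, x ≤ 1 → N ^ x ≤ N := fun x hx =>
    (Real.rpow_le_rpow_of_exponent_le hN hx).trans_eq (Real.rpow_one N)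
  have e1 : N ^ (1 / 2 + ε : ℝ) * N ^ (18 * ε * C : ℝ) ≤ N := by
    rw [← Real.rpow_add hN0]
    exact hexp _ (by linarith)
  have e2 : N ^ (1 / 2 + ε : ℝ) * N ^ (18 * ε * C : ℝ) * N ^ (1 + 2 * ε - 1 / α : ℝ) ≤ N := by
    rw [← Real.rpow_add hN0, ← Real.rpow_add hN0]
    exact hexp _ (by linarith)
  refine le_of_mul_le_mul_right (a := N) ?_ hN0
  calc N ^ (1 / 2 + ε : ℝ) * N ≤ N ^ (1 / 2 + ε : ℝ) *
        (8 * D * (2 ^ (28 * C) * N ^ (18 * ε * C : ℝ)) * (1 + N ^ (1 + 2 * ε - 1 / α : ℝ))) :=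
        mul_le_mul_of_nonneg_left hNle (by positivity)
    _ = 8 * D * 2 ^ (28 * C) * (N ^ (1 / 2 + ε : ℝ) * N ^ (18 * ε * C : ℝ) +
        N ^ (1 / 2 + ε : ℝ) * N ^ (18 * ε * C : ℝ) * N ^ (1 + 2 * ε - 1 / α : ℝ)) := by ring
    _ ≤ 8 * D * 2 ^ (28 * C) * (N + N) :=
        mul_le_mul_of_nonneg_left (add_le_add e1 e2) (by positivity)
    _ = 2 ^ (28 * C) * 2 ^ 4 * D * N := by ring

theorem distance_set_bound :
    ∀ α : ℝ, 0 < α → α < 2 →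
      ∃ ε : ℝ, 0 < ε ∧ ∃ c : ℝ, 0 < c ∧
        ∀ p : ℕ, p.Prime → p % 4 = 3 →
          ∀ P : Finset (ZMod p × ZMod p),
            (1 / 2 : ℝ) * (p : ℝ) ^ α ≤ (P.card : ℝ) → (P.card : ℝ) ≤ (p : ℝ) ^ α →
            c * (P.card : ℝ) ^ (1 / 2 + ε : ℝ) ≤
              (((P ×ˢ P).image fun x =>
                  (x.1.1 - x.2.1) ^ 2 + (x.1.2 - x.2.2) ^ 2).card : ℝ) := by
  intro α hα hα2
  obtain ⟨k, hk⟩ := pow_unbounded_of_one_lt (12 / α) (one_lt_two (α := ℝ))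
  obtain ⟨C, hC⟩ := exists_bound_of_partialSums k
  have hβ : 0 < min (1 / 2) (1 / α - 1 / 2) :=
    lt_min (by norm_num) (sub_pos.2 (one_div_lt_one_div_of_lt hα hα2))
  obtain ⟨ε, hε, hεβ⟩ : ∃ ε : ℝ, 0 < ε ∧ ε * (18 * C + 3) = min (1 / 2) (1 / α - 1 / 2) :=
    ⟨min (1 / 2) (1 / α - 1 / 2) / (18 * C + 3), by positivity, div_mul_cancel₀ _ (by positivity)⟩
  have hε₁ : ε * (18 * C + 3) ≤ 1 / 2 := hεβ.trans_le (min_le_left _ _)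
  have hε₂ : ε * (18 * C + 3) ≤ 1 / α - 1 / 2 := hεβ.trans_le (min_le_right _ _)
  have hεC : 0 ≤ ε * C := by positivity
  refine ⟨ε, hε, 1 / (2 ^ (28 * C) * 2 ^ 10), by positivity, fun p hp hp4 P hlow hup => ?_⟩
  have : Fact p.Prime := ⟨hp⟩
  change _ ≤ (#(distSet P) : ℝ)
  have hp0 : (0 : ℝ) < p := by exact_mod_cast hp.pos
  have hP0 : (0 : ℝ) < #P := lt_of_lt_of_le (by positivity) hlow
  have hP1 : (1 : ℝ) ≤ #P := by exact_mod_cast (Nat.cast_pos.1 hP0 : 0 < #P)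
  have hXne : (distSet P).Nonempty := by
    obtain ⟨x, hx⟩ := card_pos.1 (Nat.cast_pos.1 hP0)
    exact ⟨_, quadDist_mem_distSet hx hx⟩
  have hX1 : (1 : ℝ) ≤ #(distSet P) := by exact_mod_cast hXne.card_pos
  by_contra! hlt
  rw [one_div, ← div_eq_inv_mul, lt_div_iff₀ (by positivity)] at hlt
  have hc1 : (1 : ℝ) ≤ 2 ^ (28 * C) := one_le_pow₀ (by norm_num)
  have hDN : (#(distSet P) : ℝ) < (#P : ℝ) ^ (1 / 2 + ε : ℝ) := by nlinarith
  have hDN' : (#(distSet P) : ℝ) < (#P : ℝ) ^ (2 / 3 : ℝ) :=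
    hDN.trans_le (Real.rpow_le_rpow_of_exponent_le hP1 (by linarith))
  have hN0 : (729 : ℝ) ≤ #P := by
    have h1 : (#P : ℝ) ^ (1 / 2 + ε : ℝ) ≤ #P :=
      (Real.rpow_le_rpow_of_exponent_le hP1 (by linarith)).trans_eq (Real.rpow_one _)
    nlinarith
  have h2D : 2 * #(distSet P) < #P := by exact_mod_cast two_mul_lt_of_lt_rpow hN0 hDN'
  obtain ⟨G, hG, L, hPG, hL0, hL, hPL⟩ :=
    exists_partialSums (ZMod.eq_zero_of_sq_add_sq_eq_zero hp4) h2D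
  have hPG' : (#P : ℝ) ≤ 2 * #G := by exact_mod_cast hPG
  obtain ⟨hy3, hyL⟩ := rpow_le_of_le_mul_add_three hN0 hDN' (Nat.cast_nonneg #L)
    (by exact_mod_cast hPL)
  have hL2 : 2 ≤ #L := by
    have : (2 : ℝ) ≤ #L := by linarith
    exact_mod_cast this
  have hpN : (p : ℝ) ≤ (#P : ℝ) ^ (2 / α : ℝ) := by
    have h1 : (p : ℝ) ^ α ≤ (#P : ℝ) ^ (2 : ℝ) := by
      rw [Real.rpow_two]
      nlinarith
    have h2 := Real.rpow_le_rpow (by positivity) h1 (inv_nonneg.2 hα.le)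
    rwa [Real.rpow_rpow_inv hp0.le hα.ne', ← Real.rpow_mul hP0.le, ← div_eq_mul_inv] at h2
  have hpL : p < #L ^ 2 ^ k := by
    have : (p : ℝ) < (#L : ℝ) ^ 2 ^ k := by
      calc (p : ℝ) ≤ (#P : ℝ) ^ (2 / α : ℝ) := hpN
        _ < (#P : ℝ) ^ ((1 / 6 : ℝ) * (2 ^ k : ℕ)) := by
            refine Real.rpow_lt_rpow_of_exponent_lt (by linarith) ?_
            have : 12 / α = 6 * (2 / α) := by ring
            push_cast
            linarith
        _ = ((#P : ℝ) ^ (1 / 6 : ℝ)) ^ 2 ^ k := by rw [Real.rpow_mul hP0.le, Real.rpow_natCast]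
        _ ≤ (#L : ℝ) ^ 2 ^ k := by gcongr
    exact_mod_cast this
  have hpow : (#P : ℝ) ^ (1 / α : ℝ) ≤ p := by
    have h2 := Real.rpow_le_rpow hP0.le hup (inv_nonneg.2 hα.le)
    rwa [Real.rpow_rpow_inv hp0.le hα.ne', ← one_div] at h2
  have hGd : (#P : ℝ) / (2 * #(distSet P) ^ 2) * #(distSet P) ^ 2 ≤ #G := by
    have : (#P : ℝ) / (2 * #(distSet P) ^ 2) * #(distSet P) ^ 2 = #P / 2 := by field_simp
    linarith
  have key := rpow_le_of_density_bound hP1 (by linarith) hpow hDN.le hε.le hε₁ hε₂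
    (hC p (distSet P) G _ L hG (by positivity) hXne hGd hL0 hL hL2 hpL)
  nlinarith
end
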